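/- Under the a priori hypotheses, for every ε ∈ (0,T) there exists D₂ = D₂(Ω, ε, T, C_φ, C_f, C_u) such that Δu ≤ D₂ on Ω×(ε,T), where Δ is the Euclidean Laplacian in the spatial variables. -/

import Mathlib

open Set Metric Complex Topology Filter Bornology
open scoped ComplexOrder

noncomputable section

/-- `ℂⁿ` with its Euclidean structure. -/
abbrev Cn (n : ℕ) := EuclideanSpace ℂ (Fin n)

/-- The `α`-th coordinate vector scaled by `c`. -/
def cvec (n : ℕ) (α : Fin n) (c : ℂ) : Cn n := EuclideanSpace.single α c

variable {n : ℕ}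

/-- Wirtinger derivative `∂/∂z_α` (within a set), via the real Fréchet derivative. -/
def wderW (s : Set (Cn n)) (α : Fin n) (u : Cn n → ℂ) (z : Cn n) : ℂ :=
  (fderivWithin ℝ u s z (cvec n α 1) - Complex.I * fderivWithin ℝ u s z (cvec n α Complex.I)) / 2

/-- Conjugate Wirtinger derivative `∂/∂z̄_β` (within a set). -/
def wderBarW (s : Set (Cn n)) (β : Fin n) (u : Cn n → ℂ) (z : Cn n) : ℂ :=
  (fderivWithin ℝ u s z (cvec n β 1) + Complex.I * fderivWithin ℝ u s z (cvec n β Complex.I)) / 2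

/-- The complex Hessian matrix `u_{αβ̄} = ∂²u/∂z_α ∂z̄_β` of a real valued function,
computed within a set `s`. -/
def cHessW (s : Set (Cn n)) (u : Cn n → ℝ) (z : Cn n) : Matrix (Fin n) (Fin n) ℂ :=
  Matrix.of fun α β => wderW s α (wderBarW s β fun w => (u w : ℂ)) z

/-- The complex Hessian matrix `u_{αβ̄}`. -/
def cHess (u : Cn n → ℝ) : Cn n → Matrix (Fin n) (Fin n) ℂ := cHessW univ u

/-- The Euclidean Laplacian (within a set) of `v : ℂⁿ → ℝ`, i.e. the sum of all pure second
derivatives in the `2n` underlying real coordinate directions. -/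
def lapW (s : Set (Cn n)) (v : Cn n → ℝ) (z : Cn n) : ℝ :=
  ∑ α : Fin n,
    (fderivWithin ℝ (fun y => fderivWithin ℝ v s y (cvec n α 1)) s z (cvec n α 1) +
      fderivWithin ℝ (fun y => fderivWithin ℝ v s y (cvec n α Complex.I)) s z
        (cvec n α Complex.I))

/-- The Euclidean Laplacian of `v : ℂⁿ → ℝ`. -/
def lap (v : Cn n → ℝ) : Cn n → ℝ := lapW univ v

/-- A bounded smooth strictly pseudoconvex domain of `ℂⁿ`: a bounded (nonempty) domain with a
smooth strictly plurisubharmonic defining function `ρ` on a bounded neighbourhood of its closure,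
with nonvanishing differential on the boundary. -/
def IsSPCDomain (Ω : Set (Cn n)) : Prop :=
  IsOpen Ω ∧ Ω.Nonempty ∧ IsBounded Ω ∧
    ∃ (U : Set (Cn n)) (ρ : Cn n → ℝ), IsOpen U ∧ IsBounded U ∧ closure Ω ⊆ U ∧
      ContDiffOn ℝ (⊤ : ℕ∞) ρ U ∧ (∀ z ∈ U, (cHess ρ z).PosDef) ∧
      Ω = {z ∈ U | ρ z < 0} ∧ ∀ z ∈ frontier Ω, fderiv ℝ ρ z ≠ 0

/-- Membership in `C^{2;1}(Ω̄ × [0,T))`: `u(·,t) ∈ C²(Ω̄)` for each `t ∈ [0,T)`,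
`u(z,·) ∈ C¹([0,T))` for each `z ∈ Ω̄`, and `∂u/∂t` together with all second spatial
derivatives are continuous on `Ω̄ × [0,T)`. -/
def C21 (n : ℕ) (Ω : Set (Cn n)) (T : ℝ) (u : Cn n × ℝ → ℝ) : Prop :=
  (∀ t ∈ Ico (0 : ℝ) T, ContDiffOn ℝ 2 (fun z => u (z, t)) (closure Ω)) ∧
  (∀ z ∈ closure Ω, ContDiffOn ℝ 1 (fun s => u (z, s)) (Ico (0 : ℝ) T)) ∧
  ContinuousOn (fun p : Cn n × ℝ => derivWithin (fun s => u (p.1, s)) (Ico (0 : ℝ) T) p.2)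
    (closure Ω ×ˢ Ico (0 : ℝ) T) ∧
  ∀ v w : Cn n, ContinuousOn
    (fun p : Cn n × ℝ =>
      fderivWithin ℝ (fun y => fderivWithin ℝ (fun x => u (x, p.2)) (closure Ω) y v)
        (closure Ω) p.1 w)
    (closure Ω ×ˢ Ico (0 : ℝ) T)

/-- The hypotheses of the a priori estimates theorem: `φ ∈ C^∞(Ω̄×[0,T))`,
`f ∈ C^∞([0,T)×Ω̄×ℝ)`, `u ∈ C^∞(Ω×(0,T)) ∩ C^{2;1}(Ω̄×[0,T))` is strictly plurisubharmonic
in `z` and solves `∂u/∂t = log det(u_{αβ̄}) + f(t,z,u)` on `Ω×(0,T)` with `u = φ` on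
`∂Ω×[0,T)`, `sup_Ω |u(·,0)| ≤ Cu`, `f` nonincreasing in the last variable,
`‖f‖_{C²((0,T)×Ω×ℝ)} ≤ Cf` and `‖φ‖_{C⁴(Ω×(0,T))} ≤ Cφv` (parabolic norm). -/
def AprioriHyps (n : ℕ) (Ω : Set (Cn n)) (T Cu Cφv Cf : ℝ)
    (u φ : Cn n × ℝ → ℝ) (f : ℝ × Cn n × ℝ → ℝ) : Prop :=
  ContDiffOn ℝ (⊤ : ℕ∞) φ (closure Ω ×ˢ Ico (0 : ℝ) T) ∧
  ContDiffOn ℝ (⊤ : ℕ∞) f (Ico (0 : ℝ) T ×ˢ closure Ω ×ˢ (univ : Set ℝ)) ∧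
  ContDiffOn ℝ (⊤ : ℕ∞) u (Ω ×ˢ Ioo (0 : ℝ) T) ∧
  C21 n Ω T u ∧
  (∀ t ∈ Ioo (0 : ℝ) T, ∀ z ∈ Ω, (cHess (fun w => u (w, t)) z).PosDef) ∧
  (∀ z ∈ Ω, ∀ t ∈ Ioo (0 : ℝ) T,
    deriv (fun s => u (z, s)) t
      = Real.log ((cHess (fun w => u (w, t)) z).det.re) + f (t, z, u (z, t))) ∧
  (∀ z ∈ frontier Ω, ∀ t ∈ Ico (0 : ℝ) T, u (z, t) = φ (z, t)) ∧
  (∀ z ∈ Ω, |u (z, 0)| ≤ Cu) ∧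
  (∀ t ∈ Ioo (0 : ℝ) T, ∀ z ∈ Ω, ∀ r : ℝ, deriv (fun y => f (t, z, y)) r ≤ 0) ∧
  (∀ k : ℕ, k ≤ 2 → ∀ p ∈ Ioo (0 : ℝ) T ×ˢ Ω ×ˢ (univ : Set ℝ),
    ‖iteratedFDeriv ℝ k f p‖ ≤ Cf) ∧
  (∀ j l : ℕ, j + 2 * l ≤ 4 → ∀ z ∈ Ω, ∀ t ∈ Ioo (0 : ℝ) T,
    ‖iteratedFDeriv ℝ j (fun w => iteratedDeriv l (fun s => φ (w, s)) t) z‖ ≤ Cφv)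

open scoped ContDiff

/-! ### Directional derivatives and jets -/

section Calc

variable {W : Type*} [NormedAddCommGroup W] [NormedSpace ℝ W]

/-- Directional derivative. -/
def dd (w : W) (g : W → ℝ) : W → ℝ := fun p => fderiv ℝ g p w

theorem dd_smooth {Q : Set W} (hQ : IsOpen Q) {g : W → ℝ} (hg : ContDiffOn ℝ ∞ g Q) (w : W) :
    ContDiffOn ℝ ∞ (dd w g) Q := by
  have h := hg.fderiv_of_isOpen (m := ∞) hQ (by simp)
  exact h.clm_apply contDiffOn_const

theorem smooth_at {Q : Set W} (hQ : IsOpen Q) {g : W → ℝ} (hg : ContDiffOn ℝ ∞ g Q) {p : W}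
    (hp : p ∈ Q) (k : ℕ) : ContDiffAt ℝ k g p :=
  (hg.contDiffAt (hQ.mem_nhds hp)).of_le (by exact_mod_cast le_top)

theorem smooth_at2 {Q : Set W} (hQ : IsOpen Q) {g : W → ℝ} (hg : ContDiffOn ℝ ∞ g Q) {p : W}
    (hp : p ∈ Q) : ContDiffAt ℝ 2 g p := smooth_at hQ hg hp 2

theorem smooth_diff {Q : Set W} (hQ : IsOpen Q) {g : W → ℝ} (hg : ContDiffOn ℝ ∞ g Q) {p : W}
    (hp : p ∈ Q) : DifferentiableAt ℝ g p :=
  (smooth_at hQ hg hp 1).differentiableAt (by norm_num)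

theorem cd2_diff {g : W → ℝ} {p : W} (h : ContDiffAt ℝ 2 g p) : DifferentiableAt ℝ g p :=
  h.differentiableAt (by norm_num)

theorem cd2_ev {g : W → ℝ} {p : W} (h : ContDiffAt ℝ 2 g p) :
    ∀ᶠ q in 𝓝 p, DifferentiableAt ℝ g q := by
  filter_upwards [h.eventually (by simp)] with q hq using cd2_diff hq

theorem cd2_dd {g : W → ℝ} {p : W} (h : ContDiffAt ℝ 2 g p) (w : W) :
    ContDiffAt ℝ 1 (dd w g) p := by
  have := h.fderiv_right (m := 1) (by norm_num)
  exact this.clm_apply contDiffAt_const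

theorem cd2_dd_diff {g : W → ℝ} {p : W} (h : ContDiffAt ℝ 2 g p) (w : W) :
    DifferentiableAt ℝ (dd w g) p := (cd2_dd h w).differentiableAt (by norm_num)

theorem dd_congr {g h : W → ℝ} {p : W} (e : g =ᶠ[𝓝 p] h) (w : W) : dd w g p = dd w h p := by
  unfold dd; rw [e.fderiv_eq]

theorem dd_congr_ev {g h : W → ℝ} {p : W} (e : g =ᶠ[𝓝 p] h) (w : W) :
    dd w g =ᶠ[𝓝 p] dd w h := by
  filter_upwards [e.eventuallyEq_nhds] with q hq using dd_congr hq w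

theorem dd_add_dir (g : W → ℝ) (v w p : W) : dd (v + w) g p = dd v g p + dd w g p := by
  simp [dd]

theorem dd_smul_dir (g : W → ℝ) (c : ℝ) (w : W) (p : W) : dd (c • w) g p = c * dd w g p := by
  simp [dd]

/-- second derivative through the iterated Frechet derivative -/
theorem dd_dd {g : W → ℝ} {p : W} (h : ContDiffAt ℝ 2 g p) (v w : W) :
    dd v (dd w g) p = fderiv ℝ (fderiv ℝ g) p v w := by
  have h1 : DifferentiableAt ℝ (fderiv ℝ g) p :=
    (h.fderiv_right (m := 1) (by norm_num)).differentiableAt (by norm_num)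
  unfold dd
  rw [fderiv_clm_apply h1 (differentiableAt_const w)]
  simp

theorem dd_comm2 {g : W → ℝ} {p : W} (h : ContDiffAt ℝ 2 g p) (v w : W) :
    dd v (dd w g) p = dd w (dd v g) p := by
  rw [dd_dd h, dd_dd h]
  exact h.isSymmSndFDerivAt (by simp) v w

theorem dd_comm_on {Q : Set W} (hQ : IsOpen Q) {g : W → ℝ} (hg : ContDiffOn ℝ ∞ g Q)
    (v w : W) {p : W} (hp : p ∈ Q) : dd v (dd w g) p = dd w (dd v g) p :=
  dd_comm2 (smooth_at2 hQ hg hp) v w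

theorem dd_eqOn {Q : Set W} (hQ : IsOpen Q) {g h : W → ℝ} (e : EqOn g h Q) (w : W) :
    EqOn (dd w g) (dd w h) Q := fun p hp =>
  dd_congr (Filter.eventuallyEq_of_mem (hQ.mem_nhds hp) e) w

theorem dd_comm3 {Q : Set W} (hQ : IsOpen Q) {g : W → ℝ} (hg : ContDiffOn ℝ ∞ g Q)
    (v w x : W) {p : W} (hp : p ∈ Q) :
    dd v (dd w (dd x g)) p = dd w (dd x (dd v g)) p := by
  rw [dd_comm_on hQ (dd_smooth hQ hg x) v w hp]
  exact dd_eqOn hQ (fun q hq => dd_comm_on hQ hg v x hq) w hp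

theorem dd_comm4 {Q : Set W} (hQ : IsOpen Q) {g : W → ℝ} (hg : ContDiffOn ℝ ∞ g Q)
    (v w x y : W) {p : W} (hp : p ∈ Q) :
    dd v (dd w (dd x (dd y g))) p = dd x (dd y (dd v (dd w g))) p := by
  have h1 : EqOn (dd w (dd x (dd y g))) (dd x (dd y (dd w g))) Q := fun q hq =>
    dd_comm3 hQ hg w x y hq
  rw [dd_eqOn hQ h1 v hp]
  exact dd_comm3 hQ (dd_smooth hQ hg w) v x y hp

theorem dd_add {g k : W → ℝ} {p : W} (w : W) (hg : DifferentiableAt ℝ g p)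
    (hk : DifferentiableAt ℝ k p) : dd w (fun q => g q + k q) p = dd w g p + dd w k p := by
  unfold dd; rw [fderiv_fun_add hg hk]; rfl

theorem dd_mul {g k : W → ℝ} {p : W} (w : W) (hg : DifferentiableAt ℝ g p)
    (hk : DifferentiableAt ℝ k p) :
    dd w (fun q => g q * k q) p = g p * dd w k p + k p * dd w g p := by
  unfold dd; rw [fderiv_fun_mul hg hk]; rfl

/-- 2-jets along directions. -/
structure HasJet (g : W → ℝ) (p : W) (a h : W → ℝ) : Prop where
  cd : ContDiffAt ℝ 2 g p
  h1 : ∀ w, dd w g p = a w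
  h2 : ∀ w, dd w (dd w g) p = h w

theorem HasJet.of_cd {g : W → ℝ} {p : W} (h : ContDiffAt ℝ 2 g p) :
    HasJet g p (fun w => dd w g p) (fun w => dd w (dd w g) p) := ⟨h, fun _ => rfl, fun _ => rfl⟩

theorem HasJet.of_smooth {Q : Set W} (hQ : IsOpen Q) {g : W → ℝ} (hg : ContDiffOn ℝ ∞ g Q)
    {p : W} (hp : p ∈ Q) :
    HasJet g p (fun w => dd w g p) (fun w => dd w (dd w g) p) := .of_cd (smooth_at2 hQ hg hp)

theorem HasJet.congr' {g : W → ℝ} {p : W} {a h a' h' : W → ℝ} (H : HasJet g p a h)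
    (ha : ∀ w, a w = a' w) (hh : ∀ w, h w = h' w) : HasJet g p a' h' :=
  ⟨H.cd, fun w => (H.h1 w).trans (ha w), fun w => (H.h2 w).trans (hh w)⟩

theorem HasJet.congr_ev {g k : W → ℝ} {p : W} {a h : W → ℝ} (H : HasJet g p a h)
    (e : k =ᶠ[𝓝 p] g) : HasJet k p a h :=
  ⟨H.cd.congr_of_eventuallyEq e, fun w => (dd_congr e w).trans (H.h1 w),
    fun w => (dd_congr (dd_congr_ev e w) w).trans (H.h2 w)⟩

theorem HasJet.add {g k : W → ℝ} {p : W} {a h a' h' : W → ℝ} (G : HasJet g p a h)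
    (K : HasJet k p a' h') :
    HasJet (fun q => g q + k q) p (fun w => a w + a' w) (fun w => h w + h' w) := by
  refine ⟨G.cd.add K.cd, fun w => ?_, fun w => ?_⟩
  · rw [← G.h1, ← K.h1, dd_add w (cd2_diff G.cd) (cd2_diff K.cd)]
  · have e : dd w (fun q => g q + k q) =ᶠ[𝓝 p] fun q => dd w g q + dd w k q := by
      filter_upwards [cd2_ev G.cd, cd2_ev K.cd] with q h1 h2 using dd_add w h1 h2
    rw [dd_congr e, ← G.h2, ← K.h2, dd_add w (cd2_dd_diff G.cd w) (cd2_dd_diff K.cd w)]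

theorem HasJet.mul {g k : W → ℝ} {p : W} {a h a' h' : W → ℝ} (G : HasJet g p a h)
    (K : HasJet k p a' h') :
    HasJet (fun q => g q * k q) p (fun w => g p * a' w + k p * a w)
      (fun w => g p * h' w + k p * h w + 2 * a w * a' w) := by
  refine ⟨G.cd.mul K.cd, fun w => ?_, fun w => ?_⟩
  · rw [← G.h1, ← K.h1, dd_mul w (cd2_diff G.cd) (cd2_diff K.cd)]
  · have e : dd w (fun q => g q * k q) =ᶠ[𝓝 p] fun q => g q * dd w k q + k q * dd w g q := by
      filter_upwards [cd2_ev G.cd, cd2_ev K.cd] with q h1 h2 using dd_mul w h1 h2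
    have d1 := cd2_diff G.cd
    have d2 := cd2_diff K.cd
    have d3 := cd2_dd_diff G.cd w
    have d4 := cd2_dd_diff K.cd w
    rw [dd_congr e, ← G.h2, ← K.h2, ← G.h1, ← K.h1, dd_add w (d1.fun_mul d4) (d2.fun_mul d3),
      dd_mul w d1 d4, dd_mul w d2 d3]
    ring

theorem HasJet.const (c : ℝ) (p : W) : HasJet (fun _ => c) p (fun _ => 0) (fun _ => 0) := by
  refine ⟨contDiffAt_const, fun w => by simp [dd], fun w => ?_⟩
  have : dd w (fun _ : W => c) = fun _ => 0 := by funext q; simp [dd]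
  rw [this]; simp [dd]

theorem HasJet.const_mul {g : W → ℝ} {p : W} {a h : W → ℝ} (c : ℝ) (G : HasJet g p a h) :
    HasJet (fun q => c * g q) p (fun w => c * a w) (fun w => c * h w) :=
  ((HasJet.const c p).mul G).congr' (fun w => by ring) (fun w => by ring)

theorem HasJet.neg {g : W → ℝ} {p : W} {a h : W → ℝ} (G : HasJet g p a h) :
    HasJet (fun q => - g q) p (fun w => - a w) (fun w => - h w) :=
  ((G.const_mul (-1)).congr' (fun w => by ring) (fun w => by ring)).congr_ev
    (Filter.Eventually.of_forall fun q => by ring)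

theorem HasJet.sub {g k : W → ℝ} {p : W} {a h a' h' : W → ℝ} (G : HasJet g p a h)
    (K : HasJet k p a' h') :
    HasJet (fun q => g q - k q) p (fun w => a w - a' w) (fun w => h w - h' w) :=
  ((G.add K.neg).congr' (fun w => by ring) (fun w => by ring)).congr_ev
    (Filter.Eventually.of_forall fun q => by ring)

theorem HasJet.sq {g : W → ℝ} {p : W} {a h : W → ℝ} (G : HasJet g p a h) :
    HasJet (fun q => g q ^ 2) p (fun w => 2 * g p * a w)
      (fun w => 2 * g p * h w + 2 * (a w) ^ 2) :=
  ((G.mul G).congr' (fun w => by ring) (fun w => by ring)).congr_ev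
    (Filter.Eventually.of_forall fun q => by ring)

theorem HasJet.exp {g : W → ℝ} {p : W} {a h : W → ℝ} (G : HasJet g p a h) :
    HasJet (fun q => Real.exp (g q)) p (fun w => Real.exp (g p) * a w)
      (fun w => Real.exp (g p) * (h w + (a w) ^ 2)) := by
  refine ⟨G.cd.exp, fun w => ?_, fun w => ?_⟩
  · rw [← G.h1]; unfold dd
    rw [fderiv_exp (cd2_diff G.cd)]; rfl
  · have e : dd w (fun q => Real.exp (g q)) =ᶠ[𝓝 p] fun q => Real.exp (g q) * dd w g q := by
      filter_upwards [cd2_ev G.cd] with q h1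
      unfold dd; rw [fderiv_exp h1]; rfl
    rw [dd_congr e, ← G.h2, ← G.h1]
    have d1 := (cd2_diff G.cd)
    have d3 := cd2_dd_diff G.cd w
    have e3 : dd w (fun q => Real.exp (g q)) p = Real.exp (g p) * dd w g p := e.self_of_nhds
    rw [dd_mul w d1.exp d3, e3]
    ring

theorem HasJet.clm (l : W →L[ℝ] ℝ) (p : W) : HasJet (fun q => l q) p (fun w => l w)
    (fun _ => 0) := by
  refine ⟨l.contDiff.contDiffAt, fun w => by simp [dd], fun w => ?_⟩
  have : dd w (fun q => l q) = fun _ => l w := by funext q; simp [dd]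
  rw [this]; simp [dd]

theorem HasJet.sum {ι : Type*} (s : Finset ι) {g : ι → W → ℝ} {p : W} {a h : ι → W → ℝ}
    (G : ∀ i ∈ s, HasJet (g i) p (a i) (h i)) :
    HasJet (fun q => ∑ i ∈ s, g i q) p (fun w => ∑ i ∈ s, a i w) (fun w => ∑ i ∈ s, h i w) := by
  classical
  induction s using Finset.induction_on with
  | empty => simpa using HasJet.const (0:ℝ) p
  | insert i s his ih =>
    have h1 := (G i (Finset.mem_insert_self i s)).add
      (ih fun j hj => G j (Finset.mem_insert_of_mem hj))
    refine (h1.congr' (fun w => ?_) (fun w => ?_)).congr_ev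
      (Filter.Eventually.of_forall fun q => ?_)
    · rw [Finset.sum_insert his]
    · rw [Finset.sum_insert his]
    · simp only [Finset.sum_insert his]

/-- one variable second derivative test -/
theorem second_deriv_max {g g' : ℝ → ℝ} {c : ℝ} (hg : ∀ᶠ r in 𝓝 (0:ℝ), HasDerivAt g (g' r) r)
    (hg' : HasDerivAt g' c 0) (hmax : ∀ᶠ r in 𝓝 (0:ℝ), g r ≤ g 0) : c ≤ 0 := by
  by_contra hc
  push Not at hc
  have h0 : g' 0 = 0 := IsLocalMax.hasDerivAt_eq_zero hmax hg.self_of_nhds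
  have e : deriv g =ᶠ[𝓝 0] g' := by
    filter_upwards [hg] with r hr using hr.deriv
  have hmin : IsLocalMin g 0 := by
    apply isLocalMin_of_deriv_deriv_pos
    · rw [e.deriv_eq, hg'.deriv]; exact hc
    · rw [e.self_of_nhds, h0]
    · exact hg.self_of_nhds.continuousAt
  have hconst : g =ᶠ[𝓝 0] fun _ => g 0 := by
    filter_upwards [hmin, hmax] with r h1 h2 using le_antisymm h2 h1
  have e2 : g' =ᶠ[𝓝 0] fun _ => 0 := by
    filter_upwards [e, hconst.eventuallyEq_nhds] with r h1 h2
    rw [← h1, h2.deriv_eq]; simp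
  have : c = 0 := by
    have h3 := e2.deriv_eq
    rw [hg'.deriv] at h3; simpa using h3
  linarith

theorem line_hasDeriv {g : W → ℝ} {p : W} (w : W) (r : ℝ)
    (h : DifferentiableAt ℝ g (p + r • w)) :
    HasDerivAt (fun s : ℝ => g (p + s • w)) (dd w g (p + r • w)) r := by
  have h1 : HasDerivAt (fun s : ℝ => p + s • w) w r := by
    simpa using ((hasDerivAt_id r).smul_const w).const_add p
  have h2 := h.hasFDerivAt.comp_hasDerivAt r h1
  exact h2

theorem line_tendsto (p w : W) : Tendsto (fun s : ℝ => p + s • w) (𝓝 0) (𝓝 p) := by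
  have : Continuous fun s : ℝ => p + s • w := by fun_prop
  simpa using this.tendsto 0

/-- At a local max along a line, first derivative vanishes and the second is nonpositive. -/
theorem HasJet.max_dir {g : W → ℝ} {p : W} {a h : W → ℝ} (G : HasJet g p a h) (w : W)
    (hmax : ∀ᶠ r in 𝓝 (0:ℝ), g (p + r • w) ≤ g p) : a w = 0 ∧ h w ≤ 0 := by
  have hd : ∀ᶠ r in 𝓝 (0:ℝ), HasDerivAt (fun s : ℝ => g (p + s • w)) (dd w g (p + r • w)) r := by
    filter_upwards [(line_tendsto p w).eventually (cd2_ev G.cd)] with r hr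
    exact line_hasDeriv w r hr
  have hd2 : HasDerivAt (fun s : ℝ => dd w g (p + s • w)) (dd w (dd w g) p) 0 := by
    have := line_hasDeriv (g := dd w g) (p := p) w 0 (by simpa using cd2_dd_diff G.cd w)
    simpa using this
  have hmaxB : ∀ᶠ r in 𝓝 (0:ℝ), (fun s : ℝ => g (p + s • w)) r ≤ (fun s : ℝ => g (p + s • w)) 0 := by
    simpa using hmax
  refine ⟨?_, ?_⟩
  · have := IsLocalMax.hasDerivAt_eq_zero hmaxB hd.self_of_nhds
    rw [← G.h1]; simpa using this
  · rw [← G.h2]; exact second_deriv_max hd hd2 hmaxB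

/-- At a one-sided (past) max along a direction the derivative is nonnegative. -/
theorem HasJet.max_past {g : W → ℝ} {p : W} {a h : W → ℝ} (G : HasJet g p a h) (w : W)
    (hmax : ∀ᶠ r in 𝓝[<] (0:ℝ), g (p + r • w) ≤ g p) : 0 ≤ a w := by
  rw [← G.h1]
  have hd := line_hasDeriv (g := g) (p := p) w 0 (by simpa using cd2_diff G.cd)
  have h2 := (hasDerivAt_iff_tendsto_slope.1 hd)
  have h3 : Tendsto (slope (fun s : ℝ => g (p + s • w)) 0) (𝓝[<] 0) (𝓝 (dd w g p)) := by
    have := h2.mono_left (nhdsWithin_mono (0:ℝ) (s := Iio 0) (t := {0}ᶜ)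
      (fun x hx => by simpa using (ne_of_lt hx)))
    simpa using this
  refine ge_of_tendsto h3 ?_
  filter_upwards [hmax, self_mem_nhdsWithin] with r h1 h4
  simp only [slope_def_field, zero_smul, add_zero, sub_zero]
  exact div_nonneg_of_nonpos (by linarith) (le_of_lt h4)

end Calc

/-! ### Maximum principles on `ℂⁿ × ℝ` -/

/-- space-time -/
abbrev En (n : ℕ) := Cn n × ℝ

/-- spatial direction -/
def sx (v : Cn n) : En n := (v, 0)

/-- time direction -/
def st : En n := (0, 1)

/-- Parabolic maximum principle. -/
theorem parabolic_max {Ω : Set (Cn n)} (hΩ : IsOpen Ω) (hb : IsBounded Ω) {s t1 : ℝ}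
    {g gh : En n → ℝ}
    (hc : ContinuousOn gh (closure Ω ×ˢ Icc s t1))
    (he : ∀ z ∈ Ω, ∀ t ∈ Icc s t1, gh (z, t) = g (z, t))
    (hbd : ∀ z ∈ frontier Ω, ∀ t ∈ Icc s t1, gh (z, t) ≤ 0)
    (hin : ∀ z ∈ Ω, g (z, s) ≤ 0)
    (hjet : ∀ z ∈ Ω, ∀ t ∈ Ioc s t1, 0 < g (z, t) → ∃ a h : En n → ℝ, HasJet g (z, t) a h ∧
      ((∀ v, a (sx v) = 0) → (∀ v, h (sx v) ≤ 0) → 0 ≤ a st → False)) :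
    ∀ z ∈ Ω, ∀ t ∈ Icc s t1, g (z, t) ≤ 0 := by
  intro z hz t ht
  by_contra hpos
  push Not at hpos
  have hK : IsCompact (closure Ω ×ˢ Icc s t1) := (hb.isCompact_closure).prod isCompact_Icc
  obtain ⟨⟨z0, t0⟩, ⟨hz0, ht0⟩, hmax⟩ := hK.exists_isMaxOn ⟨(z, t), subset_closure hz, ht⟩ hc
  have hm : ∀ z' ∈ closure Ω, ∀ t' ∈ Icc s t1, gh (z', t') ≤ gh (z0, t0) := fun z' h1 t' h2 =>
    hmax (show (z', t') ∈ closure Ω ×ˢ Icc s t1 from ⟨h1, h2⟩)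
  simp only at hz0 ht0
  have hp : 0 < gh (z0, t0) := by
    refine lt_of_lt_of_le ?_ (hm z (subset_closure hz) t ht)
    rw [he z hz t ht]; exact hpos
  have hz0Ω : z0 ∈ Ω := by
    by_contra hnot
    have : z0 ∈ frontier Ω := by rw [hΩ.frontier_eq]; exact ⟨hz0, hnot⟩
    linarith [hbd z0 this t0 ht0]
  have ht0s : t0 ≠ s := by
    rintro rfl
    have := hin z0 hz0Ω
    rw [he z0 hz0Ω t0 ht0] at hp; linarith
  have hlt : s < t0 := lt_of_le_of_ne ht0.1 (Ne.symm ht0s)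
  rw [he z0 hz0Ω t0 ht0] at hp
  obtain ⟨a, h, G, hF⟩ := hjet z0 hz0Ω t0 ⟨hlt, ht0.2⟩ hp
  have hdir : ∀ v, a (sx v) = 0 ∧ h (sx v) ≤ 0 := by
    intro v
    apply G.max_dir
    have hnh : ∀ᶠ r in 𝓝 (0:ℝ), z0 + r • v ∈ Ω :=
      (line_tendsto z0 v).eventually (hΩ.mem_nhds hz0Ω)
    filter_upwards [hnh] with r hr
    have h1 := hm _ (subset_closure hr) t0 ht0
    rw [he _ hr t0 ht0, he z0 hz0Ω t0 ht0] at h1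
    simpa [sx] using h1
  refine hF (fun v => (hdir v).1) (fun v => (hdir v).2) ?_
  apply G.max_past
  have : ∀ᶠ r in 𝓝[<] (0:ℝ), s < t0 + r := by
    have : Tendsto (fun r : ℝ => t0 + r) (𝓝[<] 0) (𝓝 t0) := by
      have : Continuous fun r : ℝ => t0 + r := by fun_prop
      simpa using (this.tendsto 0).mono_left nhdsWithin_le_nhds
    exact this.eventually (lt_mem_nhds hlt)
  filter_upwards [this, self_mem_nhdsWithin] with r h1 h2
  have ht' : t0 + r ∈ Icc s t1 := ⟨h1.le, by have := ht0.2; simp only [mem_Iio] at h2; linarith⟩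
  have h3 := hm z0 hz0 _ ht'
  rw [he _ hz0Ω _ ht', he z0 hz0Ω t0 ht0] at h3
  simpa [st] using h3

/-- Elliptic maximum principle on a time slice, in the part of `Ω` inside an open set `B`. -/
theorem elliptic_max {Ω B : Set (Cn n)} (hΩ : IsOpen Ω) (hb : IsBounded Ω) (hB : IsOpen B) {t : ℝ}
    {g : En n → ℝ} {gh : Cn n → ℝ}
    (hc : ContinuousOn gh (closure Ω ∩ closure B))
    (he : ∀ z ∈ Ω ∩ closure B, gh z = g (z, t))
    (hbd : ∀ z ∈ frontier Ω, z ∈ closure B → gh z ≤ 0)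
    (hbd2 : ∀ z ∈ Ω, z ∈ frontier B → gh z ≤ 0)
    (hjet : ∀ z ∈ Ω ∩ B, 0 < g (z, t) → ∃ a h : En n → ℝ, HasJet g (z, t) a h ∧
      ((∀ v, a (sx v) = 0) → (∀ v, h (sx v) ≤ 0) → False)) :
    ∀ z ∈ Ω ∩ B, g (z, t) ≤ 0 := by
  intro z hz
  by_contra hpos
  push Not at hpos
  have hK : IsCompact (closure Ω ∩ closure B) := (hb.isCompact_closure).inter_right isClosed_closure
  obtain ⟨z0, ⟨hz0, hzB⟩, hmax⟩ :=
    hK.exists_isMaxOn ⟨z, subset_closure hz.1, subset_closure hz.2⟩ hc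
  have hm : ∀ z' ∈ closure Ω, z' ∈ closure B → gh z' ≤ gh z0 := fun z' h1 h2 => hmax ⟨h1, h2⟩
  have hp : 0 < gh z0 := by
    refine lt_of_lt_of_le ?_ (hm z (subset_closure hz.1) (subset_closure hz.2))
    rw [he z ⟨hz.1, subset_closure hz.2⟩]; exact hpos
  have hz0Ω : z0 ∈ Ω := by
    by_contra hnot
    have : z0 ∈ frontier Ω := by rw [hΩ.frontier_eq]; exact ⟨hz0, hnot⟩
    linarith [hbd z0 this hzB]
  have hz0B : z0 ∈ B := by
    by_contra hnot
    have : z0 ∈ frontier B := by rw [hB.frontier_eq]; exact ⟨hzB, hnot⟩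
    linarith [hbd2 z0 hz0Ω this]
  rw [he z0 ⟨hz0Ω, hzB⟩] at hp
  obtain ⟨a, h, G, hF⟩ := hjet z0 ⟨hz0Ω, hz0B⟩ hp
  have hdir : ∀ v, a (sx v) = 0 ∧ h (sx v) ≤ 0 := by
    intro v
    apply G.max_dir
    have hnh : ∀ᶠ r in 𝓝 (0:ℝ), z0 + r • v ∈ Ω ∩ B :=
      (line_tendsto z0 v).eventually ((hΩ.inter hB).mem_nhds ⟨hz0Ω, hz0B⟩)
    filter_upwards [hnh] with r hr
    have h1 := hm _ (subset_closure hr.1) (subset_closure hr.2)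
    rw [he _ ⟨hr.1, subset_closure hr.2⟩, he z0 ⟨hz0Ω, hzB⟩] at h1
    simpa [sx] using h1
  exact hF (fun v => (hdir v).1) (fun v => (hdir v).2)

/-! ### Linear algebra: frames adapted to a positive definite Hermitian matrix -/

section LinAlg
open Matrix

/-- sesquilinear form -/
def cf (M : Matrix (Fin n) (Fin n) ℂ) (v w : Cn n) : ℂ :=
  ∑ α, ∑ β, v α * star (w β) * M α β

/-- quadratic form -/
def qf (M : Matrix (Fin n) (Fin n) ℂ) (v : Cn n) : ℝ := (cf M v v).re

theorem prod_le_pow_sum {ι : Type*} (s : Finset ι) (a : ι → ℝ) (ha : ∀ i ∈ s, 0 ≤ a i) (A : ℝ)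
    (hA : ∀ i ∈ s, a i ≤ A) : ∏ i ∈ s, a i ≤ A ^ s.card := by
  rw [← Finset.prod_const]; exact Finset.prod_le_prod ha hA

theorem logdet_le {N : Matrix (Fin n) (Fin n) ℂ} (hN : N.PosDef) :
    Real.log N.det.re ≤ N.trace.re - n := by
  have h1 : N.det = ((∏ i, hN.1.eigenvalues i : ℝ) : ℂ) := by
    rw [hN.1.det_eq_prod_eigenvalues]; push_cast; rfl
  have h2 : N.trace = ((∑ i, hN.1.eigenvalues i : ℝ) : ℂ) := by
    rw [hN.1.trace_eq_sum_eigenvalues]; push_cast; rfl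
  rw [h1, h2, Complex.ofReal_re, Complex.ofReal_re,
    Real.log_prod (fun i _ => (hN.eigenvalues_pos i).ne')]
  have : ∑ i, Real.log (hN.1.eigenvalues i) ≤ ∑ i, (hN.1.eigenvalues i - 1) :=
    Finset.sum_le_sum fun i _ => Real.log_le_sub_one_of_pos (hN.eigenvalues_pos i)
  simpa [Finset.sum_sub_distrib] using this

/-- A frame adapted to `M`. -/
structure FrameAt (M : Matrix (Fin n) (Fin n) ℂ) (e : Fin n → Cn n) : Prop where
  unit : ∀ k, qf M (e k) = 1
  expand : ∀ ν : Cn n, ∑ k, cf M ν (e k) • e k = ν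
  norm_sum : ∀ ν : Cn n, ∑ k, ‖cf M ν (e k)‖ ^ 2 = qf M ν
  logdet : ∀ M' : Matrix (Fin n) (Fin n) ℂ, M'.PosDef →
    Real.log M'.det.re - Real.log M.det.re ≤ ∑ k, qf M' (e k) - n
  trace_le : M.trace.re ≤ n * (M.det.re * (∑ k, ‖e k‖ ^ 2) ^ (n - 1))
  inv_le : M.det.re * (∑ k, ‖e k‖ ^ 2) ≤ n * M.trace.re ^ (n - 1)
  qf_le : ∀ ν : Cn n, qf M ν ≤ M.trace.re * ‖ν‖ ^ 2

theorem others_le (l : Fin n → ℝ) (hl : ∀ i, 0 < l i) (j : Fin n) :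
    ∏ i ∈ Finset.univ.erase j, l i ≤ (∑ i, l i) ^ (n - 1) := by
  have h := prod_le_pow_sum (Finset.univ.erase j) l (fun i _ => (hl i).le) (∑ i, l i)
    (fun i _ => Finset.single_le_sum (f := l) (fun k _ => (hl k).le) (Finset.mem_univ i))
  simpa [Finset.card_erase_of_mem] using h

theorem cf_matrix (M X : Matrix (Fin n) (Fin n) ℂ) (k l : Fin n) :
    cf M (WithLp.toLp 2 fun α => star (X α k)) (WithLp.toLp 2 fun α => star (X α l))
      = (Xᴴ * M * X) k l := by
  simp only [cf, Matrix.mul_apply, Matrix.conjTranspose_apply, star_star, Finset.sum_mul]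
  rw [Finset.sum_comm]
  refine Finset.sum_congr rfl fun β _ => Finset.sum_congr rfl fun α _ => ?_
  ring

theorem exists_frame {M : Matrix (Fin n) (Fin n) ℂ} (hM : M.PosDef) : ∃ e, FrameAt M e := by
  set l := hM.1.eigenvalues with hl
  have lpos : ∀ i, 0 < l i := hM.eigenvalues_pos
  set V : Matrix (Fin n) (Fin n) ℂ := (hM.1.eigenvectorUnitary).1 with hV
  have hVV : Vᴴ * V = 1 := by
    have := Unitary.coe_star_mul_self hM.1.eigenvectorUnitary
    simpa [Matrix.star_eq_conjTranspose] using this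
  have hVV' : V * Vᴴ = 1 := mul_eq_one_comm.1 hVV
  have hdiag : Vᴴ * M * V = diagonal fun i => ((l i : ℝ) : ℂ) := by
    have := hM.1.conjStarAlgAut_star_eigenvectorUnitary
    rw [Unitary.conjStarAlgAut_star_apply] at this
    simpa [Matrix.star_eq_conjTranspose, Function.comp_def] using this
  set D : Matrix (Fin n) (Fin n) ℂ := diagonal fun i => (((Real.sqrt (l i))⁻¹ : ℝ) : ℂ) with hD
  have hDH : Dᴴ = D := by
    rw [hD, diagonal_conjTranspose]; congr 1; funext i; simp
  set X := V * D with hX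
  have hsq : ∀ i, (Real.sqrt (l i))⁻¹ * (Real.sqrt (l i))⁻¹ = (l i)⁻¹ := fun i => by
    rw [← mul_inv, Real.mul_self_sqrt (lpos i).le]
  have hXM : Xᴴ * M * X = 1 := by
    have : Xᴴ * M * X = Dᴴ * (Vᴴ * M * V) * D := by
      simp only [hX, conjTranspose_mul, Matrix.mul_assoc]
    rw [this, hdiag, hDH, hD, diagonal_mul_diagonal, diagonal_mul_diagonal, ← diagonal_one]
    congr 1; funext i
    have h := hsq i
    have h2 : (Real.sqrt (l i))⁻¹ * l i * (Real.sqrt (l i))⁻¹ = 1 := by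
      rw [mul_right_comm, h, inv_mul_cancel₀ (lpos i).ne']
    exact_mod_cast h2
  have hXX : Xᴴ * X = diagonal fun i => (((l i)⁻¹ : ℝ) : ℂ) := by
    have : Xᴴ * X = Dᴴ * (Vᴴ * V) * D := by
      simp only [hX, conjTranspose_mul, Matrix.mul_assoc]
    rw [this, hVV, hDH, Matrix.mul_one, hD, diagonal_mul_diagonal]
    congr 1; funext i
    exact_mod_cast hsq i
  have hXM' : M * X * Xᴴ = 1 := by
    apply mul_eq_one_comm.1; rw [← Matrix.mul_assoc]; exact hXM
  have hdet : M.det.re = ∏ i, l i := by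
    rw [hM.1.det_eq_prod_eigenvalues]
    have : (∏ i, (hM.1.eigenvalues i : ℂ)) = ((∏ i, l i : ℝ) : ℂ) := by push_cast; rfl
    exact (congrArg Complex.re this).trans (Complex.ofReal_re _)
  have htr : M.trace.re = ∑ i, l i := by
    rw [hM.1.trace_eq_sum_eigenvalues]
    have : (∑ i, (hM.1.eigenvalues i : ℂ)) = ((∑ i, l i : ℝ) : ℂ) := by push_cast; rfl
    exact (congrArg Complex.re this).trans (Complex.ofReal_re _)
  set e : Fin n → Cn n := fun k => WithLp.toLp 2 fun α => star (X α k) with he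
  have hne : ∀ k, ‖e k‖ ^ 2 = (l k)⁻¹ := by
    intro k
    have h1 : (Xᴴ * X) k k = ((‖e k‖ ^ 2 : ℝ) : ℂ) := by
      rw [EuclideanSpace.norm_sq_eq, Matrix.mul_apply]
      push_cast
      refine Finset.sum_congr rfl fun α _ => ?_
      simp only [he, conjTranspose_apply, Complex.star_def]
      rw [Complex.norm_conj, Complex.conj_mul']
    rw [hXX, diagonal_apply_eq] at h1
    exact_mod_cast h1.symm
  have hS : ∑ k, ‖e k‖ ^ 2 = ∑ k, (l k)⁻¹ := Finset.sum_congr rfl fun k _ => hne k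
  have hcf : ∀ (N : Matrix (Fin n) (Fin n) ℂ) k, cf N (e k) (e k) = (Xᴴ * N * X) k k :=
    fun N k => cf_matrix N X k k
  -- coefficients
  have hc : ∀ (ν : Cn n) k, cf M ν (e k) = ((M * X)ᵀ *ᵥ ν.ofLp) k := by
    intro ν k
    simp only [cf, he, star_star, mulVec, dotProduct, transpose_apply, Matrix.mul_apply,
      Finset.sum_mul]
    refine Finset.sum_congr rfl fun α _ => Finset.sum_congr rfl fun β _ => ?_
    ring
  have hexp : ∀ ν : Cn n, ∑ k, cf M ν (e k) • e k = ν := by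
    intro ν
    have h1 : (Xᴴ)ᵀ * (M * X)ᵀ = 1 := by
      rw [← transpose_mul, hXM', transpose_one]
    have h2 : ν.ofLp = (Xᴴ)ᵀ *ᵥ ((M * X)ᵀ *ᵥ ν.ofLp) := by
      rw [mulVec_mulVec, h1, one_mulVec]
    apply PiLp.ext
    intro α
    rw [h2]
    simp only [mulVec, dotProduct, transpose_apply, conjTranspose_apply]
    simp only [WithLp.ofLp_sum, WithLp.ofLp_smul, Finset.sum_apply, Pi.smul_apply, smul_eq_mul, he]
    refine Finset.sum_congr rfl fun k _ => ?_
    have h3 := hc ν k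
    simp only [mulVec, dotProduct, transpose_apply, he] at h3
    rw [h3, mul_comm]
  have hns : ∀ ν : Cn n, ∑ k, ‖cf M ν (e k)‖ ^ 2 = qf M ν := by
    intro ν
    have h1 : cf M ν ν = ∑ k, star (cf M ν (e k)) * cf M ν (e k) := by
      conv_lhs => 
        enter [3]
        rw [← hexp ν]
      have : ∀ c : Fin n → ℂ, cf M ν (∑ k, c k • e k) = ∑ k, star (c k) * cf M ν (e k) := by
        intro c
        simp only [cf, WithLp.ofLp_sum, WithLp.ofLp_smul, Finset.sum_apply, Pi.smul_apply,
          smul_eq_mul, star_sum, star_mul', Finset.mul_sum, Finset.sum_mul]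
        rw [Finset.sum_congr rfl fun α _ => Finset.sum_comm, Finset.sum_comm]
        refine Finset.sum_congr rfl fun k _ => Finset.sum_congr rfl fun α _ =>
          Finset.sum_congr rfl fun β _ => ?_
        ring
      exact this _
    rw [qf, h1, Complex.re_sum]
    refine Finset.sum_congr rfl fun k _ => ?_
    simp only [Complex.star_def]
    rw [Complex.conj_mul', ← Complex.ofReal_pow, Complex.ofReal_re]
  refine ⟨e, ⟨fun k => ?_, hexp, fun ν => ?_, fun M' hM' => ?_, ?_, ?_, fun ν => ?_⟩⟩
  · rw [qf, hcf, hXM]; simp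
  · -- norm_sum
    exact hns ν
  · -- logdet
    have hdX : X.det ≠ 0 := by
      intro h0
      have := congrArg det hXM
      rw [det_mul, h0, mul_zero, det_one] at this
      exact one_ne_zero this.symm
    have hN : (Xᴴ * M' * X).PosDef := by
      apply hM'.conjTranspose_mul_mul_same
      exact mulVec_injective_iff_isUnit.2 ((isUnit_iff_isUnit_det X).2 (isUnit_iff_ne_zero.2 hdX))
    have h1 := logdet_le hN
    have h2 : (Xᴴ * M' * X).trace.re = ∑ k, qf M' (e k) := by
      simp only [trace, diag, Complex.re_sum, qf, hcf]
    have h3 : (Xᴴ * M' * X).det * M.det = M'.det := by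
      have h4 := congrArg det hXM
      simp only [det_mul, det_one] at h4 ⊢
      linear_combination M'.det * h4
    have p1 := hN.det_pos
    have p2 := hM.det_pos
    have p3 := hM'.det_pos
    rw [Complex.lt_def] at p1 p2 p3
    have h5 : M'.det.re = (Xᴴ * M' * X).det.re * M.det.re := by
      rw [← h3, Complex.mul_re, ← p2.2]; simp
    rw [h5, Real.log_mul p1.1.ne' p2.1.ne', ← h2]
    linarith
  · rw [hS, hdet, htr]
    have hj : ∀ j, l j ≤ (∏ i, l i) * (∑ k, (l k)⁻¹) ^ (n - 1) := by
      intro j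
      have h1 := others_le (fun i => (l i)⁻¹) (fun i => inv_pos.2 (lpos i)) j
      have h2 : ∏ i, l i = l j * ∏ i ∈ Finset.univ.erase j, l i :=
        (Finset.mul_prod_erase _ _ (Finset.mem_univ j)).symm
      have h3 : (∏ i ∈ Finset.univ.erase j, l i) * ∏ i ∈ Finset.univ.erase j, (l i)⁻¹ = 1 := by
        rw [← Finset.prod_mul_distrib]
        exact Finset.prod_eq_one fun i _ => mul_inv_cancel₀ (lpos i).ne'
      have h4 : 0 < ∏ i, l i := Finset.prod_pos fun i _ => lpos i
      calc l j = (∏ i, l i) * ∏ i ∈ Finset.univ.erase j, (l i)⁻¹ := by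
            rw [h2, mul_assoc, h3, mul_one]
        _ ≤ _ := by gcongr
    calc ∑ i, l i ≤ ∑ _i : Fin n, (∏ i, l i) * (∑ k, (l k)⁻¹) ^ (n - 1) :=
          Finset.sum_le_sum fun j _ => hj j
      _ = _ := by simp
  · rw [hS, hdet, htr, Finset.mul_sum]
    have hj : ∀ j, (∏ i, l i) * (l j)⁻¹ ≤ (∑ k, l k) ^ (n - 1) := by
      intro j
      have h1 := others_le l lpos j
      have h2 : ∏ i, l i = l j * ∏ i ∈ Finset.univ.erase j, l i :=
        (Finset.mul_prod_erase _ _ (Finset.mem_univ j)).symm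
      rw [h2, mul_right_comm, mul_inv_cancel₀ (lpos j).ne', one_mul]
      exact h1
    calc _ ≤ ∑ _i : Fin n, (∑ k, l k) ^ (n - 1) := Finset.sum_le_sum fun j _ => hj j
      _ = _ := by simp
  · -- qf_le
    have hlam : ∀ k, ‖cf M ν (e k)‖ ^ 2 ≤ l k * ‖ν‖ ^ 2 := by
      intro k
      -- M X = V * diag(sqrt) and so on: use eigenvector equation
      have hMX : M * X = X * diagonal fun i => ((l i : ℝ) : ℂ) := by
        have h1 : M * V = V * diagonal fun i => ((l i : ℝ) : ℂ) := by
          rw [← hdiag, ← Matrix.mul_assoc, ← Matrix.mul_assoc, hVV', Matrix.one_mul]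
        rw [hX, ← Matrix.mul_assoc, h1, Matrix.mul_assoc, Matrix.mul_assoc, hD,
          diagonal_mul_diagonal, diagonal_mul_diagonal]
        congr 2; funext i; ring
      have h2 : cf M ν (e k) = ((l k : ℝ) : ℂ) * inner ℂ (e k) ν := by
        rw [hc, hMX]
        simp only [mulVec, dotProduct, transpose_apply, mul_diagonal, PiLp.inner_apply, he,
          Finset.mul_sum, RCLike.inner_apply, Complex.star_def, Complex.conj_conj]
        refine Finset.sum_congr rfl fun α _ => ?_
        ring
      have h3 := norm_inner_le_norm (𝕜 := ℂ) (e k) ν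
      rw [h2, norm_mul, mul_pow, Complex.norm_real, Real.norm_of_nonneg (lpos k).le]
      have h4 : ‖inner ℂ (e k) ν‖ ^ 2 ≤ (‖e k‖ * ‖ν‖) ^ 2 := by gcongr
      rw [mul_pow, hne] at h4
      calc l k ^ 2 * ‖inner ℂ (e k) ν‖ ^ 2 ≤ l k ^ 2 * ((l k)⁻¹ * ‖ν‖ ^ 2) := by gcongr
        _ = _ := by have := (lpos k).ne'; field_simp
    rw [← hns, htr, Finset.sum_mul]
    exact Finset.sum_le_sum fun k _ => hlam k

end LinAlg

/-! ### Real bilinear forms and their Hermitian matrices -/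

section Bil
open Matrix

/-- symmetric real-bilinear form -/
structure IsBil (B : Cn n → Cn n → ℝ) : Prop where
  add : ∀ v v' w, B (v + v') w = B v w + B v' w
  smul : ∀ (c : ℝ) v w, B (c • v) w = c * B v w
  symm : ∀ v w, B v w = B w v

/-- the `J`-invariant part (doubled) -/
def hf (B : Cn n → Cn n → ℝ) (v w : Cn n) : ℝ := B v w + B (I • v) (I • w)

/-- the Hermitian matrix of a form -/
def hMat (B : Cn n → Cn n → ℝ) : Matrix (Fin n) (Fin n) ℂ :=
  Matrix.of fun α β => (1 / 4 : ℂ) *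
    (((B (cvec n α 1) (cvec n β 1) + B (cvec n α I) (cvec n β I) : ℝ) : ℂ) +
      I * ((B (cvec n α 1) (cvec n β I) - B (cvec n α I) (cvec n β 1) : ℝ) : ℂ))

theorem IsBil.addr {B : Cn n → Cn n → ℝ} (h : IsBil B) (v w w' : Cn n) :
    B v (w + w') = B v w + B v w' := by
  rw [h.symm, h.add, h.symm w, h.symm w']

theorem IsBil.smulr {B : Cn n → Cn n → ℝ} (h : IsBil B) (c : ℝ) (v w : Cn n) :
    B v (c • w) = c * B v w := by
  rw [h.symm, h.smul, h.symm w]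

theorem IsBil.zero {B : Cn n → Cn n → ℝ} (h : IsBil B) (w : Cn n) : B 0 w = 0 := by
  have := h.smul 0 0 w
  simpa using this

theorem IsBil.suml {B : Cn n → Cn n → ℝ} (h : IsBil B) {ι : Type*} (s : Finset ι)
    (v : ι → Cn n) (w : Cn n) : B (∑ i ∈ s, v i) w = ∑ i ∈ s, B (v i) w := by
  classical
  induction s using Finset.induction_on with
  | empty => simpa using h.zero w
  | insert i s hi ih => rw [Finset.sum_insert hi, Finset.sum_insert hi, h.add, ih]

theorem IsBil.sumr {B : Cn n → Cn n → ℝ} (h : IsBil B) {ι : Type*} (s : Finset ι)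
    (v : ι → Cn n) (w : Cn n) : B w (∑ i ∈ s, v i) = ∑ i ∈ s, B w (v i) := by
  rw [h.symm, h.suml]; exact Finset.sum_congr rfl fun i _ => h.symm _ _

theorem cvec_eq (α : Fin n) (c : ℂ) :
    cvec n α c = c.re • cvec n α 1 + c.im • cvec n α I := by
  apply PiLp.ext; intro β
  by_cases hb : β = α
  · subst hb
    simp only [cvec, PiLp.add_apply, PiLp.smul_apply, EuclideanSpace.single, PiLp.single_apply, if_true]
    apply Complex.ext <;> simp
  · simp [cvec, hb]

theorem smul_cvec (α : Fin n) (c d : ℂ) : d • cvec n α c = cvec n α (d * c) := by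
  apply PiLp.ext; intro β
  simp [cvec]

theorem sum_cvec (v : Cn n) : ∑ α, cvec n α (v α) = v := by
  apply PiLp.ext; intro β
  simp [cvec]

theorem hf_cvec {B : Cn n → Cn n → ℝ} (h : IsBil B) (α β : Fin n) (a b : ℂ) :
    (a * star b * hMat B α β).re = 1 / 4 * hf B (cvec n α a) (cvec n β b) := by
  have e1 := cvec_eq α a
  have e2 := cvec_eq β b
  have e3 := cvec_eq α (I * a)
  have e4 := cvec_eq β (I * b)
  rw [hf, smul_cvec, smul_cvec, e1, e2, e3, e4]
  simp only [h.add, h.addr, h.smul, h.smulr, hMat, Matrix.of_apply]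
  set P := B (cvec n α 1) (cvec n β 1)
  set R := B (cvec n α I) (cvec n β I)
  set S := B (cvec n α 1) (cvec n β I)
  set W := B (cvec n α I) (cvec n β 1)
  have q : (1 / 4 : ℂ) = ((1 / 4 : ℝ) : ℂ) := by push_cast; rfl
  rw [q]
  simp only [Complex.mul_re, Complex.mul_im, Complex.add_re, Complex.add_im, Complex.ofReal_re,
    Complex.ofReal_im, Complex.I_re, Complex.I_im, Complex.star_def, Complex.conj_re,
    Complex.conj_im]
  ring

theorem cf_re {B : Cn n → Cn n → ℝ} (h : IsBil B) (v w : Cn n) :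
    (cf (hMat B) v w).re = 1 / 4 * hf B v w := by
  have : hf B v w = ∑ α, ∑ β, hf B (cvec n α (v α)) (cvec n β (w β)) := by
    conv_lhs => rw [← sum_cvec v, ← sum_cvec w]
    simp only [hf, Finset.smul_sum, h.suml, h.sumr, Finset.sum_add_distrib]
  rw [this, cf, Complex.re_sum, Finset.mul_sum]
  refine Finset.sum_congr rfl fun α _ => ?_
  rw [Complex.re_sum, Finset.mul_sum]
  refine Finset.sum_congr rfl fun β _ => hf_cvec h α β _ _

theorem cf_im {B : Cn n → Cn n → ℝ} (h : IsBil B) (v w : Cn n) :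
    (cf (hMat B) v w).im = 1 / 4 * hf B v (I • w) := by
  rw [← cf_re h]
  have : cf (hMat B) v (I • w) = -I * cf (hMat B) v w := by
    simp only [cf, Finset.mul_sum]
    refine Finset.sum_congr rfl fun α _ => Finset.sum_congr rfl fun β _ => ?_
    simp only [PiLp.smul_apply, smul_eq_mul, Complex.star_def, map_mul, Complex.conj_I]
    ring
  rw [this]; simp

theorem qf_hMat {B : Cn n → Cn n → ℝ} (h : IsBil B) (v : Cn n) :
    qf (hMat B) v = 1 / 4 * hf B v v := cf_re h v v

theorem hMat_herm {B : Cn n → Cn n → ℝ} (h : IsBil B) : (hMat B).IsHermitian := by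
  ext α β
  simp only [Matrix.conjTranspose_apply, hMat, Matrix.of_apply]
  rw [h.symm (cvec n β 1) (cvec n α 1), h.symm (cvec n β I) (cvec n α I),
    h.symm (cvec n β 1) (cvec n α I), h.symm (cvec n β I) (cvec n α 1)]
  have q : (1 / 4 : ℂ) = ((1 / 4 : ℝ) : ℂ) := by push_cast; rfl
  rw [q]
  apply Complex.ext
  · simp
  · simp

theorem qf_posDef {M : Matrix (Fin n) (Fin n) ℂ} (hM : M.PosDef) {v : Cn n} (hv : v ≠ 0) :
    0 < qf M v := by
  have hx : (fun β => star (v β)) ≠ 0 := by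
    intro h0; apply hv
    apply PiLp.ext; intro β
    have := congrFun h0 β
    simpa using this
  have h1 := hM.re_dotProduct_pos hx
  convert h1 using 1
  simp only [qf, cf, dotProduct, Matrix.mulVec, Pi.star_apply, star_star, Finset.mul_sum]
  simp only [RCLike.re_to_complex]
  congr 1
  refine Finset.sum_congr rfl fun α _ => Finset.sum_congr rfl fun β _ => ?_
  ring

theorem posDef_of_qf {M : Matrix (Fin n) (Fin n) ℂ} (hM : M.IsHermitian)
    (h : ∀ v : Cn n, v ≠ 0 → 0 < qf M v) : M.PosDef := by
  refine Matrix.PosDef.of_dotProduct_mulVec_pos hM fun x hx => ?_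
  have hv : (WithLp.toLp 2 fun β => star (x β) : Cn n) ≠ 0 := by
    intro h0; apply hx
    funext β
    have := congrArg (fun y : Cn n => y β) h0
    simpa using this
  have h1 := h _ hv
  have h2 : (cf M (WithLp.toLp 2 fun β => star (x β)) (WithLp.toLp 2 fun β => star (x β)))
      = star x ⬝ᵥ (M *ᵥ x) := by
    simp only [cf, dotProduct, Matrix.mulVec, Pi.star_apply, star_star, Finset.mul_sum]
    refine Finset.sum_congr rfl fun α _ => Finset.sum_congr rfl fun β _ => ?_
    ring
  rw [qf, h2] at h1
  have h3 := hM.im_star_dotProduct_mulVec_self x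
  rw [Complex.lt_def]
  exact ⟨h1, by simpa using h3.symm⟩

theorem trace_hMat (B : Cn n → Cn n → ℝ) : (hMat B).trace.re =
    1 / 4 * ∑ α, (B (cvec n α 1) (cvec n α 1) + B (cvec n α I) (cvec n α I)) := by
  rw [Matrix.trace, Complex.re_sum, Finset.mul_sum]
  refine Finset.sum_congr rfl fun α _ => ?_
  have q : (1 / 4 : ℂ) = ((1 / 4 : ℝ) : ℂ) := by push_cast; rfl
  simp only [Matrix.diag, hMat, Matrix.of_apply, q]
  simp

/-! consequences for frames -/

variable {B : Cn n → Cn n → ℝ} {e : Fin n → Cn n}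

theorem frame_unit (h : IsBil B) (F : FrameAt (hMat B) e) (k : Fin n) : hf B (e k) (e k) = 4 := by
  have := F.unit k
  rw [qf_hMat h] at this; linarith

theorem frame_expand (h : IsBil B) (F : FrameAt (hMat B) e) (l : Cn n →ₗ[ℝ] ℝ) (ν : Cn n) :
    ∑ k, (hf B ν (e k) * l (e k) + hf B ν (I • e k) * l (I • e k)) = 4 * l ν := by
  conv_rhs => rw [← F.expand ν]
  rw [map_sum, Finset.mul_sum]
  refine Finset.sum_congr rfl fun k _ => ?_
  have h1 : cf (hMat B) ν (e k) • e k
      = (1 / 4 * hf B ν (e k)) • e k + (1 / 4 * hf B ν (I • e k)) • (I • e k) := by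
    rw [← cf_re h, ← cf_im h]
    apply PiLp.ext; intro α
    simp only [PiLp.add_apply, PiLp.smul_apply, smul_eq_mul, Complex.real_smul]
    conv_lhs => rw [← Complex.re_add_im (cf (hMat B) ν (e k))]
    ring
  rw [h1, map_add, LinearMap.map_smul, LinearMap.map_smul, smul_eq_mul, smul_eq_mul]
  ring

theorem frame_cs (h : IsBil B) (F : FrameAt (hMat B) e) (l : Cn n →ₗ[ℝ] ℝ) (ν : Cn n) :
    l ν ^ 2 ≤ qf (hMat B) ν * ∑ k, (l (e k) ^ 2 + l (I • e k) ^ 2) := by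
  have h1 := frame_expand h F l ν
  have h2 : qf (hMat B) ν = ∑ k, ((1 / 4 * hf B ν (e k)) ^ 2 + (1 / 4 * hf B ν (I • e k)) ^ 2) := by
    rw [← F.norm_sum ν]
    refine Finset.sum_congr rfl fun k _ => ?_
    rw [← cf_re h, ← cf_im h, Complex.sq_norm, Complex.normSq_apply]; ring
  have h3 : l ν = ∑ k, ((1 / 4 * hf B ν (e k)) * l (e k) + (1 / 4 * hf B ν (I • e k)) * l (I • e k)) := by
    have : ∑ k, ((1 / 4 * hf B ν (e k)) * l (e k) + (1 / 4 * hf B ν (I • e k)) * l (I • e k))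
      = 1 / 4 * ∑ k, (hf B ν (e k) * l (e k) + hf B ν (I • e k) * l (I • e k)) := by
      rw [Finset.mul_sum]; exact Finset.sum_congr rfl fun k _ => by ring
    rw [this, h1]; ring
  set a := fun k => 1 / 4 * hf B ν (e k)
  set b := fun k => 1 / 4 * hf B ν (I • e k)
  have h4 := Finset.sum_mul_sq_le_sq_mul_sq (Finset.univ : Finset (Fin n ⊕ Fin n))
    (Sum.elim a b) (Sum.elim (fun k => l (e k)) (fun k => l (I • e k)))
  simp only [Fintype.sum_sum_type, Sum.elim_inl, Sum.elim_inr] at h4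
  rw [h3, h2]
  simp only [Finset.sum_add_distrib]
  exact h4

theorem frame_norm {M : Matrix (Fin n) (Fin n) ℂ} (F : FrameAt M e) (ν : Cn n) :
    ‖ν‖ ^ 2 ≤ qf M ν * ∑ k, ‖e k‖ ^ 2 := by
  conv_lhs => rw [← F.expand ν]
  have h1 : ‖∑ k, cf M ν (e k) • e k‖ ≤ ∑ k, ‖cf M ν (e k)‖ * ‖e k‖ :=
    (norm_sum_le _ _).trans (le_of_eq (Finset.sum_congr rfl fun k _ => norm_smul _ _))
  calc ‖∑ k, cf M ν (e k) • e k‖ ^ 2 ≤ (∑ k, ‖cf M ν (e k)‖ * ‖e k‖) ^ 2 := by gcongr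
    _ ≤ (∑ k, ‖cf M ν (e k)‖ ^ 2) * ∑ k, ‖e k‖ ^ 2 := Finset.sum_mul_sq_le_sq_mul_sq _ _ _
    _ = _ := by rw [F.norm_sum]

theorem qf_smul_one (c : ℝ) (v : Cn n) :
    qf ((c : ℂ) • (1 : Matrix (Fin n) (Fin n) ℂ)) v = c * ‖v‖ ^ 2 := by
  have : cf ((c : ℂ) • (1 : Matrix (Fin n) (Fin n) ℂ)) v v = ((c * ‖v‖ ^ 2 : ℝ) : ℂ) := by
    rw [EuclideanSpace.norm_sq_eq]
    simp only [cf, Matrix.smul_apply, Matrix.one_apply, smul_eq_mul, mul_ite, mul_one, mul_zero,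
      Finset.sum_ite_eq, Finset.mem_univ, if_true]
    push_cast
    rw [Finset.mul_sum]
    refine Finset.sum_congr rfl fun α _ => ?_
    rw [Complex.star_def, Complex.mul_conj']; ring
  rw [qf, this, Complex.ofReal_re]

theorem frame_logdet_scalar {M : Matrix (Fin n) (Fin n) ℂ} (F : FrameAt M e) {c : ℝ} (hc : 0 < c) :
    n * Real.log c - Real.log M.det.re ≤ c * ∑ k, ‖e k‖ ^ 2 - n := by
  have hp : ((c : ℂ) • (1 : Matrix (Fin n) (Fin n) ℂ)).PosDef :=
    Matrix.PosDef.one.smul (by exact_mod_cast hc)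
  have h := F.logdet _ hp
  have hd : ((c : ℂ) • (1 : Matrix (Fin n) (Fin n) ℂ)).det.re = c ^ n := by
    rw [Matrix.det_smul]; simp [← Complex.ofReal_pow]
  rw [hd, Real.log_pow] at h
  simp only [qf_smul_one, ← Finset.mul_sum] at h
  exact h

/-- lower bound plus determinant bound gives trace bound -/
theorem trace_le_of_lower (M : Matrix (Fin n) (Fin n) ℂ) (hM : M.IsHermitian) {c C : ℝ} (hc : 0 < c)
    (h : ∀ v : Cn n, c * ‖v‖ ^ 2 ≤ qf M v) (hC : M.det.re ≤ C) :
    M.trace.re ≤ n * (C * (n / c) ^ (n - 1)) := by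
  have hp : M.PosDef := posDef_of_qf hM fun v hv =>
    lt_of_lt_of_le (by positivity) (h v)
  obtain ⟨e, F⟩ := exists_frame hp
  have h1 : ∑ k, ‖e k‖ ^ 2 ≤ n / c := by
    have : ∀ k, ‖e k‖ ^ 2 ≤ 1 / c := fun k => by
      rw [le_div_iff₀ hc, mul_comm, ← F.unit k]; exact h _
    calc _ ≤ ∑ _k : Fin n, 1 / c := Finset.sum_le_sum fun k _ => this k
      _ = n / c := by simp [div_eq_mul_inv]
  have h2 : 0 < M.det.re := (Complex.lt_def.1 hp.det_pos).1
  have h3 : 0 ≤ C := h2.le.trans hC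
  refine F.trace_le.trans ?_
  gcongr

/-- degenerate direction bounds the determinant -/
theorem det_le_of_dir {M : Matrix (Fin n) (Fin n) ℂ} (hM : M.PosDef) {δ A : ℝ} {ζ : Cn n}
    (hζ : ζ ≠ 0) (h : qf M ζ ≤ δ * ‖ζ‖ ^ 2) (hA : M.trace.re ≤ A) :
    M.det.re ≤ n * δ * A ^ (n - 1) := by
  obtain ⟨e, F⟩ := exists_frame hM
  have h1 := frame_norm F ζ
  have h4 := F.inv_le
  have hS : 0 ≤ ∑ k, ‖e k‖ ^ 2 := Finset.sum_nonneg fun k _ => by positivity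
  generalize ∑ k, ‖e k‖ ^ 2 = S at *
  have hz : 0 < ‖ζ‖ ^ 2 := by positivity
  have h2 : 1 ≤ δ * S := by
    have : ‖ζ‖ ^ 2 ≤ δ * ‖ζ‖ ^ 2 * S := h1.trans (by gcongr)
    by_contra hc; push Not at hc
    have : δ * S * ‖ζ‖ ^ 2 < 1 * ‖ζ‖ ^ 2 := mul_lt_mul_of_pos_right hc hz
    linarith
  have h3 : 0 < M.det.re := (Complex.lt_def.1 hM.det_pos).1
  have ht : 0 ≤ M.trace.re := (Complex.le_def.1 hM.posSemidef.trace_nonneg).1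
  have hδ : 0 < δ := by
    by_contra hc; push Not at hc
    have := mul_nonpos_of_nonpos_of_nonneg hc hS
    linarith
  calc M.det.re ≤ M.det.re * (δ * S) := le_mul_of_one_le_right h3.le h2
    _ = δ * (M.det.re * S) := by ring
    _ ≤ δ * (n * M.trace.re ^ (n - 1)) := by gcongr
    _ ≤ δ * (n * A ^ (n - 1)) := by gcongr
    _ = _ := by ring

end Bil

/-! ### Slices, the operator `L`, and the equation -/

section Slices

/-- spatial second derivative -/
def D2 (g : En n → ℝ) (p : En n) (v w : Cn n) : ℝ := dd (sx v) (dd (sx w) g) p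

/-- linearized operator in a frame -/
def Lop (e : Fin n → Cn n) (g : En n → ℝ) (p : En n) : ℝ :=
  dd st g p - 1 / 4 * ∑ k, hf (D2 g p) (e k) (e k)

theorem sx_add (v w : Cn n) : sx (v + w) = sx v + sx w := by simp [sx]
theorem sx_smul (c : ℝ) (v : Cn n) : sx (c • v) = c • sx v := by simp [sx]

theorem D2_bil {g : En n → ℝ} {p : En n} (h : ContDiffAt ℝ 2 g p) : IsBil (D2 g p) := by
  refine ⟨fun v v' w => ?_, fun c v w => ?_, fun v w => dd_comm2 h _ _⟩
  · simp only [D2, sx_add, dd_add_dir]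
  · simp only [D2, sx_smul, dd_smul_dir]

/-- first derivative as a linear map -/
def D1 (g : En n → ℝ) (p : En n) : Cn n →ₗ[ℝ] ℝ where
  toFun v := dd (sx v) g p
  map_add' v w := by simp [sx_add, dd_add_dir]
  map_smul' c v := by simp [sx_smul, dd_smul_dir]

@[simp] theorem D1_apply (g : En n → ℝ) (p : En n) (v : Cn n) : D1 g p v = dd (sx v) g p := rfl

theorem fderiv_ofReal {g : Cn n → ℝ} {z : Cn n} (h : DifferentiableAt ℝ g z) (v : Cn n) :
    fderiv ℝ (fun w => (g w : ℂ)) z v = ((dd v g z : ℝ) : ℂ) := by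
  have h1 := Complex.ofRealCLM.hasFDerivAt.comp z h.hasFDerivAt
  have h2 : fderiv ℝ (fun w => (g w : ℂ)) z = _ := h1.fderiv
  rw [h2]; rfl

theorem cHess_eq {g : Cn n → ℝ} {z : Cn n} (h : ContDiffAt ℝ 2 g z) :
    cHess g z = hMat fun v w => dd v (dd w g) z := by
  ext α β
  simp only [cHess, cHessW, Matrix.of_apply, wderW, fderivWithin_univ]
  have e1 : (wderBarW univ β fun w => (g w : ℂ)) =ᶠ[𝓝 z] fun y =>
      (1 / 2 : ℂ) * ((dd (cvec n β 1) g y : ℝ) : ℂ) + (I / 2) * ((dd (cvec n β I) g y : ℝ) : ℂ) := by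
    filter_upwards [cd2_ev h] with y hy
    simp only [wderBarW, fderivWithin_univ]
    rw [fderiv_ofReal hy, fderiv_ofReal hy]; ring
  have e2 : ∀ v, fderiv ℝ (wderBarW univ β fun w => (g w : ℂ)) z v =
      (1 / 2 : ℂ) * ((dd v (dd (cvec n β 1) g) z : ℝ) : ℂ) +
        (I / 2) * ((dd v (dd (cvec n β I) g) z : ℝ) : ℂ) := by
    intro v
    rw [e1.fderiv_eq]
    have d1 := cd2_dd_diff h (cvec n β 1)
    have d2 := cd2_dd_diff h (cvec n β I)
    have c1 : DifferentiableAt ℝ (fun y => ((dd (cvec n β 1) g y : ℝ) : ℂ)) z :=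
      Complex.ofRealCLM.differentiableAt.comp z d1
    have c2 : DifferentiableAt ℝ (fun y => ((dd (cvec n β I) g y : ℝ) : ℂ)) z :=
      Complex.ofRealCLM.differentiableAt.comp z d2
    rw [fderiv_fun_add (c1.const_mul _) (c2.const_mul _), fderiv_const_mul c1, fderiv_const_mul c2]
    simp only [ContinuousLinearMap.add_apply, ContinuousLinearMap.smul_apply, smul_eq_mul]
    rw [fderiv_ofReal d1, fderiv_ofReal d2]
  rw [e2, e2]
  simp only [hMat, Matrix.of_apply]
  push_cast
  linear_combination (-(1 / 4 : ℂ) * ((dd (cvec n α I) (dd (cvec n β I) g) z : ℝ) : ℂ)) * Complex.I_sq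

theorem dd_slice {g : En n → ℝ} {z : Cn n} {t : ℝ} (h : DifferentiableAt ℝ g (z, t)) (v : Cn n) :
    dd v (fun w => g (w, t)) z = dd (sx v) g (z, t) := by
  have h1 : HasFDerivAt (fun w : Cn n => (w, t)) ((ContinuousLinearMap.id ℝ (Cn n)).prod 0) z :=
    (hasFDerivAt_id z).prodMk (hasFDerivAt_const t z)
  have h2 := h.hasFDerivAt.comp z h1
  unfold dd
  have h3 : fderiv ℝ (fun w => g (w, t)) z = _ := h2.fderiv
  rw [h3]; rfl

theorem slice_ev {g : En n → ℝ} {z : Cn n} {t : ℝ} {P : En n → Prop} (h : ∀ᶠ q in 𝓝 (z, t), P q) :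
    ∀ᶠ w in 𝓝 z, P (w, t) := by
  have : Continuous fun w : Cn n => (w, t) := by fun_prop
  exact this.continuousAt.eventually h

theorem slice_cd {g : En n → ℝ} {z : Cn n} {t : ℝ} (h : ContDiffAt ℝ 2 g (z, t)) :
    ContDiffAt ℝ 2 (fun w => g (w, t)) z :=
  ContDiffAt.comp z (g := g) (f := fun w : Cn n => (w, t)) h
    (contDiffAt_id.prodMk contDiffAt_const)

theorem dd_dd_slice {g : En n → ℝ} {z : Cn n} {t : ℝ} (h : ContDiffAt ℝ 2 g (z, t)) (v w : Cn n) :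
    dd v (dd w (fun y => g (y, t))) z = D2 g (z, t) v w := by
  have e : dd w (fun y => g (y, t)) =ᶠ[𝓝 z] fun y => dd (sx w) g (y, t) := by
    filter_upwards [slice_ev (g := g) (cd2_ev h)] with y hy using dd_slice hy w
  rw [dd_congr e, dd_slice (cd2_dd_diff h _)]; rfl

theorem cHess_slice {g : En n → ℝ} {z : Cn n} {t : ℝ} (h : ContDiffAt ℝ 2 g (z, t)) :
    cHess (fun w => g (w, t)) z = hMat (D2 g (z, t)) := by
  rw [cHess_eq (slice_cd h)]
  congr 1; funext v w; exact dd_dd_slice h v w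

theorem lap_slice {g : En n → ℝ} {z : Cn n} {t : ℝ} (h : ContDiffAt ℝ 2 g (z, t)) :
    lap (fun w => g (w, t)) z = ∑ α, (D2 g (z, t) (cvec n α 1) (cvec n α 1) +
      D2 g (z, t) (cvec n α I) (cvec n α I)) := by
  simp only [lap, lapW, fderivWithin_univ]
  refine Finset.sum_congr rfl fun α _ => ?_
  rw [← dd_dd_slice h, ← dd_dd_slice h]; rfl

theorem deriv_slice {g : En n → ℝ} {z : Cn n} {t : ℝ} (h : DifferentiableAt ℝ g (z, t)) :
    HasDerivAt (fun s => g (z, s)) (dd st g (z, t)) t := by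
  have h1 : HasDerivAt (fun s : ℝ => (z, s)) ((0 : Cn n), (1 : ℝ)) t :=
    (hasDerivAt_const t z).prodMk (hasDerivAt_id t)
  exact h.hasFDerivAt.comp_hasDerivAt t h1

end Slices

section Solution

/-- Interior information about a solution. -/
structure Sol (Ω : Set (Cn n)) (T Cf : ℝ) (u F : En n → ℝ) : Prop where
  op : IsOpen (Ω ×ˢ Ioo (0:ℝ) T)
  su : ContDiffOn ℝ ∞ u (Ω ×ˢ Ioo (0:ℝ) T)
  sF : ContDiffOn ℝ ∞ F (Ω ×ˢ Ioo (0:ℝ) T)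
  pos : ∀ p ∈ Ω ×ˢ Ioo (0:ℝ) T, (hMat (D2 u p)).PosDef
  eq : ∀ p ∈ Ω ×ˢ Ioo (0:ℝ) T, dd st u p = Real.log (hMat (D2 u p)).det.re + F p
  bF : ∀ p ∈ Ω ×ˢ Ioo (0:ℝ) T, |F p| ≤ Cf
  dF : ∀ p ∈ Ω ×ˢ Ioo (0:ℝ) T, ∃ c : ℝ, -Cf ≤ c ∧ c ≤ 0 ∧
    (∀ ξ : Cn n, |dd (sx ξ) F p - c * dd (sx ξ) u p| ≤ Cf * ‖ξ‖) ∧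
    |dd st F p - c * dd st u p| ≤ Cf ∧
    ∀ ξ : Cn n, dd (sx ξ) (dd (sx ξ) F) p ≤ c * dd (sx ξ) (dd (sx ξ) u) p
      + Cf * (‖ξ‖ + |dd (sx ξ) u p|) ^ 2

theorem Sol.frame {Ω : Set (Cn n)} {T Cf : ℝ} {u F : En n → ℝ} (S : Sol Ω T Cf u F)
    {p : En n} (hp : p ∈ Ω ×ˢ Ioo (0:ℝ) T) : ∃ e, FrameAt (hMat (D2 u p)) e :=
  exists_frame (S.pos p hp)

/-- linearized equations -/
theorem Sol.lin {Ω : Set (Cn n)} {T Cf : ℝ} {u F : En n → ℝ} (S : Sol Ω T Cf u F)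
    {p : En n} (hp : p ∈ Ω ×ˢ Ioo (0:ℝ) T) {e : Fin n → Cn n} (E : FrameAt (hMat (D2 u p)) e)
    (w : En n) : Lop e (dd w u) p = dd w F p ∧ Lop e (dd w (dd w u)) p ≤ dd w (dd w F) p := by
  set Q := Ω ×ˢ Ioo (0:ℝ) T with hQ
  set K : En n → ℝ := fun q => dd st u q - F q - 1 / 4 * ∑ k, (dd (sx (e k)) (dd (sx (e k)) u) q
    + dd (sx (I • e k)) (dd (sx (I • e k)) u) q) with hK
  have s2 : ∀ v : En n, ContDiffOn ℝ ∞ (dd v (dd v u)) Q := fun v =>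
    dd_smooth S.op (dd_smooth S.op S.su v) v
  have J : HasJet K p (fun v => dd v (dd st u) p - dd v F p - 1 / 4 * ∑ k,
      (dd v (dd (sx (e k)) (dd (sx (e k)) u)) p + dd v (dd (sx (I • e k)) (dd (sx (I • e k)) u)) p))
      (fun v => dd v (dd v (dd st u)) p - dd v (dd v F) p - 1 / 4 * ∑ k,
      (dd v (dd v (dd (sx (e k)) (dd (sx (e k)) u))) p +
        dd v (dd v (dd (sx (I • e k)) (dd (sx (I • e k)) u))) p)) := by
    refine ((HasJet.of_smooth S.op (dd_smooth S.op S.su st) hp).sub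
      (HasJet.of_smooth S.op S.sF hp)).sub (HasJet.const_mul _ (HasJet.sum _ fun k _ => ?_))
    exact (HasJet.of_smooth S.op (s2 _) hp).add (HasJet.of_smooth S.op (s2 _) hp)
  have hKq : ∀ q ∈ Q, K q = Real.log (hMat (D2 u q)).det.re - ∑ k, qf (hMat (D2 u q)) (e k) := by
    intro q hq
    have hb := D2_bil (smooth_at2 S.op S.su hq)
    simp only [hK, S.eq q hq, qf_hMat hb, ← Finset.mul_sum]
    simp only [hf, D2]; ring
  have hKp : K p = Real.log (hMat (D2 u p)).det.re - n := by
    rw [hKq p hp]; simp [E.unit]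
  have hmax : ∀ᶠ r in 𝓝 (0:ℝ), K (p + r • w) ≤ K p := by
    filter_upwards [(line_tendsto p w).eventually (S.op.mem_nhds hp)] with r hr
    rw [hKq _ hr, hKp]
    have := E.logdet _ (S.pos _ hr)
    linarith
  obtain ⟨h1, h2⟩ := J.max_dir w hmax
  have c1 : ∀ v : En n, dd w (dd v (dd v u)) p = dd v (dd v (dd w u)) p := fun v =>
    dd_comm3 S.op S.su w v v hp
  have c2 : ∀ v : En n, dd w (dd w (dd v (dd v u))) p = dd v (dd v (dd w (dd w u))) p := fun v =>
    dd_comm4 S.op S.su w w v v hp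
  have c3 : dd w (dd st u) p = dd st (dd w u) p := dd_comm_on S.op S.su w st hp
  have c4 : dd w (dd w (dd st u)) p = dd st (dd w (dd w u)) p :=
    (dd_comm3 S.op S.su st w w hp).symm
  simp only [c1, c2, c3, c4] at h1 h2
  constructor
  · simp only [Lop, hf, D2]; linarith
  · simp only [Lop, hf, D2]; linarith

end Solution

/-! ### From the hypotheses to interior information -/

section ToSol

theorem norm_fderiv_fderiv_le {W : Type*} [NormedAddCommGroup W] [NormedSpace ℝ W] {f : W → ℝ}
    {P : W} (X Y : W) : |fderiv ℝ (fderiv ℝ f) P X Y| ≤ ‖iteratedFDeriv ℝ 2 f P‖ * ‖X‖ * ‖Y‖ := by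
  have h := (iteratedFDeriv ℝ 2 f P).le_opNorm ![X, Y]
  rw [iteratedFDeriv_two_apply] at h
  simpa [Fin.prod_univ_two, mul_assoc] using h

theorem norm_fderiv_le' {W : Type*} [NormedAddCommGroup W] [NormedSpace ℝ W] {f : W → ℝ}
    {P : W} (X : W) : |fderiv ℝ f P X| ≤ ‖iteratedFDeriv ℝ 1 f P‖ * ‖X‖ := by
  have h := (iteratedFDeriv ℝ 1 f P).le_opNorm ![X]
  rw [iteratedFDeriv_one_apply] at h
  simpa using h

theorem toSol {Ω : Set (Cn n)} {T Cu Cφv Cf : ℝ} (hΩ : IsOpen Ω) {u φ : En n → ℝ}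
    {f : ℝ × Cn n × ℝ → ℝ} (H : AprioriHyps n Ω T Cu Cφv Cf u φ f) :
    Sol Ω T Cf u fun p => f (p.2, p.1, u p) := by
  obtain ⟨-, hf, hu, -, hpos, heq, -, -, hfu, hfb, -⟩ := H
  have hQ : IsOpen (Ω ×ˢ Ioo (0:ℝ) T) := hΩ.prod isOpen_Ioo
  set P : Set (ℝ × Cn n × ℝ) := Ioo (0:ℝ) T ×ˢ Ω ×ˢ (univ : Set ℝ) with hP
  have hPo : IsOpen P := isOpen_Ioo.prod (hΩ.prod isOpen_univ)
  have hfP : ContDiffOn ℝ ∞ f P := hf.mono (by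
    rintro ⟨t, z, r⟩ ⟨h1, h2, h3⟩
    exact ⟨⟨h1.1.le, h1.2⟩, subset_closure h2, h3⟩)
  set m : En n → ℝ × Cn n × ℝ := fun p => (p.2, p.1, u p) with hm
  have hmP : ∀ p ∈ Ω ×ˢ Ioo (0:ℝ) T, m p ∈ P := fun p hp => ⟨hp.2, hp.1, mem_univ _⟩
  have hms : ContDiffOn ℝ ∞ m (Ω ×ˢ Ioo (0:ℝ) T) :=
    contDiff_snd.contDiffOn.prodMk (contDiff_fst.contDiffOn.prodMk hu)
  have hF : ContDiffOn ℝ ∞ (fun p => f (m p)) (Ω ×ˢ Ioo (0:ℝ) T) := hfP.comp hms hmP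
  have hd1 : ∀ p ∈ Ω ×ˢ Ioo (0:ℝ) T, ∀ w : En n,
      fderiv ℝ m p w = (w.2, w.1, dd w u p) := by
    intro p hp w
    have h1 : HasFDerivAt m ((ContinuousLinearMap.snd ℝ (Cn n) ℝ).prod
        ((ContinuousLinearMap.fst ℝ (Cn n) ℝ).prod (fderiv ℝ u p))) p :=
      hasFDerivAt_snd.prodMk (hasFDerivAt_fst.prodMk (smooth_diff hQ hu hp).hasFDerivAt)
    rw [h1.fderiv]; rfl
  have hmd : ∀ p ∈ Ω ×ˢ Ioo (0:ℝ) T, DifferentiableAt ℝ m p := fun p hp =>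
    (hms.contDiffAt (hQ.mem_nhds hp)).differentiableAt (by simp)
  have hdF : ∀ p ∈ Ω ×ˢ Ioo (0:ℝ) T, ∀ w : En n, dd w (fun p => f (m p)) p =
      fderiv ℝ f (m p) (w.2, w.1, dd w u p) := by
    intro p hp w
    have h1 := (smooth_diff hPo hfP (hmP p hp)).hasFDerivAt.comp p (hmd p hp).hasFDerivAt
    unfold dd
    have h2 : fderiv ℝ (fun p => f (m p)) p = _ := h1.fderiv
    rw [h2, ContinuousLinearMap.comp_apply, hd1 p hp]; rfl
  have hcut : ∀ (A : (ℝ × Cn n × ℝ) →L[ℝ] ℝ) (a : ℝ) (b : Cn n) (c : ℝ),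
      A (a, b, c) = A (a, b, 0) + c * A (0, 0, 1) := by
    intro A a b c
    rw [← smul_eq_mul, ← map_smul, ← map_add]; simp
  refine ⟨hQ, hu, hF, ?_, ?_, ?_, ?_⟩
  · rintro ⟨z, t⟩ ⟨hz, ht⟩
    rw [← cHess_slice (smooth_at2 hQ hu ⟨hz, ht⟩)]
    exact hpos t ht z hz
  · rintro ⟨z, t⟩ ⟨hz, ht⟩
    rw [← cHess_slice (smooth_at2 hQ hu ⟨hz, ht⟩), ← heq z hz t ht]
    exact (deriv_slice (smooth_diff hQ hu ⟨hz, ht⟩)).deriv.symm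
  · intro p hp
    have := hfb 0 (by norm_num) (m p) (hmP p hp)
    rwa [norm_iteratedFDeriv_zero] at this
  · intro p hp
    have hb1 := hfb 1 (by norm_num) (m p) (hmP p hp)
    have hb2 := hfb 2 le_rfl (m p) (hmP p hp)
    have hfd := smooth_diff hPo hfP (hmP p hp)
    have B1 : ∀ X, |fderiv ℝ f (m p) X| ≤ Cf * ‖X‖ := fun X =>
      (norm_fderiv_le' X).trans (by gcongr)
    have hCf : 0 ≤ Cf := (norm_nonneg _).trans hb1
    refine ⟨fderiv ℝ f (m p) (0, 0, 1), ?_, ?_, fun ξ => ?_, ?_, fun ξ => ?_⟩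
    · have := B1 (0, 0, 1)
      simp only [Prod.norm_mk, norm_zero, norm_one, zero_le_one, max_eq_right, mul_one] at this
      linarith [(abs_le.1 this).1]
    · have h1 : HasDerivAt (fun y : ℝ => (p.2, p.1, y)) ((0:ℝ), (0 : Cn n), (1:ℝ)) (u p) :=
        (hasDerivAt_const _ _).prodMk ((hasDerivAt_const _ _).prodMk (hasDerivAt_id _))
      have h2 : HasDerivAt (fun y => f (p.2, p.1, y)) _ (u p) :=
        hfd.hasFDerivAt.comp_hasDerivAt (u p) h1
      rw [← h2.deriv]
      exact hfu p.2 hp.2 p.1 hp.1 (u p)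
    · rw [hdF p hp, hcut]
      have := B1 (0, ξ, 0)
      simp only [sx]
      simp only [Prod.norm_mk, norm_zero] at this
      rw [mul_comm (fderiv ℝ f (m p) (0, 0, 1)), add_sub_cancel_right]
      refine this.trans (le_of_eq ?_)
      simp
    · rw [hdF p hp, hcut]
      have := B1 (1, 0, 0)
      simp only [st]
      simp only [Prod.norm_mk, norm_zero, norm_one] at this
      rw [mul_comm (fderiv ℝ f (m p) (0, 0, 1)), add_sub_cancel_right]
      refine this.trans (le_of_eq ?_)
      simp
    · set w := sx ξ with hw
      have e : dd w (fun p => f (m p)) =ᶠ[𝓝 p] fun q => fderiv ℝ f (m q) (w.2, w.1, dd w u q) := by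
        filter_upwards [hQ.mem_nhds hp] with q hq using hdF q hq w
      rw [dd_congr e]
      have cd2 := smooth_at2 hPo hfP (hmP p hp)
      have d1 : DifferentiableAt ℝ (fderiv ℝ f) (m p) :=
        (cd2.fderiv_right (m := 1) (by norm_num)).differentiableAt (by norm_num)
      have h1 := d1.hasFDerivAt.comp p (hmd p hp).hasFDerivAt
      have h2 : HasFDerivAt (fun q : En n => ((w.2, w.1, dd w u q) : ℝ × Cn n × ℝ))
          ((0 : En n →L[ℝ] ℝ).prod ((0 : En n →L[ℝ] Cn n).prod (fderiv ℝ (dd w u) p))) p :=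
        (hasFDerivAt_const _ _).prodMk ((hasFDerivAt_const _ _).prodMk
          (smooth_diff hQ (dd_smooth hQ hu w) hp).hasFDerivAt)
      have h3 : HasFDerivAt (fun q => fderiv ℝ f (m q) (w.2, w.1, dd w u q)) _ p := h1.clm_apply h2
      have h4 : dd w (fun q => fderiv ℝ f (m q) (w.2, w.1, dd w u q)) p =
          fderiv ℝ f (m p) (0, 0, dd w (dd w u) p) +
          fderiv ℝ (fderiv ℝ f) (m p) (w.2, w.1, dd w u p) (w.2, w.1, dd w u p) := by
        unfold dd at h3 ⊢
        rw [h3.fderiv]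
        have := hd1 p hp w
        unfold dd at this
        simp [this]
      rw [h4, hcut]
      have h5 := norm_fderiv_fderiv_le (f := f) (P := m p) (w.2, w.1, dd w u p) (w.2, w.1, dd w u p)
      have h6 : ‖((w.2, w.1, dd w u p) : ℝ × Cn n × ℝ)‖ ≤ ‖ξ‖ + |dd w u p| := by
        simp only [Prod.norm_mk, hw, sx, norm_zero, Real.norm_eq_abs]
        refine max_le (by positivity) (max_le ?_ ?_)
        · linarith [abs_nonneg (dd (ξ, (0:ℝ)) u p)]
        · linarith [norm_nonneg ξ]
      have h7 : ‖iteratedFDeriv ℝ 2 f (m p)‖ * ‖((w.2, w.1, dd w u p) : ℝ × Cn n × ℝ)‖ *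
          ‖((w.2, w.1, dd w u p) : ℝ × Cn n × ℝ)‖ ≤ Cf * (‖ξ‖ + |dd w u p|) * (‖ξ‖ + |dd w u p|) := by
        gcongr
      have h8 := (le_abs_self _).trans (h5.trans h7)
      have h9 : fderiv ℝ f (m p) (0, 0, 0) = 0 := by
        have : ((0, 0, 0) : ℝ × Cn n × ℝ) = 0 := rfl
        rw [this, map_zero]
      rw [h9]
      linarith [h8]

end ToSol

/-! ### Bounds on derivatives -/

/-- spatial derivatives up to order `k` bounded -/
def Bk (Q : Set (En n)) (k : ℕ) (C : ℝ) (g : En n → ℝ) : Prop :=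
  ∀ p ∈ Q, ∀ j ≤ k, ‖iteratedFDeriv ℝ j (fun w => g (w, p.2)) p.1‖ ≤ C

theorem slice_smooth {Q : Set (En n)} (hQ : IsOpen Q) {g : En n → ℝ} (hg : ContDiffOn ℝ ∞ g Q)
    {p : En n} (hp : p ∈ Q) : ContDiffAt ℝ ∞ (fun w => g (w, p.2)) p.1 :=
  ContDiffAt.comp p.1 (g := g) (f := fun w : Cn n => (w, p.2)) (hg.contDiffAt (hQ.mem_nhds hp))
    (contDiffAt_id.prodMk contDiffAt_const)

theorem Bk.step {Q : Set (En n)} (hQ : IsOpen Q) {g : En n → ℝ} (hg : ContDiffOn ℝ ∞ g Q) {k : ℕ}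
    {C : ℝ} (h : Bk Q (k + 1) C g) (v : Cn n) : Bk Q k (C * ‖v‖) (dd (sx v) g) := by
  intro p hp j hj
  have e : (fun w => dd (sx v) g (w, p.2)) =ᶠ[𝓝 p.1] fun y => fderiv ℝ (fun w => g (w, p.2)) y v := by
    filter_upwards [slice_ev (g := g) (z := p.1) (t := p.2) (hQ.mem_nhds hp)] with y hy
    exact (dd_slice (smooth_diff hQ hg hy) v).symm
  rw [(e.iteratedFDeriv ℝ j).self_of_nhds]
  have hc : ContDiffAt ℝ ∞ (fderiv ℝ (fun w => g (w, p.2))) p.1 :=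
    (slice_smooth hQ hg hp).fderiv_right (by simp)
  have h1 := norm_iteratedFDeriv_clm_apply_const (c := v) (n := j) hc (by exact_mod_cast le_top)
  refine h1.trans ?_
  rw [norm_iteratedFDeriv_fderiv, mul_comm]
  gcongr
  exact h p hp (j + 1) (by omega)

theorem Bk.val {Q : Set (En n)} {g : En n → ℝ} {k : ℕ} {C : ℝ} (h : Bk Q k C g) {p : En n}
    (hp : p ∈ Q) : |g p| ≤ C := by
  have := h p hp 0 (Nat.zero_le _)
  rw [norm_iteratedFDeriv_zero] at this
  exact this

theorem Bk.mono {Q : Set (En n)} {g : En n → ℝ} {k l : ℕ} {C : ℝ} (h : Bk Q k C g) (hl : l ≤ k) :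
    Bk Q l C g := fun p hp j hj => h p hp j (hj.trans hl)

/-- uniform bounds of value, first and second space derivatives and time derivative -/
structure C2b (Q : Set (En n)) (K : ℝ) (g : En n → ℝ) : Prop where
  sm : ContDiffOn ℝ ∞ g Q
  b0 : ∀ p ∈ Q, |g p| ≤ K
  b1 : ∀ p ∈ Q, ∀ v, |dd (sx v) g p| ≤ K * ‖v‖
  b2 : ∀ p ∈ Q, ∀ v w, |D2 g p v w| ≤ K * ‖v‖ * ‖w‖
  bt : ∀ p ∈ Q, |dd st g p| ≤ K

theorem C2b.of_Bk {Q : Set (En n)} (hQ : IsOpen Q) {g : En n → ℝ} {K : ℝ}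
    (sm : ContDiffOn ℝ ∞ g Q) (h : Bk Q 2 K g) (ht : ∀ p ∈ Q, |dd st g p| ≤ K) : C2b Q K g := by
  refine ⟨sm, fun p hp => h.val hp, fun p hp v => (h.step hQ sm v).val hp, fun p hp v w => ?_, ht⟩
  have := ((h.step hQ sm w).step hQ (dd_smooth hQ sm _) v).val hp
  unfold D2
  linarith [mul_right_comm K ‖w‖ ‖v‖]

theorem C2b.mono {Q Q' : Set (En n)} {g : En n → ℝ} {K K' : ℝ} (h : C2b Q K g) (hQ : Q' ⊆ Q)
    (hK : K ≤ K') : C2b Q' K' g := by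
  refine ⟨h.sm.mono hQ, fun p hp => (h.b0 p (hQ hp)).trans hK, fun p hp v =>
    (h.b1 p (hQ hp) v).trans (by gcongr), fun p hp v w => (h.b2 p (hQ hp) v w).trans (by gcongr),
    fun p hp => (h.bt p (hQ hp)).trans hK⟩

theorem C2b.const (Q : Set (En n)) (c : ℝ) : C2b Q |c| (fun _ => c) := by
  have e : ∀ w : En n, dd w (fun _ : En n => c) = fun _ => 0 := fun w => by funext q; simp [dd]
  have e0 : ∀ w : En n, dd w (fun _ : En n => (0:ℝ)) = fun _ => 0 := fun w => by funext q; simp [dd]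
  refine ⟨contDiffOn_const, fun p _ => le_rfl, fun p _ v => ?_, fun p _ v w => ?_, fun p _ => ?_⟩
  · rw [e]; simp; positivity
  · rw [D2, e, e0]; simp; positivity
  · rw [e]; simp

theorem C2b.add {Q : Set (En n)} (hQ : IsOpen Q) {g k : En n → ℝ} {A B : ℝ} (G : C2b Q A g)
    (K : C2b Q B k) : C2b Q (A + B) (fun q => g q + k q) := by
  have d1 : ∀ w : En n, ∀ p ∈ Q, dd w (fun q => g q + k q) p = dd w g p + dd w k p := fun w p hp =>
    dd_add w (smooth_diff hQ G.sm hp) (smooth_diff hQ K.sm hp)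
  have ab : ∀ {a b A B : ℝ}, |a| ≤ A → |b| ≤ B → |a + b| ≤ A + B := fun h1 h2 =>
    (abs_add_le _ _).trans (add_le_add h1 h2)
  refine ⟨G.sm.add K.sm, fun p hp => ab (G.b0 p hp) (K.b0 p hp), fun p hp v => ?_,
    fun p hp v w => ?_, fun p hp => ?_⟩
  · rw [d1 _ p hp, add_mul]; exact ab (G.b1 p hp v) (K.b1 p hp v)
  · rw [D2, dd_eqOn hQ (d1 (sx w)) (sx v) hp, dd_add _ (smooth_diff hQ (dd_smooth hQ G.sm _) hp)
      (smooth_diff hQ (dd_smooth hQ K.sm _) hp), add_mul, add_mul]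
    exact ab (G.b2 p hp v w) (K.b2 p hp v w)
  · rw [d1 _ p hp]; exact ab (G.bt p hp) (K.bt p hp)

theorem C2b.mul {Q : Set (En n)} (hQ : IsOpen Q) {g k : En n → ℝ} {A B : ℝ} (G : C2b Q A g)
    (K : C2b Q B k) : C2b Q (4 * (A * B)) (fun q => g q * k q) := by
  have d1 : ∀ w : En n, ∀ p ∈ Q, dd w (fun q => g q * k q) p = g p * dd w k p + k p * dd w g p :=
    fun w p hp => dd_mul w (smooth_diff hQ G.sm hp) (smooth_diff hQ K.sm hp)
  have ml : ∀ {a b A B : ℝ}, |a| ≤ A → |b| ≤ B → |a * b| ≤ A * B := fun {a b A B} h1 h2 => by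
    rw [abs_mul]; exact mul_le_mul h1 h2 (abs_nonneg _) ((abs_nonneg _).trans h1)
  refine ⟨G.sm.mul K.sm, fun p hp => ?_, fun p hp v => ?_, fun p hp v w => ?_, fun p hp => ?_⟩
  · have := ml (G.b0 p hp) (K.b0 p hp)
    have h0 := (abs_nonneg _).trans this
    linarith
  · rw [d1 _ p hp]
    have h1 := ml (G.b0 p hp) (K.b1 p hp v)
    have h2 := ml (K.b0 p hp) (G.b1 p hp v)
    have h0 := (abs_nonneg _).trans h1
    calc _ ≤ _ := abs_add_le _ _
      _ ≤ _ := add_le_add h1 h2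
      _ ≤ _ := by linarith
  · rw [D2, dd_eqOn hQ (d1 (sx w)) (sx v) hp]
    have a1 := smooth_diff hQ G.sm hp
    have a2 := smooth_diff hQ K.sm hp
    have a3 := smooth_diff hQ (dd_smooth hQ G.sm (sx w)) hp
    have a4 := smooth_diff hQ (dd_smooth hQ K.sm (sx w)) hp
    rw [dd_add _ (a1.fun_mul a4) (a2.fun_mul a3), dd_mul _ a1 a4, dd_mul _ a2 a3]
    have h1 := ml (G.b0 p hp) (K.b2 p hp v w)
    have h2 := ml (K.b1 p hp w) (G.b1 p hp v)
    have h3 := ml (K.b0 p hp) (G.b2 p hp v w)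
    have h4 := ml (G.b1 p hp w) (K.b1 p hp v)
    simp only [D2] at h1 h3
    rw [abs_le] at *
    constructor <;> nlinarith
  · rw [d1 _ p hp]
    have h1 := ml (G.b0 p hp) (K.bt p hp)
    have h2 := ml (K.b0 p hp) (G.bt p hp)
    have h0 := (abs_nonneg _).trans h1
    calc _ ≤ _ := abs_add_le _ _
      _ ≤ _ := add_le_add h1 h2
      _ ≤ _ := by linarith

/-- `g`, its first and second spatial derivatives are `C2b`. -/
structure C4b (Q : Set (En n)) (K : ℝ) (g : En n → ℝ) : Prop where
  o0 : C2b Q K g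
  o1 : ∀ v, C2b Q (K * ‖v‖) (dd (sx v) g)
  o2 : ∀ v w, C2b Q (K * ‖v‖ * ‖w‖) (fun p => D2 g p v w)

theorem C4b.of_Bk {Q : Set (En n)} (hQ : IsOpen Q) {g : En n → ℝ} {K : ℝ}
    (sm : ContDiffOn ℝ ∞ g Q) (h : Bk Q 4 K g) (ht : Bk Q 2 K (dd st g)) : C4b Q K g := by
  have st' := dd_smooth hQ sm st
  refine ⟨.of_Bk hQ sm (h.mono (by norm_num)) fun p hp => ht.val hp, fun v => ?_, fun v w => ?_⟩
  · refine .of_Bk hQ (dd_smooth hQ sm _) ((h.step hQ sm v).mono (by norm_num)) fun p hp => ?_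
    rw [dd_comm_on hQ sm _ _ hp]
    exact (ht.step hQ st' v).val hp
  · have s1 := dd_smooth hQ sm (sx w)
    have h2 : Bk Q 2 (K * ‖v‖ * ‖w‖) (fun p => D2 g p v w) := by
      have := (h.step hQ sm w).step hQ s1 v
      rw [mul_right_comm]; exact this
    refine .of_Bk hQ (dd_smooth hQ s1 (sx v)) h2 fun p hp => ?_
    have : dd st (fun p => D2 g p v w) p = dd (sx v) (dd (sx w) (dd st g)) p :=
      dd_comm3 hQ sm st (sx v) (sx w) hp
    rw [this, mul_right_comm]
    exact ((ht.step hQ st' w).step hQ (dd_smooth hQ st' _) v).val hp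

theorem C4b.mono {Q Q' : Set (En n)} {g : En n → ℝ} {K K' : ℝ} (h : C4b Q K g) (hQ : Q' ⊆ Q)
    (hK : K ≤ K') : C4b Q' K' g :=
  ⟨h.o0.mono hQ hK, fun v => (h.o1 v).mono hQ (by gcongr), fun v w => (h.o2 v w).mono hQ (by gcongr)⟩

/-- composition of jets with linear maps -/
theorem dd_comp_clm {W V : Type*} [NormedAddCommGroup W] [NormedSpace ℝ W] [NormedAddCommGroup V]
    [NormedSpace ℝ V] (L : W →L[ℝ] V) {g : V → ℝ} {p : W} (h : DifferentiableAt ℝ g (L p)) (w : W) :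
    dd w (fun q => g (L q)) p = dd (L w) g (L p) := by
  have h1 := h.hasFDerivAt.comp p L.hasFDerivAt
  unfold dd
  have h3 : fderiv ℝ (fun q => g (L q)) p = _ := h1.fderiv
  rw [h3]; rfl

/-- lft of a spatial function -/
def lft (g : Cn n → ℝ) : En n → ℝ := fun p => g p.1

theorem lift_smooth {O : Set (Cn n)} {g : Cn n → ℝ} (h : ContDiffOn ℝ ∞ g O) :
    ContDiffOn ℝ ∞ (lft g) (O ×ˢ univ) :=
  h.comp contDiff_fst.contDiffOn fun _ hp => hp.1

theorem dd_lift {g : Cn n → ℝ} {p : En n} (h : DifferentiableAt ℝ g p.1) (w : En n) :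
    dd w (lft g) p = dd w.1 g p.1 :=
  dd_comp_clm (ContinuousLinearMap.fst ℝ (Cn n) ℝ) h w

theorem dd_st_lift (g : Cn n → ℝ) (p : En n) : dd st (lft g) p = 0 := by
  by_cases h : DifferentiableAt ℝ (lft g) p
  · have h1 := (deriv_slice (z := p.1) (t := p.2) h)
    have h2 : HasDerivAt (fun s : ℝ => lft g (p.1, s)) 0 p.2 := hasDerivAt_const p.2 (g p.1)
    exact h1.unique h2
  · simp [dd, fderiv_zero_of_not_differentiableAt h]

theorem lift_C4b {O : Set (Cn n)} (hO : IsOpen O) {g : Cn n → ℝ} (h : ContDiffOn ℝ ∞ g O) {K : ℝ}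
    (hK : 0 ≤ K) (hb : ∀ z ∈ O, ∀ j ≤ 4, ‖iteratedFDeriv ℝ j g z‖ ≤ K) :
    C4b (O ×ˢ (univ : Set ℝ)) K (lft g) := by
  refine C4b.of_Bk (hO.prod isOpen_univ) (lift_smooth h) (fun p hp j hj => hb p.1 hp.1 j hj) ?_
  have : (dd st (lft g) : En n → ℝ) = fun _ => 0 := by funext p; exact dd_st_lift g p
  rw [this]
  intro p hp j hj
  have : iteratedFDeriv ℝ j (fun _ : Cn n => (0:ℝ)) p.1 = 0 := by
    simp
  simpa [this] using hK

theorem C2b.nonneg {Q : Set (En n)} {K : ℝ} {g : En n → ℝ} (h : C2b Q K g) {p : En n} (hp : p ∈ Q) :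
    0 ≤ K := (abs_nonneg _).trans (h.b0 p hp)

/-! ### The domain -/

structure Dom (Ω : Set (Cn n)) (ρ : Cn n → ℝ) (O : Set (Cn n)) (δ c C : ℝ) : Prop where
  op : IsOpen Ω
  bd : IsBounded Ω
  ne : Ω.Nonempty
  opO : IsOpen O
  hδ : 0 < δ
  hc : 0 < c
  hC : 1 ≤ C
  ball : ∀ p ∈ closure Ω, Metric.ball p δ ⊆ O
  sm : ContDiffOn ℝ ∞ ρ O
  eq : Ω = {z ∈ O | ρ z < 0}
  fr : ∀ z ∈ frontier Ω, ρ z = 0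
  b4 : ∀ z ∈ O, ∀ j ≤ 4, ‖iteratedFDeriv ℝ j ρ z‖ ≤ C
  bz : ∀ z ∈ O, ‖z‖ ≤ C
  psh : ∀ z ∈ O, ∀ v, 4 * c * ‖v‖ ^ 2 ≤ hf (fun v w => dd v (dd w ρ) z) v v
  grad : ∀ p ∈ frontier Ω, ∃ (ν : Cn n) (γ : ℝ), ‖ν‖ = 1 ∧ c ≤ γ ∧ γ ≤ C ∧
    ∀ x, dd x ρ p = γ * (inner ℂ ν x).re

/-- real linear functionals through the Hermitian inner product -/
theorem exists_grad (l : Cn n →ₗ[ℝ] ℝ) : ∃ G : Cn n, ∀ x, l x = (inner ℂ G x).re := by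
  refine ⟨WithLp.toLp 2 fun α => ((l (cvec n α 1) : ℝ) : ℂ) + I * ((l (cvec n α I) : ℝ) : ℂ), fun x => ?_⟩
  conv_lhs => rw [← sum_cvec x]
  rw [map_sum, PiLp.inner_apply, Complex.re_sum]
  refine Finset.sum_congr rfl fun α _ => ?_
  rw [cvec_eq α (x α), map_add, map_smul, map_smul]
  simp

theorem Dom.exists {Ω : Set (Cn n)} (h : IsSPCDomain Ω) : ∃ ρ O δ c C, Dom Ω ρ O δ c C := by
  obtain ⟨op, ne, bd, U, ρ, hU, hUb, hcl, hs, hpd, heq, hfr⟩ := h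
  have hK : IsCompact (closure Ω) := bd.isCompact_closure
  obtain ⟨δ, hδ, hδU⟩ := hK.exists_cthickening_subset_open hU hcl
  set O := thickening δ (closure Ω) with hO
  have hOU : O ⊆ U := (thickening_subset_cthickening _ _).trans hδU
  have hK' : IsCompact (cthickening δ (closure Ω)) := hK.cthickening
  have hOK : O ⊆ cthickening δ (closure Ω) := thickening_subset_cthickening _ _
  -- bounds
  have hb : ∀ j : ℕ, ∃ C, ∀ z ∈ cthickening δ (closure Ω), ‖iteratedFDeriv ℝ j ρ z‖ ≤ C := fun j =>
    hK'.exists_bound_of_continuousOn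
      ((ContinuousOn.continuousOn_iteratedFDeriv hs hU (by exact_mod_cast le_top)).mono hδU)
  choose Cb hCb using hb
  obtain ⟨Cz, hCz⟩ := hK'.exists_bound_of_continuousOn (f := fun z : Cn n => z) continuous_id.continuousOn
  have frz : ∀ z ∈ frontier Ω, ρ z = 0 := by
    intro z hz
    have hzU : z ∈ U := hcl hz.1
    rw [op.frontier_eq] at hz
    have h1 : 0 ≤ ρ z := by
      by_contra hn
      exact hz.2 (by rw [heq]; exact ⟨hzU, not_le.1 hn⟩)
    have h2 : ρ z ≤ 0 := by
      have hc : ContinuousWithinAt ρ Ω z :=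
        ((hs.continuousOn).continuousAt (hU.mem_nhds hzU)).continuousWithinAt
      have : z ∈ closure Ω := hz.1
      exact hc.closure_le this continuousWithinAt_const (fun y hy => by
        rw [heq] at hy; exact hy.2.le)
    linarith
  -- psh
  have hpsh : ∃ c0 > 0, ∀ z ∈ O, ∀ v, 4 * c0 * ‖v‖ ^ 2 ≤ hf (fun v w => dd v (dd w ρ) z) v v := by
    have cont : ContinuousOn (fun q : Cn n × Cn n => hf (fun v w => dd v (dd w ρ) q.1) q.2 q.2)
        (cthickening δ (closure Ω) ×ˢ sphere 0 1) := by
      have h1 : ContinuousOn (fderiv ℝ (fderiv ℝ ρ)) U :=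
        ((hs.fderiv_of_isOpen (m := ∞) hU (by simp)).fderiv_of_isOpen (m := ∞) hU (by simp)).continuousOn
      have h2 : ContinuousOn (fun q : Cn n × Cn n => fderiv ℝ (fderiv ℝ ρ) q.1 q.2 q.2 +
          fderiv ℝ (fderiv ℝ ρ) q.1 (I • q.2) (I • q.2)) (cthickening δ (closure Ω) ×ˢ sphere 0 1) := by
        have h3 : ContinuousOn (fun q : Cn n × Cn n => fderiv ℝ (fderiv ℝ ρ) q.1)
            (cthickening δ (closure Ω) ×ˢ sphere 0 1) :=
          h1.comp continuous_fst.continuousOn fun q hq => hδU hq.1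
        have h4 : Continuous fun q : Cn n × Cn n => I • q.2 := by fun_prop
        exact ((h3.clm_apply continuous_snd.continuousOn).clm_apply continuous_snd.continuousOn).add
          ((h3.clm_apply h4.continuousOn).clm_apply h4.continuousOn)
      refine h2.congr fun q hq => ?_
      have := smooth_at2 hU hs (hδU hq.1)
      simp only [hf]
      rw [dd_dd this, dd_dd this]
    have pos : ∀ z ∈ U, ∀ v, v ≠ 0 → 0 < hf (fun v w => dd v (dd w ρ) z) v v := by
      intro z hz v hv
      have h2 := smooth_at2 hU hs hz
      have h1 := hpd z hz
      rw [cHess_eq h2] at h1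
      have h3 := qf_posDef h1 hv
      rw [qf_hMat] at h3
      · linarith
      · exact ⟨fun a b w => dd_add_dir _ _ _ _, fun a b w => dd_smul_dir _ _ _ _, fun v w => dd_comm2 h2 v w⟩
    rcases (cthickening δ (closure Ω) ×ˢ sphere (0 : Cn n) 1).eq_empty_or_nonempty with he | hne
    · refine ⟨1, one_pos, fun z hz v => ?_⟩
      have hv : v = 0 := by
        by_contra hv
        have : (z, (‖v‖⁻¹ : ℝ) • v) ∈ (∅ : Set (Cn n × Cn n)) := by
          rw [← he]; refine ⟨hOK hz, ?_⟩
          simp [norm_smul, hv]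
        exact this
      subst hv
      have h2 := smooth_at2 hU hs (hOU hz)
      have hB : IsBil fun v w => dd v (dd w ρ) z :=
        ⟨fun a b w => dd_add_dir _ _ _ _, fun a b w => dd_smul_dir _ _ _ _, fun v w => dd_comm2 h2 v w⟩
      have := hB.zero 0
      simp [hf, this]
    · obtain ⟨q, hq, hmin⟩ := (hK'.prod (isCompact_sphere 0 1)).exists_isMinOn hne cont
      set m := hf (fun v w => dd v (dd w ρ) q.1) q.2 q.2 with hm
      have hmpos : 0 < m := pos q.1 (hδU hq.1) q.2 (by
        have := hq.2
        simp only [mem_sphere_iff_norm, sub_zero] at this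
        intro h0; rw [h0] at this; simp at this)
      refine ⟨m / 4, by positivity, fun z hz v => ?_⟩
      have h2 := smooth_at2 hU hs (hOU hz)
      have hB : IsBil fun v w => dd v (dd w ρ) z :=
        ⟨fun a b w => dd_add_dir _ _ _ _, fun a b w => dd_smul_dir _ _ _ _, fun v w => dd_comm2 h2 v w⟩
      by_cases hv : v = 0
      · subst hv
        have := hB.zero 0
        simp [hf, this]
      · have hm2 : m ≤ hf (fun v w => dd v (dd w ρ) z) ((‖v‖⁻¹ : ℝ) • v) ((‖v‖⁻¹ : ℝ) • v) :=
          hmin (show (z, (‖v‖⁻¹ : ℝ) • v) ∈ _ from ⟨hOK hz, by simp [norm_smul, hv]⟩)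
        have e : hf (fun v w => dd v (dd w ρ) z) ((‖v‖⁻¹ : ℝ) • v) ((‖v‖⁻¹ : ℝ) • v)
            = (‖v‖⁻¹) ^ 2 * hf (fun v w => dd v (dd w ρ) z) v v := by
          have s1 := hB.smul
          have s2 := hB.smulr
          simp only [hf, smul_comm I (‖v‖⁻¹ : ℝ) v, s1, s2]; ring
        rw [e] at hm2
        have hvn : 0 < ‖v‖ := norm_pos_iff.2 hv
        have : m * ‖v‖ ^ 2 ≤ ((‖v‖⁻¹) ^ 2 * hf (fun v w => dd v (dd w ρ) z) v v) * ‖v‖ ^ 2 := by gcongr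
        rw [mul_right_comm, ← mul_pow, inv_mul_cancel₀ hvn.ne', one_pow, one_mul] at this
        linarith
  obtain ⟨c0, hc0, hpsh⟩ := hpsh
  -- gradient
  have hg : ∃ c1 > 0, ∀ z ∈ frontier Ω, c1 ≤ ‖fderiv ℝ ρ z‖ := by
    have hKf : IsCompact (frontier Ω) := hK.of_isClosed_subset isClosed_frontier frontier_subset_closure
    have cont : ContinuousOn (fun z => ‖fderiv ℝ ρ z‖) (frontier Ω) :=
      ((hs.fderiv_of_isOpen (m := ∞) hU (by simp)).continuousOn.mono
        (frontier_subset_closure.trans hcl)).norm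
    rcases (frontier Ω).eq_empty_or_nonempty with he | hne
    · exact ⟨1, one_pos, by simp [he]⟩
    · obtain ⟨q, hq, hmin⟩ := hKf.exists_isMinOn hne cont
      exact ⟨‖fderiv ℝ ρ q‖, norm_pos_iff.2 (hfr q hq), fun z hz => hmin hz⟩
  obtain ⟨c1, hc1, hg⟩ := hg
  set C := 1 + |Cz| + ∑ j ∈ Finset.range 5, |Cb j| with hC
  have hs0 : 0 ≤ ∑ j ∈ Finset.range 5, |Cb j| := Finset.sum_nonneg fun j _ => abs_nonneg _
  have hCj : ∀ j ≤ 4, Cb j ≤ C := by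
    intro j hj
    have := Finset.single_le_sum (f := fun j => |Cb j|) (fun j _ => abs_nonneg _)
      (Finset.mem_range.2 (by omega : j < 5))
    have h2 := le_abs_self (Cb j)
    have h3 := abs_nonneg Cz
    linarith
  have hclO : closure Ω ⊆ O := self_subset_thickening hδ _
  refine ⟨ρ, O, δ, min c0 c1, C, op, bd, ne, isOpen_thickening, hδ, lt_min hc0 hc1, ?_, ?_,
    hs.mono hOU, ?_, frz, ?_, ?_, ?_, ?_⟩
  · have h3 := abs_nonneg Cz
    linarith
  · intro p hp
    exact ball_subset_thickening hp δ
  · ext z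
    constructor
    · intro hz
      refine ⟨hclO (subset_closure hz), ?_⟩
      rw [heq] at hz; exact hz.2
    · rintro ⟨h1, h2⟩
      rw [heq]; exact ⟨hOU h1, h2⟩
  · intro z hz j hj
    exact (hCb j z (hOK hz)).trans (hCj j hj)
  · intro z hz
    have := hCz z (hOK hz)
    have h2 := le_abs_self Cz
    linarith
  · intro z hz v
    refine le_trans ?_ (hpsh z hz v)
    have := min_le_left c0 c1
    gcongr
  · intro p hp
    obtain ⟨G, hG⟩ := exists_grad (fderiv ℝ ρ p : Cn n →ₗ[ℝ] ℝ)
    have hGn : ‖fderiv ℝ ρ p‖ ≤ ‖G‖ := by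
      refine ContinuousLinearMap.opNorm_le_bound _ (norm_nonneg _) fun x => ?_
      have := hG x
      simp only [ContinuousLinearMap.coe_coe] at this
      rw [this, Real.norm_eq_abs]
      exact (Complex.abs_re_le_norm _).trans (norm_inner_le_norm _ _)
    have hGpos : 0 < ‖G‖ := lt_of_lt_of_le (lt_of_lt_of_le hc1 (hg p hp)) hGn
    refine ⟨(‖G‖⁻¹ : ℝ) • G, ‖G‖, ?_, ?_, ?_, fun x => ?_⟩
    · rw [norm_smul]; simp [hGpos.ne']
    · exact (min_le_right _ _).trans ((hg p hp).trans hGn)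
    · have h1 : fderiv ℝ ρ p G = ‖G‖ ^ 2 := by
        have := hG G
        simp only [ContinuousLinearMap.coe_coe] at this
        rw [this, inner_self_eq_norm_sq_to_K]
        norm_cast
      have h2 := norm_fderiv_le' (f := ρ) (P := p) G
      rw [h1, abs_of_nonneg (by positivity), pow_two] at h2
      have h3 := le_of_mul_le_mul_right h2 hGpos
      exact h3.trans ((hCb 1 p (hOK (hclO hp.1))).trans (hCj 1 (by norm_num)))
    · have := hG x
      simp only [ContinuousLinearMap.coe_coe] at this
      unfold dd
      rw [this]
      have e : ((‖G‖⁻¹ : ℝ) • G) = ((‖G‖⁻¹ : ℝ) : ℂ) • G :=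
        (Complex.coe_smul _ _).symm
      rw [e, inner_smul_left]
      simp only [Complex.conj_ofReal, Complex.re_ofReal_mul]
      rw [← mul_assoc, mul_inv_cancel₀ hGpos.ne', one_mul]

/-! ### Geometry of the domain -/

section Geo

variable {Ω O : Set (Cn n)} {ρ : Cn n → ℝ} {δ c C : ℝ}

theorem Dom.cl_sub (D : Dom Ω ρ O δ c C) : closure Ω ⊆ O := fun p hp =>
  D.ball p hp (mem_ball_self D.hδ)

theorem Dom.sub (D : Dom Ω ρ O δ c C) : Ω ⊆ O := subset_closure.trans D.cl_sub

theorem Dom.neg (D : Dom Ω ρ O δ c C) {z : Cn n} (hz : z ∈ Ω) : ρ z < 0 := by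
  rw [D.eq] at hz; exact hz.2

theorem Dom.cases (D : Dom Ω ρ O δ c C) {z : Cn n} (hz : z ∈ closure Ω) : z ∈ Ω ∨ z ∈ frontier Ω := by
  by_cases h : z ∈ Ω
  · exact Or.inl h
  · right; rw [D.op.frontier_eq]; exact ⟨hz, h⟩

theorem Dom.nonpos (D : Dom Ω ρ O δ c C) {z : Cn n} (hz : z ∈ closure Ω) : ρ z ≤ 0 := by
  rcases D.cases hz with h | h
  · exact (D.neg h).le
  · exact (D.fr z h).le

theorem Dom.diff (D : Dom Ω ρ O δ c C) {z : Cn n} (hz : z ∈ O) : DifferentiableAt ℝ ρ z :=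
  smooth_diff D.opO D.sm hz

theorem Dom.C4b (D : Dom Ω ρ O δ c C) : C4b (O ×ˢ (univ : Set ℝ)) C (lft ρ) :=
  lift_C4b D.opO D.sm (by linarith [D.hC]) D.b4

theorem Dom.dd_lft (D : Dom Ω ρ O δ c C) {p : En n} (hp : p.1 ∈ O) (v : Cn n) :
    dd (sx v) (lft ρ) p = dd v ρ p.1 := dd_lift (D.diff hp) _

theorem Dom.D2_lft (D : Dom Ω ρ O δ c C) {p : En n} (hp : p.1 ∈ O) (v w : Cn n) :
    D2 (lft ρ) p v w = dd v (dd w ρ) p.1 := by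
  have h : EqOn (dd (sx w) (lft ρ)) (lft (dd w ρ)) (O ×ˢ univ) := fun q hq => D.dd_lft hq.1 w
  rw [D2, dd_eqOn (D.opO.prod isOpen_univ) h (sx v) ⟨hp, mem_univ _⟩]
  exact dd_lift (smooth_diff D.opO (dd_smooth D.opO D.sm w) hp) _

theorem Dom.psh' (D : Dom Ω ρ O δ c C) {p : En n} (hp : p.1 ∈ O) (v : Cn n) :
    4 * c * ‖v‖ ^ 2 ≤ hf (D2 (lft ρ) p) v v := by
  have := D.psh p.1 hp v
  simp only [hf] at this ⊢
  rwa [D.D2_lft hp, D.D2_lft hp]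

/-- moving inside -/
theorem Dom.inward (D : Dom Ω ρ O δ c C) {p x : Cn n} (hp : p ∈ frontier Ω) (hx : dd x ρ p < 0) :
    ∃ r0 > 0, ∀ z ∈ Metric.ball p r0, ρ z ≤ 0 → ∀ r ∈ Ioc 0 r0, z + r • x ∈ Ω := by
  have hpO : p ∈ O := D.cl_sub hp.1
  have hc : ContinuousAt (dd x ρ) p :=
    (dd_smooth D.opO D.sm x).continuousOn.continuousAt (D.opO.mem_nhds hpO)
  have hev : ∀ᶠ z in 𝓝 p, z ∈ O ∧ dd x ρ z < 0 :=
    (show ∀ᶠ z in 𝓝 p, z ∈ O from D.opO.mem_nhds hpO).and (hc.eventually (gt_mem_nhds hx))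
  obtain ⟨ε, hε, hball⟩ := Metric.eventually_nhds_iff_ball.1 hev
  refine ⟨ε / (2 * (1 + ‖x‖)), by positivity, fun z hz hρ r hr => ?_⟩
  have hbig : ∀ s ∈ Icc 0 r, z + s • x ∈ Metric.ball p ε := by
    intro s hs
    rw [mem_ball_iff_norm] at hz ⊢
    have h1 : ‖z + s • x - p‖ ≤ ‖z - p‖ + s * ‖x‖ := by
      have : z + s • x - p = (z - p) + s • x := by abel
      rw [this]
      refine (norm_add_le _ _).trans ?_
      rw [norm_smul, Real.norm_eq_abs, abs_of_nonneg hs.1]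
    have h2 : s * ‖x‖ ≤ ε / (2 * (1 + ‖x‖)) * ‖x‖ := by
      gcongr; exact hs.2.trans hr.2
    have h3 : ε / (2 * (1 + ‖x‖)) * (1 + ‖x‖) = ε / 2 := by
      have : (1 + ‖x‖) ≠ 0 := by positivity
      field_simp
    nlinarith
  have hd : ∀ s ∈ Icc 0 r, HasDerivAt (fun s : ℝ => ρ (z + s • x)) (dd x ρ (z + s • x)) s := fun s hs =>
    line_hasDeriv x s (D.diff (hball _ (hbig s hs)).1)
  have hr0 : 0 < r := hr.1
  obtain ⟨s, hs, hs2⟩ := exists_hasDerivAt_eq_slope (fun s : ℝ => ρ (z + s • x))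
    (fun s => dd x ρ (z + s • x)) hr0 (fun s hs => (hd s hs).continuousAt.continuousWithinAt)
    (fun s hs => hd s ⟨hs.1.le, hs.2.le⟩)
  have h1 := (hball _ (hbig s ⟨hs.1.le, hs.2.le⟩)).2
  rw [hs2, div_neg_iff] at h1
  have h2 : ρ (z + r • x) < ρ z := by
    rcases h1 with h1 | h1
    · linarith [h1.2]
    · simp at h1; linarith [h1.1]
  rw [D.eq]
  exact ⟨(hball _ (hbig r ⟨hr0.le, le_rfl⟩)).1, by linarith⟩

theorem Dom.exists_inward (D : Dom Ω ρ O δ c C) {p : Cn n} (hp : p ∈ frontier Ω) :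
    ∃ x : Cn n, ‖x‖ = 1 ∧ dd x ρ p < 0 := by
  obtain ⟨ν, γ, h1, h2, -, h4⟩ := D.grad p hp
  refine ⟨-ν, by simpa using h1, ?_⟩
  rw [h4, inner_neg_right, inner_self_eq_norm_sq_to_K, h1]
  have := D.hc
  simp; linarith

theorem Dom.uniqueDiff (D : Dom Ω ρ O δ c C) : UniqueDiffOn ℝ (closure Ω) := by
  intro p hp
  rcases D.cases hp with h | h
  · exact (D.op.uniqueDiffWithinAt h).mono subset_closure
  · have hin : ∀ x, dd x ρ p < 0 → x ∈ tangentConeAt ℝ (closure Ω) p := by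
      intro x hx
      obtain ⟨r0, hr0, hr⟩ := D.inward h hx
      refine mem_tangentConeAt_of_add_smul_mem (l := 𝓝[>] (0:ℝ)) (c := fun r => r)
        (tendsto_id'.mpr <| nhdsGT_le_nhdsNE 0) ?_
      filter_upwards [Ioc_mem_nhdsGT hr0] with r h1
      exact subset_closure (hr p (mem_ball_self hr0) (D.nonpos hp) r h1)
    refine ⟨?_, by simpa using hp⟩
    obtain ⟨x0, -, hx0⟩ := D.exists_inward h
    have htop : Submodule.span ℝ (tangentConeAt ℝ (closure Ω) p) = ⊤ := by
      rw [eq_top_iff]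
      intro y _
      -- y = (y + k x0) - k x0
      obtain ⟨k, hk⟩ : ∃ k : ℝ, 0 < k ∧ dd (y + k • x0) ρ p < 0 := by
        refine ⟨(|dd y ρ p| + 1) / (-dd x0 ρ p), ?_, ?_⟩
        · have : 0 < -dd x0 ρ p := by linarith
          positivity
        · rw [dd_add_dir, dd_smul_dir]
          have : (|dd y ρ p| + 1) / (-dd x0 ρ p) * dd x0 ρ p = -(|dd y ρ p| + 1) := by
            have : dd x0 ρ p ≠ 0 := hx0.ne
            field_simp
          rw [this]
          linarith [le_abs_self (dd y ρ p)]
      have e : y = (y + k • x0) - k • x0 := by abel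
      rw [e]
      exact Submodule.sub_mem _ (Submodule.subset_span (hin _ hk.2))
        (Submodule.smul_mem _ _ (Submodule.subset_span (hin _ hx0)))
    rw [htop]
    exact dense_univ

/-- A function vanishing on the boundary has vanishing tangential derivatives. -/
theorem Dom.tangential (D : Dom Ω ρ O δ c C) {p τ : Cn n} (hp : p ∈ frontier Ω) (hτ : dd τ ρ p = 0)
    {F : Cn n → ℝ} {F' : Cn n →L[ℝ] ℝ} (hF : HasFDerivWithinAt F F' (closure Ω) p)
    (h0 : ∀ z ∈ frontier Ω, F z = 0) : F' τ = 0 := by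
  have hpO : p ∈ O := D.cl_sub hp.1
  obtain ⟨x, hx1, hx⟩ := D.exists_inward hp
  obtain ⟨r0, hr0, hr⟩ := D.inward hp hx
  have key : ∀ η ∈ Ioo (0:ℝ) 1, |F' τ| ≤ η * (‖τ‖ + 1 + |F' x|) := by
    intro η hη
    have hsgn : ∀ y : Cn n, Tendsto (fun r : ℝ => r⁻¹ * ρ (p + r • y)) (𝓝[>] 0) (𝓝 (dd y ρ p)) := by
      intro y
      have hd := line_hasDeriv (g := ρ) (p := p) y 0 (by simpa using D.diff hpO)
      have h1 := hd.tendsto_slope_zero_right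
      simpa [D.fr p hp] using h1
    have e1 : ∀ᶠ r : ℝ in 𝓝[>] 0, r⁻¹ * ρ (p + r • (τ + η • x)) < 0 :=
      (hsgn _).eventually (gt_mem_nhds (by rw [dd_add_dir, dd_smul_dir, hτ]; nlinarith [hη.1]))
    have e2 : ∀ᶠ r : ℝ in 𝓝[>] 0, 0 < r⁻¹ * ρ (p + r • (τ + (-η) • x)) :=
      (hsgn _).eventually (lt_mem_nhds (by rw [dd_add_dir, dd_smul_dir, hτ]; nlinarith [hη.1]))
    have hlo := hF.isLittleO.def hη.1
    obtain ⟨ε, hε, hball⟩ := Metric.mem_nhdsWithin_iff.1 hlo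
    have hbO := Metric.isOpen_iff.1 D.opO p hpO
    obtain ⟨ε2, hε2, hball2⟩ := hbO
    have hsm : ∀ᶠ r : ℝ in 𝓝[>] 0, r * (‖τ‖ + 1) < min (min ε ε2) r0 := by
      have : Tendsto (fun r : ℝ => r * (‖τ‖ + 1)) (𝓝[>] 0) (𝓝 0) := by
        have : Continuous fun r : ℝ => r * (‖τ‖ + 1) := by fun_prop
        simpa using (this.tendsto 0).mono_left nhdsWithin_le_nhds
      exact this.eventually (gt_mem_nhds (lt_min (lt_min hε hε2) hr0))
    obtain ⟨r, h1, h2, h3, h4⟩ := (e1.and (e2.and (hsm.and self_mem_nhdsWithin))).exists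
    have hrpos : (0:ℝ) < r := h4
    have hnear : ∀ s ∈ Icc (-η) η, ‖r • (τ + s • x)‖ ≤ r * (‖τ‖ + 1) := by
      intro s hs
      rw [norm_smul, Real.norm_eq_abs, abs_of_pos hrpos]
      gcongr
      refine (norm_add_le _ _).trans ?_
      rw [norm_smul, hx1, Real.norm_eq_abs, mul_one]
      have : |s| ≤ η := abs_le.2 hs
      linarith [hη.2]
    have hin : ∀ s ∈ Icc (-η) η, p + r • (τ + s • x) ∈ O := fun s hs => hball2 (by
      rw [mem_ball_iff_norm, add_sub_cancel_left]
      exact lt_of_le_of_lt (hnear s hs) (h3.trans_le ((min_le_left _ _).trans (min_le_right _ _))))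
    have hcont : ContinuousOn (fun s : ℝ => ρ (p + r • (τ + s • x))) (Icc (-η) η) := by
      refine D.sm.continuousOn.comp (by fun_prop) hin
    have hneg : ρ (p + r • (τ + η • x)) < 0 := by
      by_contra hcon
      exact absurd h1 (not_lt.2 (mul_nonneg (inv_nonneg.2 hrpos.le) (not_lt.1 hcon)))
    have hpos : 0 < ρ (p + r • (τ + (-η) • x)) := by
      by_contra hcon
      exact absurd h2 (not_lt.2 (mul_nonpos_of_nonneg_of_nonpos (inv_nonneg.2 hrpos.le) (not_lt.1 hcon)))
    obtain ⟨s, hs, hs0⟩ := intermediate_value_Icc' (by linarith [hη.1] : -η ≤ η) hcont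
      ⟨hneg.le, hpos.le⟩
    simp only at hs0
    set y := p + r • (τ + s • x) with hy
    have hyb : ‖y - p‖ ≤ r * (‖τ‖ + 1) := by
      rw [hy, add_sub_cancel_left]; exact hnear s hs
    have hyfr : y ∈ frontier Ω := by
      rw [D.op.frontier_eq]
      constructor
      · have hyr : y ∈ Metric.ball p r0 := by
          rw [mem_ball_iff_norm]; exact lt_of_le_of_lt hyb (h3.trans_le (min_le_right _ _))
        have hin2 := hr y hyr hs0.le
        have ht : Tendsto (fun r : ℝ => y + r • x) (𝓝[>] 0) (𝓝 y) :=
          (line_tendsto y x).mono_left nhdsWithin_le_nhds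
        refine mem_closure_of_tendsto ht ?_
        filter_upwards [Ioc_mem_nhdsGT hr0] with r hr' using hin2 r hr'
      · intro hcon
        have := D.neg hcon; linarith
    have hfin := hball ⟨by
      rw [mem_ball_iff_norm]
      exact lt_of_le_of_lt hyb (h3.trans_le ((min_le_left _ _).trans (min_le_left _ _))), hyfr.1⟩
    simp only [mem_ofPred_eq] at hfin
    rw [h0 y hyfr, h0 p hp] at hfin
    have e : F' (y - p) = r * (F' τ + s * F' x) := by
      rw [hy, add_sub_cancel_left]; simp; ring
    rw [e] at hfin
    simp only [sub_self, zero_sub, norm_neg, Real.norm_eq_abs, abs_mul, abs_of_pos hrpos] at hfin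
    have h5 : r * |F' τ + s * F' x| ≤ r * (η * (‖τ‖ + 1)) := by
      calc _ ≤ _ := hfin
        _ ≤ η * (r * (‖τ‖ + 1)) := mul_le_mul_of_nonneg_left hyb hη.1.le
        _ = _ := by ring
    have h6 := le_of_mul_le_mul_left h5 hrpos
    have h7 : |F' τ| ≤ |F' τ + s * F' x| + |s| * |F' x| := by
      rw [← abs_mul]
      have := abs_sub (F' τ + s * F' x) (s * F' x)
      simpa using this
    have h8 : |s| ≤ η := abs_le.2 hs
    nlinarith [abs_nonneg (F' x)]
  by_contra hne
  have hpos : 0 < |F' τ| := abs_pos.2 hne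
  set B := ‖τ‖ + 1 + |F' x| with hB
  have hBpos : 0 < B := by positivity
  have h1 := key (min (1/2) (|F' τ| / (2 * B))) ⟨by positivity, lt_of_le_of_lt (min_le_left _ _) (by norm_num)⟩
  have h2 : min (1/2) (|F' τ| / (2 * B)) * B ≤ |F' τ| / (2 * B) * B := by
    gcongr; exact min_le_right _ _
  have h3 : |F' τ| / (2 * B) * B = |F' τ| / 2 := by field_simp
  linarith

end Geo

/-! ### Regularity up to the boundary -/

structure Reg (Ω : Set (Cn n)) (T : ℝ) (g : En n → ℝ) (g1 : Cn n → En n → ℝ)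
    (g2 : Cn n → Cn n → En n → ℝ) (gt : En n → ℝ) : Prop where
  sm : ContDiffOn ℝ ∞ g (Ω ×ˢ Ioo (0:ℝ) T)
  c0 : ContinuousOn g (closure Ω ×ˢ Ico (0:ℝ) T)
  c1 : ∀ v, ContinuousOn (g1 v) (closure Ω ×ˢ Ioo (0:ℝ) T)
  c2 : ∀ v w, ContinuousOn (g2 v w) (closure Ω ×ˢ Ioo (0:ℝ) T)
  ct : ContinuousOn gt (closure Ω ×ˢ Ioo (0:ℝ) T)
  i1 : ∀ v, ∀ p ∈ Ω ×ˢ Ioo (0:ℝ) T, g1 v p = dd (sx v) g p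
  i2 : ∀ v w, ∀ p ∈ Ω ×ˢ Ioo (0:ℝ) T, g2 v w p = D2 g p v w
  it : ∀ p ∈ Ω ×ˢ Ioo (0:ℝ) T, gt p = dd st g p
  f1 : ∀ p ∈ closure Ω ×ˢ Ioo (0:ℝ) T, ∃ L : Cn n →L[ℝ] ℝ, (∀ v, L v = g1 v p) ∧
    HasFDerivWithinAt (fun z => g (z, p.2)) L (closure Ω) p.1
  f2 : ∀ w, ∀ p ∈ closure Ω ×ˢ Ioo (0:ℝ) T, ∃ L : Cn n →L[ℝ] ℝ, (∀ v, L v = g2 v w p) ∧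
    HasFDerivWithinAt (fun z => g1 w (z, p.2)) L (closure Ω) p.1
  bt : ∀ p ∈ closure Ω ×ˢ Ioo (0:ℝ) T, HasDerivAt (fun s => g (p.1, s)) (gt p) p.2

theorem dd_sub {g k : En n → ℝ} {p : En n} (hg : DifferentiableAt ℝ g p)
    (hk : DifferentiableAt ℝ k p) (w : En n) :
    dd w (fun p => g p - k p) p = dd w g p - dd w k p := by
  unfold dd; rw [fderiv_fun_sub hg hk]; rfl

theorem Reg.sub {Ω : Set (Cn n)} (hO : IsOpen Ω) {T : ℝ} {g k : En n → ℝ} {g1 k1 : Cn n → En n → ℝ}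
    {g2 k2 : Cn n → Cn n → En n → ℝ} {gt kt : En n → ℝ} (G : Reg Ω T g g1 g2 gt)
    (K : Reg Ω T k k1 k2 kt) :
    Reg Ω T (fun p => g p - k p) (fun v p => g1 v p - k1 v p) (fun v w p => g2 v w p - k2 v w p)
      (fun p => gt p - kt p) := by
  have hQ : IsOpen (Ω ×ˢ Ioo (0:ℝ) T) := hO.prod isOpen_Ioo
  have ds : ∀ w : En n, ∀ p ∈ Ω ×ˢ Ioo (0:ℝ) T, dd w (fun p => g p - k p) p = dd w g p - dd w k p := by
    intro w p hp
    unfold dd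
    rw [fderiv_fun_sub (smooth_diff hQ G.sm hp) (smooth_diff hQ K.sm hp)]; rfl
  refine ⟨G.sm.sub K.sm, G.c0.sub K.c0, fun v => (G.c1 v).sub (K.c1 v), fun v w =>
    (G.c2 v w).sub (K.c2 v w), G.ct.sub K.ct, fun v p hp => ?_, fun v w p hp => ?_, fun p hp => ?_,
    fun p hp => ?_, fun w p hp => ?_, fun p hp => (G.bt p hp).sub (K.bt p hp)⟩
  · rw [ds _ p hp, G.i1 v p hp, K.i1 v p hp]
  · rw [G.i2 v w p hp, K.i2 v w p hp, D2, D2, D2, dd_eqOn hQ (ds (sx w)) (sx v) hp]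
    exact (dd_sub (smooth_diff hQ (dd_smooth hQ G.sm (sx w)) hp)
      (smooth_diff hQ (dd_smooth hQ K.sm (sx w)) hp) (sx v)).symm
  · rw [ds _ p hp, G.it p hp, K.it p hp]
  · obtain ⟨L, h1, h2⟩ := G.f1 p hp
    obtain ⟨L', h1', h2'⟩ := K.f1 p hp
    exact ⟨L - L', fun v => by simp [h1, h1'], h2.sub h2'⟩
  · obtain ⟨L, h1, h2⟩ := G.f2 w p hp
    obtain ⟨L', h1', h2'⟩ := K.f2 w p hp
    exact ⟨L - L', fun v => by simp [h1, h1'], h2.sub h2'⟩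

section

variable {Ω O : Set (Cn n)} {ρ : Cn n → ℝ} {δ c C : ℝ}

theorem reg_phi (D : Dom Ω ρ O δ c C) {T : ℝ} {φ : En n → ℝ}
    (h : ContDiffOn ℝ ∞ φ (closure Ω ×ˢ Ico (0:ℝ) T)) : ∃ g1 g2 gt, Reg Ω T φ g1 g2 gt := by
  set K := closure Ω ×ˢ Ico (0:ℝ) T with hK
  have hU : UniqueDiffOn ℝ K := D.uniqueDiff.prod (uniqueDiffOn_Ico 0 T)
  have hQ : IsOpen (Ω ×ˢ Ioo (0:ℝ) T) := D.op.prod isOpen_Ioo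
  have hQK : Ω ×ˢ Ioo (0:ℝ) T ⊆ K := prod_mono subset_closure Ioo_subset_Ico_self
  have hIK : closure Ω ×ˢ Ioo (0:ℝ) T ⊆ K := prod_mono subset_rfl Ioo_subset_Ico_self
  have step : ∀ (g : En n → ℝ), ContDiffOn ℝ ∞ g K → ∀ w,
      ContDiffOn ℝ ∞ (fun p => fderivWithin ℝ g K p w) K := fun g hg w =>
    (hg.fderivWithin (m := ∞) hU (by simp)).clm_apply contDiffOn_const
  have inn : ∀ (g : En n → ℝ) (w : En n), ∀ p ∈ Ω ×ˢ Ioo (0:ℝ) T, fderivWithin ℝ g K p w = dd w g p := by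
    intro g w p hp
    rw [fderivWithin_of_mem_nhds (Filter.mem_of_superset (hQ.mem_nhds hp) hQK)]; rfl
  have slc : ∀ (g : En n → ℝ), ContDiffOn ℝ ∞ g K → ∀ p ∈ closure Ω ×ˢ Ioo (0:ℝ) T,
      ∃ L : Cn n →L[ℝ] ℝ, (∀ v, L v = fderivWithin ℝ g K p (sx v)) ∧
      HasFDerivWithinAt (fun z => g (z, p.2)) L (closure Ω) p.1 := by
    intro g hg p hp
    have h1 : HasFDerivWithinAt (fun w : Cn n => (w, p.2)) ((ContinuousLinearMap.id ℝ (Cn n)).prod 0)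
        (closure Ω) p.1 := ((hasFDerivAt_id p.1).prodMk (hasFDerivAt_const p.2 p.1)).hasFDerivWithinAt
    have h2 : HasFDerivWithinAt g (fderivWithin ℝ g K p) K (p.1, p.2) :=
      (hg.differentiableOn (by simp) p (hIK hp)).hasFDerivWithinAt
    have h3 := h2.comp p.1 h1 (show MapsTo (fun w : Cn n => (w, p.2)) (closure Ω) K from fun z hz => ⟨hz, (hIK hp).2⟩)
    exact ⟨_, fun v => rfl, h3⟩
  refine ⟨fun v p => fderivWithin ℝ φ K p (sx v), fun v w p => fderivWithin ℝ
    (fun q => fderivWithin ℝ φ K q (sx w)) K p (sx v), fun p => fderivWithin ℝ φ K p st,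
    h.mono hQK, h.continuousOn, fun v => (step φ h _).continuousOn.mono hIK, fun v w =>
    (step _ (step φ h _) _).continuousOn.mono hIK, (step φ h _).continuousOn.mono hIK,
    fun v p hp => inn _ _ p hp, fun v w p hp => ?_, fun p hp => inn _ _ p hp, slc φ h,
    fun w => slc _ (step φ h _), fun p hp => ?_⟩
  · rw [inn _ _ p hp, D2]
    exact dd_eqOn hQ (inn φ (sx w)) (sx v) hp
  · have h1 : HasDerivWithinAt (fun s : ℝ => (p.1, s)) ((0 : Cn n), (1 : ℝ)) (Ico 0 T) p.2 :=
      ((hasDerivAt_const p.2 p.1).prodMk (hasDerivAt_id p.2)).hasDerivWithinAt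
    have h2 : HasFDerivWithinAt φ (fderivWithin ℝ φ K p) K (p.1, p.2) :=
      (h.differentiableOn (by simp) p (hIK hp)).hasFDerivWithinAt
    have h3 := h2.comp_hasDerivWithinAt p.2 h1 (show MapsTo (fun s : ℝ => (p.1, s)) (Ico 0 T) K from fun s hs => ⟨hp.1, hs⟩)
    exact h3.hasDerivAt (Ico_mem_nhds hp.2.1 hp.2.2)

theorem reg_u (D : Dom Ω ρ O δ c C) {T : ℝ} {u : En n → ℝ} (sm : ContDiffOn ℝ ∞ u (Ω ×ˢ Ioo (0:ℝ) T))
    (h : C21 n Ω T u) : ∃ g1 g2 gt, Reg Ω T u g1 g2 gt := by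
  obtain ⟨hx, ht, hct, hc2⟩ := h
  have hU := D.uniqueDiff
  have hQ : IsOpen (Ω ×ˢ Ioo (0:ℝ) T) := D.op.prod isOpen_Ioo
  have hI : ∀ {t : ℝ}, t ∈ Ioo 0 T → t ∈ Ico 0 T := fun h => Ioo_subset_Ico_self h
  set g1 : Cn n → En n → ℝ := fun v p => fderivWithin ℝ (fun x => u (x, p.2)) (closure Ω) p.1 v with hg1
  set g2 : Cn n → Cn n → En n → ℝ := fun v w p =>
    fderivWithin ℝ (fun y => fderivWithin ℝ (fun x => u (x, p.2)) (closure Ω) y w) (closure Ω) p.1 v with hg2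
  set gt : En n → ℝ := fun p => derivWithin (fun s => u (p.1, s)) (Ico (0 : ℝ) T) p.2 with hgt
  have nh : ∀ z ∈ Ω, closure Ω ∈ 𝓝 z := fun z hz =>
    Filter.mem_of_superset (D.op.mem_nhds hz) subset_closure
  have i1 : ∀ v, ∀ p ∈ Ω ×ˢ Ioo (0:ℝ) T, g1 v p = dd (sx v) u p := by
    intro v p hp
    simp only [hg1]
    rw [fderivWithin_of_mem_nhds (nh p.1 hp.1)]
    exact dd_slice (z := p.1) (t := p.2) (smooth_diff hQ sm hp) v
  have f1 : ∀ p ∈ closure Ω ×ˢ Ioo (0:ℝ) T, ∃ L : Cn n →L[ℝ] ℝ, (∀ v, L v = g1 v p) ∧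
      HasFDerivWithinAt (fun z => u (z, p.2)) L (closure Ω) p.1 := fun p hp =>
    ⟨_, fun v => rfl, ((hx p.2 (hI hp.2)).differentiableOn (by norm_num) p.1 hp.1).hasFDerivWithinAt⟩
  have f2 : ∀ w, ∀ p ∈ closure Ω ×ˢ Ioo (0:ℝ) T, ∃ L : Cn n →L[ℝ] ℝ, (∀ v, L v = g2 v w p) ∧
      HasFDerivWithinAt (fun z => g1 w (z, p.2)) L (closure Ω) p.1 := by
    intro w p hp
    have h1 := (hx p.2 (hI hp.2)).fderivWithin (m := 1) hU (by norm_num)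
    have h2 : ContDiffOn ℝ 1 (fun y => fderivWithin ℝ (fun x => u (x, p.2)) (closure Ω) y w) (closure Ω) :=
      h1.clm_apply contDiffOn_const
    exact ⟨_, fun v => rfl, (h2.differentiableOn (by norm_num) p.1 hp.1).hasFDerivWithinAt⟩
  have c2 : ∀ v w, ContinuousOn (g2 v w) (closure Ω ×ˢ Ioo (0:ℝ) T) := fun v w =>
    (hc2 w v).mono (prod_mono subset_rfl Ioo_subset_Ico_self)
  have c1i : ∀ v, ∀ p ∈ Ω ×ˢ Ioo (0:ℝ) T, ContinuousAt (g1 v) p := by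
    intro v p hp
    have h1 : ContinuousAt (dd (sx v) u) p :=
      (dd_smooth hQ sm (sx v)).continuousOn.continuousAt (hQ.mem_nhds hp)
    refine h1.congr ?_
    filter_upwards [hQ.mem_nhds hp] with q hq using (i1 v q hq).symm
  have c1 : ∀ v, ContinuousOn (g1 v) (closure Ω ×ˢ Ioo (0:ℝ) T) := by
    rintro v ⟨p, t0⟩ ⟨hp, ht0⟩
    simp only at hp ht0
    rcases D.cases hp with hpΩ | hfr
    · exact (c1i v (p, t0) ⟨hpΩ, ht0⟩).continuousWithinAt
    obtain ⟨x, hx1, hxi⟩ := D.exists_inward hfr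
    obtain ⟨r0, hr0, hin⟩ := D.inward hfr hxi
    set M := |g2 x v (p, t0)| + 1 with hM
    have hMpos : 0 < M := by positivity
    have hbd : ∀ᶠ q in 𝓝[closure Ω ×ˢ Ioo (0:ℝ) T] (p, t0), |g2 x v q| < M := by
      have := (c2 x v (p, t0) ⟨hp, ht0⟩).abs
      exact this.eventually (gt_mem_nhds (by simp [hM]))
    obtain ⟨η, hη, hball⟩ := Metric.mem_nhdsWithin_iff.1 hbd
    have lip : ∀ z ∈ closure Ω, z ∈ Metric.ball p (min r0 (η / 2)) → ∀ t ∈ Ioo (0:ℝ) T, t ∈ Metric.ball t0 η →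
        ∀ r ∈ Ioc 0 (min r0 (η / 2)), |g1 v (z + r • x, t) - g1 v (z, t)| ≤ M * r := by
      intro z hz hzb t htI htb r hr
      have hseg : ∀ s ∈ Icc 0 r, z + s • x ∈ closure Ω ∧ z + s • x ∈ Metric.ball p η := by
        intro s hs
        constructor
        · rcases eq_or_lt_of_le hs.1 with h0 | h0
          · rw [← h0]; simpa using hz
          · exact subset_closure (hin z (Metric.ball_subset_ball (min_le_left _ _) hzb) (D.nonpos hz) s
              ⟨h0, hs.2.trans (hr.2.trans (min_le_left _ _))⟩)
        · rw [mem_ball_iff_norm] at hzb ⊢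
          have e : z + s • x - p = (z - p) + s • x := by abel
          rw [e]
          refine lt_of_le_of_lt (norm_add_le _ _) ?_
          rw [norm_smul, hx1, Real.norm_eq_abs, abs_of_nonneg hs.1]
          have h1 := hs.2.trans (hr.2.trans (min_le_right _ _))
          have h2 := hzb.trans_le (min_le_right r0 (η / 2))
          linarith
      have hder : ∀ s ∈ Icc 0 r, HasDerivWithinAt (fun s : ℝ => g1 v (z + s • x, t))
          (g2 x v (z + s • x, t)) (Icc 0 r) s := by
        intro s hs
        obtain ⟨L, hL1, hL2⟩ := f2 v (z + s • x, t) ⟨(hseg s hs).1, htI⟩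
        have h1 : HasDerivWithinAt (fun s : ℝ => z + s • x) x (Icc 0 r) s := by
          have : HasDerivAt (fun s : ℝ => z + s • x) x s := by
            simpa using ((hasDerivAt_id s).smul_const x).const_add z
          exact this.hasDerivWithinAt
        have h2 := hL2.comp_hasDerivWithinAt s h1 (fun s' hs' => (hseg s' hs').1)
        rw [hL1] at h2
        exact h2
      have hb : ∀ s ∈ Icc 0 r, ‖g2 x v (z + s • x, t)‖ ≤ M := by
        intro s hs
        have : (z + s • x, t) ∈ Metric.ball (p, t0) η := by
          rw [← ball_prod_same]; exact ⟨(hseg s hs).2, htb⟩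
        exact (hball ⟨this, (hseg s hs).1, htI⟩).le
      have := (convex_Icc 0 r).norm_image_sub_le_of_norm_hasDerivWithin_le hder hb
        (left_mem_Icc.2 hr.1.le) (right_mem_Icc.2 hr.1.le)
      simpa [abs_of_pos hr.1] using this
    rw [ContinuousWithinAt, Metric.tendsto_nhds]
    intro ε hε
    set r := min (min r0 (η / 2)) (ε / (4 * M)) with hr
    have hrpos : 0 < r := by positivity
    have hr1 : r ≤ min r0 (η / 2) := min_le_left _ _
    have hMr : M * r ≤ ε / 4 := by
      have : M * r ≤ M * (ε / (4 * M)) := by gcongr; exact min_le_right _ _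
      have e : M * (ε / (4 * M)) = ε / 4 := by field_simp
      linarith
    have hpr : p + r • x ∈ Ω := hin p (mem_ball_self hr0) (D.nonpos hp) r
      ⟨hrpos, hr1.trans (min_le_left _ _)⟩
    have hcont : ContinuousAt (fun q : En n => g1 v (q.1 + r • x, q.2)) (p, t0) := by
      have h1 : ContinuousAt (fun q : En n => (q.1 + r • x, q.2)) (p, t0) := by fun_prop
      exact ContinuousAt.comp (g := g1 v) (c1i v (p + r • x, t0) ⟨hpr, ht0⟩) h1
    have e1 : ∀ᶠ q in 𝓝[closure Ω ×ˢ Ioo (0:ℝ) T] (p, t0),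
        dist (g1 v (q.1 + r • x, q.2)) (g1 v (p + r • x, t0)) < ε / 4 :=
      (Metric.tendsto_nhds.1 hcont (ε / 4) (by positivity)).filter_mono nhdsWithin_le_nhds
    have hm : 0 < min r0 (η / 2) := by positivity
    have e2 : ∀ᶠ q in 𝓝[closure Ω ×ˢ Ioo (0:ℝ) T] (p, t0), q ∈ Metric.ball p (min r0 (η / 2)) ×ˢ Metric.ball t0 η := by
      refine nhdsWithin_le_nhds (prod_mem_nhds (ball_mem_nhds _ hm) (ball_mem_nhds _ hη))
    filter_upwards [e1, e2, self_mem_nhdsWithin] with q h1 h2 h3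
    have l1 := lip q.1 h3.1 h2.1 q.2 h3.2 h2.2 r ⟨hrpos, hr1⟩
    have l2 := lip p hp (mem_ball_self hm) t0 ht0 (mem_ball_self hη) r ⟨hrpos, hr1⟩
    rw [Real.dist_eq, abs_lt] at *
    rw [abs_le] at l1 l2
    simp only [Prod.mk.eta] at l1
    constructor <;> linarith [h1.1, h1.2, l1.1, l1.2, l2.1, l2.2]
  have c0 : ContinuousOn u (closure Ω ×ˢ Ico (0:ℝ) T) := by
    rintro ⟨p, t0⟩ ⟨hp, ht0⟩
    simp only at hp ht0
    set M := |gt (p, t0)| + 1 with hM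
    have hMpos : 0 < M := by positivity
    have hbd : ∀ᶠ q in 𝓝[closure Ω ×ˢ Ico (0:ℝ) T] (p, t0), |gt q| < M := by
      have := (hct (p, t0) ⟨hp, ht0⟩).abs
      exact this.eventually (gt_mem_nhds (by simp [hM, hgt]))
    obtain ⟨η, hη, hball⟩ := Metric.mem_nhdsWithin_iff.1 hbd
    have lip : ∀ z ∈ closure Ω, z ∈ Metric.ball p η → ∀ t ∈ Ico (0:ℝ) T, t ∈ Metric.ball t0 η →
        |u (z, t) - u (z, t0)| ≤ M * |t - t0| := by
      intro z hz hzb t htI htb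
      have hconv : Convex ℝ (Ico (0:ℝ) T ∩ Metric.ball t0 η) := (convex_Ico 0 T).inter (convex_ball _ _)
      have hder : ∀ s ∈ Ico (0:ℝ) T ∩ Metric.ball t0 η, HasDerivWithinAt (fun s : ℝ => u (z, s))
          (gt (z, s)) (Ico (0:ℝ) T ∩ Metric.ball t0 η) s := fun s hs =>
        (((ht z hz).differentiableOn (by norm_num) s hs.1).hasDerivWithinAt).mono inter_subset_left
      have hb : ∀ s ∈ Ico (0:ℝ) T ∩ Metric.ball t0 η, ‖gt (z, s)‖ ≤ M := by
        intro s hs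
        have : (z, s) ∈ Metric.ball (p, t0) η := by
          rw [← ball_prod_same]; exact ⟨hzb, hs.2⟩
        exact (hball ⟨this, hz, hs.1⟩).le
      exact hconv.norm_image_sub_le_of_norm_hasDerivWithin_le hder hb
        ⟨ht0, mem_ball_self hη⟩ ⟨htI, htb⟩
    have hs : ContinuousWithinAt (fun q : En n => u (q.1, t0)) (closure Ω ×ˢ Ico (0:ℝ) T) (p, t0) := by
      have h1 : ContinuousWithinAt (fun z => u (z, t0)) (closure Ω) p := (hx t0 ht0).continuousOn p hp
      exact ContinuousWithinAt.comp (g := fun z => u (z, t0)) (f := fun q : En n => q.1) (x := (p, t0)) h1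
        continuous_fst.continuousWithinAt (fun q hq => hq.1)
    have ht' : Tendsto (fun q : En n => M * |q.2 - t0|) (𝓝[closure Ω ×ˢ Ico (0:ℝ) T] (p, t0)) (𝓝 0) := by
      have : Continuous fun q : En n => M * |q.2 - t0| := by fun_prop
      simpa using (this.tendsto (p, t0)).mono_left nhdsWithin_le_nhds
    have hd : Tendsto (fun q : En n => u q - u (q.1, t0)) (𝓝[closure Ω ×ˢ Ico (0:ℝ) T] (p, t0)) (𝓝 0) := by
      refine squeeze_zero_norm' ?_ ht'
      have e2 : ∀ᶠ q in 𝓝[closure Ω ×ˢ Ico (0:ℝ) T] (p, t0), q ∈ Metric.ball p η ×ˢ Metric.ball t0 η :=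
        nhdsWithin_le_nhds (prod_mem_nhds (ball_mem_nhds _ hη) (ball_mem_nhds _ hη))
      filter_upwards [e2, self_mem_nhdsWithin] with q h2 h3
      exact lip q.1 h3.1 h2.1 q.2 h3.2 h2.2
    have := hd.add hs
    simpa [ContinuousWithinAt] using this
  refine ⟨g1, g2, gt, sm, c0, c1, c2, hct.mono (prod_mono subset_rfl Ioo_subset_Ico_self), i1, ?_, ?_,
    f1, f2, ?_⟩
  · intro v w p hp
    simp only [hg2]
    rw [fderivWithin_of_mem_nhds (nh p.1 hp.1)]
    have e : (fun y => fderivWithin ℝ (fun x => u (x, p.2)) (closure Ω) y w) =ᶠ[𝓝 p.1]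
        dd w (fun x => u (x, p.2)) := by
      filter_upwards [D.op.mem_nhds hp.1] with y hy
      rw [fderivWithin_of_mem_nhds (nh y hy)]; rfl
    rw [e.fderiv_eq]
    exact dd_dd_slice (z := p.1) (t := p.2) (smooth_at2 hQ sm hp) v w
  · intro p hp
    have h1 := ((ht p.1 (subset_closure hp.1)).differentiableOn (by norm_num) p.2 (hI hp.2)).hasDerivWithinAt
    have h2 := h1.hasDerivAt (Ico_mem_nhds hp.2.1 hp.2.2)
    exact h2.unique (deriv_slice (z := p.1) (t := p.2) (smooth_diff hQ sm hp))
  · intro p hp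
    have h1 := ((ht p.1 hp.1).differentiableOn (by norm_num) p.2 (hI hp.2)).hasDerivWithinAt
    exact h1.hasDerivAt (Ico_mem_nhds hp.2.1 hp.2.2)

end

/-! ### Scalar calculus for the linearized operator -/

def Gam (e : Fin n → Cn n) (a b : Cn n → ℝ) : ℝ :=
  ∑ k, (a (e k) * b (e k) + a (I • e k) * b (I • e k))

def SS (e : Fin n → Cn n) : ℝ := ∑ k, ‖e k‖ ^ 2

theorem SS_nonneg (e : Fin n → Cn n) : 0 ≤ SS e := Finset.sum_nonneg fun _ _ => by positivity

structure HasL (e : Fin n → Cn n) (g : En n → ℝ) (p : En n) (a : Cn n → ℝ) (τ σ : ℝ) : Prop where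
  cd : ContDiffAt ℝ 2 g p
  ha : ∀ v, dd (sx v) g p = a v
  ht : dd st g p = τ
  hs : 1 / 4 * ∑ k, hf (D2 g p) (e k) (e k) = σ

section HL

variable {e : Fin n → Cn n} {g k : En n → ℝ} {p : En n} {a b : Cn n → ℝ} {τ σ τ' σ' : ℝ}

theorem HasL.of_jet (e : Fin n → Cn n) {A h : En n → ℝ} (J : HasJet g p A h) :
    HasL e g p (fun v => A (sx v)) (A st) (1 / 4 * ∑ k, (h (sx (e k)) + h (sx (I • e k)))) :=
  ⟨J.cd, fun v => J.h1 _, J.h1 _, by simp only [hf, D2, J.h2]⟩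

theorem HasL.of_cd (e : Fin n → Cn n) (h : ContDiffAt ℝ 2 g p) :
    HasL e g p (fun v => dd (sx v) g p) (dd st g p) (1 / 4 * ∑ k, hf (D2 g p) (e k) (e k)) :=
  ⟨h, fun _ => rfl, rfl, rfl⟩

theorem HasL.congr' (G : HasL e g p a τ σ) (h1 : ∀ v, a v = b v) (h2 : τ = τ') (h3 : σ = σ') :
    HasL e g p b τ' σ' := ⟨G.cd, fun v => (G.ha v).trans (h1 v), G.ht.trans h2, G.hs.trans h3⟩

theorem HasL.sum_eq (G : HasL e g p a τ σ) :
    1 / 4 * ∑ k, (dd (sx (e k)) (dd (sx (e k)) g) p + dd (sx (I • e k)) (dd (sx (I • e k)) g) p) = σ := G.hs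

theorem HasL.add (G : HasL e g p a τ σ) (K : HasL e k p b τ' σ') :
    HasL e (fun q => g q + k q) p (fun v => a v + b v) (τ + τ') (σ + σ') := by
  refine (HasL.of_jet e ((HasJet.of_cd G.cd).add (HasJet.of_cd K.cd))).congr' ?_ ?_ ?_
  · intro v; simp only [G.ha, K.ha]
  · simp only [G.ht, K.ht]
  · rw [← G.sum_eq, ← K.sum_eq, ← mul_add, ← Finset.sum_add_distrib]
    congr 1; refine Finset.sum_congr rfl fun i _ => ?_; ring

theorem HasL.mul (G : HasL e g p a τ σ) (K : HasL e k p b τ' σ') :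
    HasL e (fun q => g q * k q) p (fun v => g p * b v + k p * a v) (g p * τ' + k p * τ)
      (g p * σ' + k p * σ + 1 / 2 * Gam e a b) := by
  refine (HasL.of_jet e ((HasJet.of_cd G.cd).mul (HasJet.of_cd K.cd))).congr' ?_ ?_ ?_
  · intro v; simp only [G.ha, K.ha]
  · simp only [G.ht, K.ht]
  · rw [← G.sum_eq, ← K.sum_eq, Gam]
    simp only [G.ha, K.ha, Finset.mul_sum]
    rw [← Finset.sum_add_distrib, ← Finset.sum_add_distrib]
    refine Finset.sum_congr rfl fun i _ => ?_; ring

theorem HasL.const (e : Fin n → Cn n) (p : En n) (c : ℝ) : HasL e (fun _ => c) p (fun _ => 0) 0 0 :=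
  (HasL.of_jet e (HasJet.const c p)).congr' (fun _ => rfl) rfl (by simp)

theorem HasL.cmul (c : ℝ) (G : HasL e g p a τ σ) :
    HasL e (fun q => c * g q) p (fun v => c * a v) (c * τ) (c * σ) := by
  refine (HasL.of_jet e ((HasJet.of_cd G.cd).const_mul c)).congr' ?_ ?_ ?_
  · intro v; simp only [G.ha]
  · simp only [G.ht]
  · rw [← G.sum_eq]
    simp only [Finset.mul_sum]
    refine Finset.sum_congr rfl fun i _ => ?_; ring

theorem HasL.neg (G : HasL e g p a τ σ) :
    HasL e (fun q => - g q) p (fun v => - a v) (-τ) (-σ) := by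
  have := G.cmul (-1)
  simpa only [neg_one_mul] using this

theorem HasL.sub (G : HasL e g p a τ σ) (K : HasL e k p b τ' σ') :
    HasL e (fun q => g q - k q) p (fun v => a v - b v) (τ - τ') (σ - σ') := by
  have := G.add K.neg
  simpa only [← sub_eq_add_neg] using this

theorem HasL.sq (G : HasL e g p a τ σ) :
    HasL e (fun q => g q ^ 2) p (fun v => 2 * g p * a v) (2 * g p * τ)
      (2 * g p * σ + 1 / 2 * Gam e a a) := by
  have h := (G.mul G).congr' (b := fun v => 2 * g p * a v) (τ' := 2 * g p * τ)
    (σ' := 2 * g p * σ + 1 / 2 * Gam e a a) (fun v => by ring) (by ring) (by ring)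
  simpa only [← pow_two] using h

theorem HasL.exp (G : HasL e g p a τ σ) :
    HasL e (fun q => Real.exp (g q)) p (fun v => Real.exp (g p) * a v) (Real.exp (g p) * τ)
      (Real.exp (g p) * (σ + 1 / 4 * Gam e a a)) := by
  refine (HasL.of_jet e (HasJet.of_cd G.cd).exp).congr' ?_ ?_ ?_
  · intro v; simp only [G.ha]
  · simp only [G.ht]
  · rw [← G.sum_eq, Gam]
    simp only [G.ha, Finset.mul_sum]
    rw [← Finset.sum_add_distrib, Finset.mul_sum]
    refine Finset.sum_congr rfl fun i _ => ?_; ring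

theorem HasL.time (e : Fin n → Cn n) (p : En n) : HasL e (fun q => q.2) p (fun _ => 0) 1 0 := by
  have := HasL.of_jet e (HasJet.clm (ContinuousLinearMap.snd ℝ (Cn n) ℝ) p)
  exact this.congr' (fun v => rfl) rfl (by simp)

theorem HasL.tpow (e : Fin n → Cn n) (p : En n) (s : ℝ) (m : ℕ) : HasL e (fun q => (q.2 - s) ^ m) p (fun _ => 0)
    (m * (p.2 - s) ^ (m - 1)) 0 := by
  induction m with
  | zero => simpa using HasL.const e p 1
  | succ m ih =>
    have := (ih.mul ((HasL.time e p).sub (HasL.const e p s)))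
    simp only [← pow_succ] at this
    refine this.congr' (fun v => by simp) ?_ (by simp [Gam])
    rcases m with _ | m
    · simp
    · simp; ring

theorem Gam_nonneg (e : Fin n → Cn n) (a : Cn n → ℝ) : 0 ≤ Gam e a a :=
  Finset.sum_nonneg fun _ _ => by nlinarith [mul_self_nonneg (a (e ‹_›)), mul_self_nonneg (a (I • e ‹_›))]

theorem norm_I_smul' (v : Cn n) : ‖I • v‖ = ‖v‖ := by rw [norm_smul]; simp

theorem Gam_le {A : ℝ} (ha : ∀ v, |a v| ≤ A * ‖v‖) : Gam e a a ≤ 2 * A ^ 2 * SS e := by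
  rw [Gam, SS, Finset.mul_sum]
  refine Finset.sum_le_sum fun i _ => ?_
  have h1 := ha (e i)
  have h2 := ha (I • e i)
  rw [norm_I_smul'] at h2
  have h3 := sq_le_sq' (by linarith [abs_nonneg (a (e i)), (abs_nonneg (a (e i))).trans h1]) h1
  have h4 := sq_le_sq' (by linarith [abs_nonneg (a (I • e i)), (abs_nonneg (a (I • e i))).trans h2]) h2
  rw [sq_abs] at h3 h4
  nlinarith

theorem hf_bound {K : ℝ} {B : Cn n → Cn n → ℝ} (h : ∀ v w, |B v w| ≤ K * ‖v‖ * ‖w‖) (v : Cn n) :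
    |hf B v v| ≤ 2 * K * ‖v‖ ^ 2 := by
  have h1 := h v v
  have h2 := h (I • v) (I • v)
  rw [norm_I_smul'] at h2
  unfold hf
  have := abs_add_le (B v v) (B (I • v) (I • v))
  nlinarith

theorem HasL.sigma_abs (G : HasL e g p a τ σ) {K : ℝ} (h : ∀ v w, |D2 g p v w| ≤ K * ‖v‖ * ‖w‖) :
    |σ| ≤ K / 2 * SS e := by
  rw [← G.hs, abs_mul]
  have : |∑ k, hf (D2 g p) (e k) (e k)| ≤ ∑ k, 2 * K * ‖e k‖ ^ 2 :=
    (Finset.abs_sum_le_sum_abs _ _).trans (Finset.sum_le_sum fun i _ => hf_bound h _)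
  rw [← Finset.mul_sum] at this
  rw [show |(1/4:ℝ)| = 1/4 by norm_num, SS]
  linarith

theorem HasL.sigma_ge (G : HasL e g p a τ σ) {c : ℝ} (h : ∀ v, 4 * c * ‖v‖ ^ 2 ≤ hf (D2 g p) v v) :
    c * SS e ≤ σ := by
  rw [← G.hs]
  have : ∑ k, 4 * c * ‖e k‖ ^ 2 ≤ ∑ k, hf (D2 g p) (e k) (e k) := Finset.sum_le_sum fun i _ => h _
  rw [← Finset.mul_sum] at this
  rw [SS]
  linarith

theorem HasL.sigma_max (G : HasL e g p a τ σ) (h : ∀ v, D2 g p v v ≤ 0) : σ ≤ 0 := by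
  rw [← G.hs]
  have : ∑ k, hf (D2 g p) (e k) (e k) ≤ 0 := Finset.sum_nonpos fun i _ => by
    unfold hf; linarith [h (e i), h (I • e i)]
  linarith

theorem HasL.lop (G : HasL e g p a τ σ) : Lop e g p = τ - σ := by rw [Lop, G.ht, G.hs]

/-- squared distance -/
def nsq (x : Cn n) (q : En n) : ℝ := ‖q.1 - x‖ ^ 2

theorem norm_sq_coord (v : Cn n) : ‖v‖ ^ 2 = ∑ i, ((v i).re ^ 2 + (v i).im ^ 2) := by
  rw [EuclideanSpace.norm_sq_eq]
  refine Finset.sum_congr rfl fun i _ => ?_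
  rw [Complex.sq_norm, Complex.normSq_apply]; ring

theorem nsq_jet (x : Cn n) (p : En n) : HasJet (nsq x) p (fun w => 2 * (inner ℂ (p.1 - x) w.1).re)
    (fun w => 2 * ‖w.1‖ ^ 2) := by
  let ev : Fin n → En n →L[ℝ] ℂ := fun i =>
    ((EuclideanSpace.proj i : Cn n →L[ℂ] ℂ).restrictScalars ℝ).comp (ContinuousLinearMap.fst ℝ (Cn n) ℝ)
  have hev : ∀ i q, ev i q = q.1 i := fun i q => rfl
  have J : ∀ i ∈ (Finset.univ : Finset (Fin n)), _ := fun i _ =>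
    (((HasJet.clm (Complex.reCLM.comp (ev i)) p).sub (HasJet.const (x i).re p)).sq).add
    (((HasJet.clm (Complex.imCLM.comp (ev i)) p).sub (HasJet.const (x i).im p)).sq)
  have J2 := HasJet.sum Finset.univ J
  have e1 : nsq x = fun q => ∑ i, (((Complex.reCLM.comp (ev i)) q - (x i).re) ^ 2 +
      ((Complex.imCLM.comp (ev i)) q - (x i).im) ^ 2) := by
    funext q
    rw [nsq, norm_sq_coord]
    refine Finset.sum_congr rfl fun i _ => ?_
    simp [hev]
  rw [e1]
  refine J2.congr' (fun w => ?_) (fun w => ?_)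
  · rw [PiLp.inner_apply, Complex.re_sum, Finset.mul_sum]
    refine Finset.sum_congr rfl fun i _ => ?_
    simp [hev]; ring
  · rw [norm_sq_coord, Finset.mul_sum]
    refine Finset.sum_congr rfl fun i _ => ?_
    simp [hev]; ring

theorem HasL.nsq (e : Fin n → Cn n) (x : Cn n) (p : En n) :
    HasL e (nsq x) p (fun v => 2 * (inner ℂ (p.1 - x) v).re) 0 (SS e) := by
  refine (HasL.of_jet e (nsq_jet x p)).congr' (fun v => rfl) (by simp [st]) ?_
  rw [SS, Finset.mul_sum]
  refine Finset.sum_congr rfl fun i _ => ?_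
  simp only [sx, norm_I_smul']; ring

theorem re_inner_le (x v : Cn n) : |(inner ℂ x v).re| ≤ ‖x‖ * ‖v‖ :=
  (Complex.abs_re_le_norm _).trans (norm_inner_le_norm x v)

theorem nsq_smooth (x : Cn n) (Q : Set (En n)) : ContDiffOn ℝ ∞ (_root_.nsq x) Q := by
  have : ContDiff ℝ ∞ (_root_.nsq x) := by
    unfold _root_.nsq
    simp only [norm_sq_coord]
    refine ContDiff.sum fun i _ => ?_
    let ev : En n →L[ℝ] ℂ :=
      ((EuclideanSpace.proj i : Cn n →L[ℂ] ℂ).restrictScalars ℝ).comp (ContinuousLinearMap.fst ℝ (Cn n) ℝ)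
    have h1 : ContDiff ℝ ∞ fun q : En n => (Complex.reCLM.comp ev) q - (x i).re :=
      (Complex.reCLM.comp ev).contDiff.sub contDiff_const
    have h2 : ContDiff ℝ ∞ fun q : En n => (Complex.imCLM.comp ev) q - (x i).im :=
      (Complex.imCLM.comp ev).contDiff.sub contDiff_const
    exact (h1.pow 2).add (h2.pow 2)
  exact this.contDiffOn

end HL

theorem par_max {Ω : Set (Cn n)} (hΩ : IsOpen Ω) (hb : IsBounded Ω) {s t1 : ℝ}
    {g gh : En n → ℝ}
    (hc : ContinuousOn gh (closure Ω ×ˢ Icc s t1))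
    (he : ∀ z ∈ Ω, ∀ t ∈ Icc s t1, gh (z, t) = g (z, t))
    (hbd : ∀ z ∈ frontier Ω, ∀ t ∈ Icc s t1, gh (z, t) ≤ 0)
    (hin : ∀ z ∈ Ω, g (z, s) ≤ 0)
    (hjet : ∀ z ∈ Ω, ∀ t ∈ Ioc s t1, 0 < g (z, t) → ∃ e a τ σ, HasL e g (z, t) a τ σ ∧
      ((∀ v, a v = 0) → 0 ≤ τ → σ ≤ 0 → False)) :
    ∀ z ∈ Ω, ∀ t ∈ Icc s t1, g (z, t) ≤ 0 := by
  refine parabolic_max hΩ hb hc he hbd hin fun z hz t ht hg => ?_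
  obtain ⟨e, a, τ, σ, G, h⟩ := hjet z hz t ht hg
  refine ⟨_, _, HasJet.of_cd G.cd, fun h1 h2 h3 => h (fun v => ?_) ?_ (G.sigma_max fun v => h2 v)⟩
  · rw [← G.ha]; exact h1 v
  · rw [← G.ht]; exact h3

theorem ell_max {Ω : Set (Cn n)} (hΩ : IsOpen Ω) (hb : IsBounded Ω) {t : ℝ}
    {g : En n → ℝ} {gh : Cn n → ℝ}
    (hc : ContinuousOn gh (closure Ω))
    (he : ∀ z ∈ Ω, gh z = g (z, t))
    (hbd : ∀ z ∈ frontier Ω, gh z ≤ 0)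
    (hjet : ∀ z ∈ Ω, 0 < g (z, t) → ∃ e a τ σ, HasL e g (z, t) a τ σ ∧
      ((∀ v, a v = 0) → σ ≤ 0 → False)) :
    ∀ z ∈ Ω, g (z, t) ≤ 0 := by
  have := elliptic_max (B := univ) (t := t) (g := g) (gh := gh) hΩ hb isOpen_univ (by simpa using hc)
    (by simpa using he) (by simpa using hbd) (by simp) (fun z hz hg => by
      obtain ⟨e, a, τ, σ, G, h⟩ := hjet z hz.1 hg
      refine ⟨_, _, HasJet.of_cd G.cd, fun h1 h2 => h (fun v => ?_) (G.sigma_max fun v => h2 v)⟩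
      rw [← G.ha]; exact h1 v)
  exact fun z hz => this z ⟨hz, mem_univ _⟩

/-! ### The package of data, and the zeroth order and time derivative estimates -/

structure Pk (Ω : Set (Cn n)) (ρ : Cn n → ℝ) (O : Set (Cn n)) (δ c C T K : ℝ) (u F φ : En n → ℝ) :
    Prop where
  D : Dom Ω ρ O δ c C
  S : Sol Ω T K u F
  hn : 0 < n
  hT : 0 < T
  hK : 1 ≤ K
  C4 : C4b (Ω ×ˢ Ioo (0:ℝ) T) K φ
  bd : ∀ z ∈ frontier Ω, ∀ t ∈ Ico (0:ℝ) T, u (z, t) = φ (z, t)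
  u0 : ∀ z ∈ Ω, |u (z, 0)| ≤ K
  ru : ∃ g1 g2 gt, Reg Ω T u g1 g2 gt
  rp : ∃ g1 g2 gt, Reg Ω T φ g1 g2 gt

section Est

variable {Ω O : Set (Cn n)} {ρ : Cn n → ℝ} {δ c C T K : ℝ} {u F φ : En n → ℝ}

theorem cl_prod {Ω : Set (Cn n)} {I J : Set ℝ} (hJ : J ⊆ closure I) : closure Ω ×ˢ J ⊆ closure (Ω ×ˢ I) := by
  rw [closure_prod_eq]; exact prod_mono subset_rfl hJ

theorem cl_le {S R : Set (En n)} {g h : En n → ℝ} (hg : ContinuousOn g S) (hh : ContinuousOn h S)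
    (hRS : R ⊆ S) (hSR : S ⊆ closure R) (H : ∀ p ∈ R, g p ≤ h p) : ∀ p ∈ S, g p ≤ h p := fun p hp =>
  ContinuousWithinAt.closure_le (hSR hp) ((hg p hp).mono hRS) ((hh p hp).mono hRS) H

theorem cl_le_Ioo {Ω : Set (Cn n)} {g h : En n → ℝ} (hg : ContinuousOn g (closure Ω ×ˢ Ioo (0:ℝ) T))
    (hh : ContinuousOn h (closure Ω ×ˢ Ioo (0:ℝ) T))
    (H : ∀ p ∈ Ω ×ˢ Ioo (0:ℝ) T, g p ≤ h p) : ∀ p ∈ closure Ω ×ˢ Ioo (0:ℝ) T, g p ≤ h p :=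
  cl_le hg hh (prod_mono subset_closure subset_rfl) (cl_prod subset_closure) H

theorem cl_le_Ico {Ω : Set (Cn n)} {g h : En n → ℝ} (hT : 0 < T) (hg : ContinuousOn g (closure Ω ×ˢ Ico (0:ℝ) T))
    (hh : ContinuousOn h (closure Ω ×ˢ Ico (0:ℝ) T))
    (H : ∀ p ∈ Ω ×ˢ Ioo (0:ℝ) T, g p ≤ h p) : ∀ p ∈ closure Ω ×ˢ Ico (0:ℝ) T, g p ≤ h p :=
  cl_le hg hh (prod_mono subset_closure Ioo_subset_Ico_self) (cl_prod (by
    rw [closure_Ioo hT.ne]; exact Ico_subset_Icc_self)) H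

theorem Pk.hu (P : Pk Ω ρ O δ c C T K u F φ) {p : En n} (hp : p ∈ Ω ×ˢ Ioo (0:ℝ) T) {e : Fin n → Cn n}
    (E : FrameAt (hMat (D2 u p)) e) : HasL e u p (fun v => dd (sx v) u p) (dd st u p) n := by
  refine (HasL.of_cd e (smooth_at2 P.S.op P.S.su hp)).congr' (fun _ => rfl) rfl ?_
  simp only [frame_unit (D2_bil (smooth_at2 P.S.op P.S.su hp)) E]
  simp; ring

theorem Pk.smρ (P : Pk Ω ρ O δ c C T K u F φ) {p : En n} (hp : p ∈ Ω ×ˢ Ioo (0:ℝ) T) :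
    ContDiffAt ℝ 2 (lft ρ) p :=
  smooth_at2 (P.D.opO.prod isOpen_univ) P.D.C4b.o0.sm ⟨P.D.sub hp.1, mem_univ _⟩

theorem Pk.hρ (P : Pk Ω ρ O δ c C T K u F φ) {p : En n} (hp : p ∈ Ω ×ˢ Ioo (0:ℝ) T) (e : Fin n → Cn n) :
    ∃ σ, HasL e (lft ρ) p (fun v => dd (sx v) (lft ρ) p) 0 σ ∧ c * SS e ≤ σ := by
  have h := HasL.of_cd e (P.smρ hp)
  rw [dd_st_lift] at h
  exact ⟨_, h, h.sigma_ge fun v => P.D.psh' (P.D.sub hp.1) v⟩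

theorem Pk.ρ_cont (P : Pk Ω ρ O δ c C T K u F φ) (I : Set ℝ) : ContinuousOn (lft ρ) (closure Ω ×ˢ I) :=
  P.D.C4b.o0.sm.continuousOn.mono (prod_mono P.D.cl_sub (subset_univ _))

theorem Pk.ρ_lb (P : Pk Ω ρ O δ c C T K u F φ) {z : Cn n} (hz : z ∈ O) : |ρ z| ≤ C :=
  P.D.C4b.o0.b0 (z, 0) ⟨hz, mem_univ _⟩

theorem Pk.φ_bd (P : Pk Ω ρ O δ c C T K u F φ) : ∀ p ∈ closure Ω ×ˢ Ico (0:ℝ) T, |φ p| ≤ K := by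
  obtain ⟨g1, g2, gt, R⟩ := P.rp
  exact cl_le_Ico P.hT R.c0.abs continuousOn_const P.C4.o0.b0

theorem Pk.u_cont (P : Pk Ω ρ O δ c C T K u F φ) : ContinuousOn u (closure Ω ×ˢ Ico (0:ℝ) T) := by
  obtain ⟨g1, g2, gt, R⟩ := P.ru
  exact R.c0

theorem Pk.ut (P : Pk Ω ρ O δ c C T K u F φ) : ∃ gt : En n → ℝ,
    ContinuousOn gt (closure Ω ×ˢ Ioo (0:ℝ) T) ∧ (∀ p ∈ Ω ×ˢ Ioo (0:ℝ) T, gt p = dd st u p) ∧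
    ∀ z ∈ frontier Ω, ∀ t ∈ Ioo (0:ℝ) T, |gt (z, t)| ≤ K := by
  obtain ⟨g1, g2, gt, R⟩ := P.ru
  obtain ⟨k1, k2, kt, R'⟩ := P.rp
  refine ⟨gt, R.ct, R.it, fun z hz t ht => ?_⟩
  have hm : (z, t) ∈ closure Ω ×ˢ Ioo (0:ℝ) T := ⟨frontier_subset_closure hz, ht⟩
  have h1 := R.bt _ hm
  have h2 := R'.bt _ hm
  have e : (fun s => u (z, s)) =ᶠ[𝓝 t] fun s => φ (z, s) := by
    filter_upwards [Ioo_mem_nhds ht.1 ht.2] with s hs using P.bd z hz s (Ioo_subset_Ico_self hs)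
  have h3 : gt (z, t) = kt (z, t) := h1.unique (h2.congr_of_eventuallyEq e)
  rw [h3]
  refine cl_le_Ioo R'.ct.abs continuousOn_const (fun p hp => ?_) _ hm
  rw [R'.it p hp]
  exact P.C4.o0.bt p hp

theorem Pk.frame_low (P : Pk Ω ρ O δ c C T K u F φ) {p : En n} (hp : p ∈ Ω ×ˢ Ioo (0:ℝ) T) {e : Fin n → Cn n}
    (E : FrameAt (hMat (D2 u p)) e) {l : ℝ} (hl : 0 < l) :
    n * Real.log l - (dd st u p - F p) ≤ l * SS e - n := by
  have h := frame_logdet_scalar E hl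
  rw [P.S.eq p hp]
  unfold SS
  linarith

theorem est0 (D : Dom Ω ρ O δ c C) (T K : ℝ) : ∃ A : ℝ, 1 ≤ A ∧ ∀ u F φ, Pk Ω ρ O δ c C T K u F φ →
    ∀ z ∈ Ω, ∀ t ∈ Ico (0:ℝ) T, |u (z, t)| ≤ A := by
  set M : ℝ := K + |n * Real.log c| + 1 with hM
  refine ⟨1 + |K| + |C| + |M| * |T|, by linarith [abs_nonneg K, abs_nonneg C, mul_nonneg (abs_nonneg M) (abs_nonneg T)], fun u F φ P z hz t ht => ?_⟩
  have hK := P.hK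
  have hM0 : 0 < M := by positivity
  have up : u (z, t) ≤ K := by
    have h := par_max D.op D.bd (s := 0) (t1 := t) (g := fun p => u p - K) (gh := fun p => u p - K)
      ((P.u_cont.mono (prod_mono subset_rfl (Icc_subset_Ico_right ht.2))).sub continuousOn_const)
      (fun _ _ _ _ => rfl) (fun z hz s hs => ?_) (fun z hz => ?_) (fun z hz s hs _ => ?_) z hz t (right_mem_Icc.2 ht.1)
    · linarith
    · have hs' : s ∈ Ico 0 T := Icc_subset_Ico_right ht.2 hs
      have := P.φ_bd (z, s) ⟨frontier_subset_closure hz, hs'⟩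
      rw [P.bd z hz s hs']; linarith [(abs_le.1 this).2]
    · linarith [(abs_le.1 (P.u0 z hz)).2]
    · have hp : (z, s) ∈ Ω ×ˢ Ioo (0:ℝ) T := ⟨hz, hs.1, hs.2.trans_lt ht.2⟩
      obtain ⟨e, E⟩ := P.S.frame hp
      refine ⟨e, _, _, _, (P.hu hp E).sub (HasL.const e _ K), fun _ _ h => ?_⟩
      have : (0:ℝ) < n := by exact_mod_cast P.hn
      linarith
  have lo : ρ z - K - M * t - u (z, t) ≤ 0 := by
    refine par_max D.op D.bd (s := 0) (t1 := t) (g := fun p => lft ρ p - K - M * p.2 - u p)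
      (gh := fun p => lft ρ p - K - M * p.2 - u p) ?_
      (fun _ _ _ _ => rfl) (fun z hz s hs => ?_) (fun z hz => ?_) (fun z hz s hs _ => ?_) z hz t (right_mem_Icc.2 ht.1)
    · exact (((P.ρ_cont _).sub continuousOn_const).sub (by fun_prop)).sub
        (P.u_cont.mono (prod_mono subset_rfl (Icc_subset_Ico_right ht.2)))
    · have hs' : s ∈ Ico 0 T := Icc_subset_Ico_right ht.2 hs
      have h1 := P.φ_bd (z, s) ⟨frontier_subset_closure hz, hs'⟩
      have h2 : lft ρ (z, s) = 0 := D.fr z hz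
      simp only [P.bd z hz s hs', h2]
      have := mul_nonneg hM0.le hs.1
      linarith [(abs_le.1 h1).1]
    · have h2 : lft ρ (z, 0) < 0 := D.neg hz
      simp only
      linarith [(abs_le.1 (P.u0 z hz)).1]
    · have hp : (z, s) ∈ Ω ×ˢ Ioo (0:ℝ) T := ⟨hz, hs.1, hs.2.trans_lt ht.2⟩
      obtain ⟨e, E⟩ := P.S.frame hp
      obtain ⟨σ, hρ, hσ⟩ := P.hρ hp e
      refine ⟨e, _, _, _, (((hρ.sub (HasL.const e _ K)).sub ((HasL.time e _).cmul M)).sub (P.hu hp E)), fun _ h1 h2 => ?_⟩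
      have h3 := P.frame_low hp E D.hc
      have h4 := (abs_le.1 (P.S.bF _ hp)).1
      have h5 := neg_abs_le (n * Real.log c)
      linarith
  rw [abs_le]
  have h1 : -C ≤ ρ z := (abs_le.1 (P.ρ_lb (D.sub hz))).1
  have h2 : M * t ≤ |M| * |T| := by
    rw [abs_of_pos hM0, abs_of_pos P.hT]; exact mul_le_mul_of_nonneg_left ht.2.le hM0.le
  have h3 := le_abs_self C
  have h4 := le_abs_self K
  have h5 := abs_nonneg C
  have h6 : 0 ≤ |M| * |T| := by positivity
  constructor <;> linarith

theorem Pk.h_dd (P : Pk Ω ρ O δ c C T K u F φ) {p : En n} (hp : p ∈ Ω ×ˢ Ioo (0:ℝ) T) {e : Fin n → Cn n}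
    (E : FrameAt (hMat (D2 u p)) e) (w : En n) : ∃ τ σ, HasL e (dd w u) p (fun v => dd (sx v) (dd w u) p) τ σ ∧
    τ - σ = dd w F p := by
  have h := HasL.of_cd e (smooth_at2 P.S.op (dd_smooth P.S.op P.S.su w) hp)
  exact ⟨_, _, h, by rw [← h.lop, (P.S.lin hp E w).1]⟩

/-- estimates of order zero and of the time derivative -/
structure E2 (Ω : Set (Cn n)) (T s A : ℝ) (u F : En n → ℝ) : Prop where
  b0 : ∀ z ∈ Ω, ∀ t ∈ Ico s T, |u (z, t)| ≤ A
  bt : ∀ z ∈ Ω, ∀ t ∈ Ico s T, |dd st u (z, t)| ≤ A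
  ld : ∀ z ∈ Ω, ∀ t ∈ Ico s T, |dd st u (z, t) - F (z, t)| ≤ A
  lS : ∀ z ∈ Ω, ∀ t ∈ Ico s T, ∀ e, FrameAt (hMat (D2 u (z, t))) e → 1 ≤ A * SS e

theorem est_t (D : Dom Ω ρ O δ c C) (T K : ℝ) {s : ℝ} (hs : 0 < s) : ∃ A : ℝ, 1 ≤ A ∧
    ∀ u F φ, Pk Ω ρ O δ c C T K u F φ → ∀ z ∈ Ω, ∀ t ∈ Ico s T, (t - s) * |dd st u (z, t)| ≤ A := by
  obtain ⟨A, hA1, hA⟩ := est0 D T K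
  set N : ℝ := |T| * |K| + |K| + n + 1 with hN
  refine ⟨A + N * |T| + (|T| * |K| + A + |K|) + C / c , ?_, fun u F φ P z hz t ht => ?_⟩
  · have := D.hc
    have := D.hC
    have : 0 ≤ C / c := by positivity
    have : 0 ≤ N * |T| := by positivity
    have : 0 ≤ |T| * |K| := by positivity
    linarith [abs_nonneg K]
  have hK := P.hK
  have hK0 : 0 < K := by linarith
  have hT := P.hT
  have hc := D.hc
  rw [abs_of_pos hT, abs_of_pos hK0] at hN
  have hTK : 0 ≤ T * K := by positivity
  have hN0 : 0 < N := by rw [hN]; positivity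
  obtain ⟨gt, hgc, hgi, hgb⟩ := P.ut
  have hI : Icc s t ⊆ Ioo 0 T := fun r hr => ⟨hs.trans_le hr.1, hr.2.trans_lt ht.2⟩
  have hts : ∀ r ∈ Icc s t, 0 ≤ r - s ∧ r - s ≤ T := fun r hr => ⟨by linarith [hr.1], by linarith [hr.2, ht.2]⟩
  have up : (t - s) * dd st u (z, t) - u (z, t) - N * t - (T * K + A + K) ≤ 0 := by
    refine par_max D.op D.bd (s := s) (t1 := t) (g := fun p => (p.2 - s) * dd st u p - u p - N * p.2 - (T * K + A + K))
      (gh := fun p => (p.2 - s) * gt p - u p - N * p.2 - (T * K + A + K)) ?_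
      (fun y hy r hr => ?_) (fun y hy r hr => ?_) (fun y hy => ?_) (fun y hy r hr hg => ?_) z hz t (right_mem_Icc.2 ht.1)
    · have h1 : ContinuousOn (fun p : En n => p.2 - s) (closure Ω ×ˢ Icc s t) := by fun_prop
      have h2 : ContinuousOn (fun p : En n => N * p.2) (closure Ω ×ˢ Icc s t) := by fun_prop
      exact (((h1.mul (hgc.mono (prod_mono subset_rfl hI))).sub
        (P.u_cont.mono (prod_mono subset_rfl (hI.trans Ioo_subset_Ico_self)))).sub h2).sub continuousOn_const
    · simp only [hgi (y, r) ⟨hy, hI hr⟩]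
    · have h1 := hgb y hy r (hI hr)
      have h2 := P.φ_bd (y, r) ⟨frontier_subset_closure hy, Ioo_subset_Ico_self (hI hr)⟩
      rw [← P.bd y hy r (Ioo_subset_Ico_self (hI hr))] at h2
      have h3 : (r - s) * gt (y, r) ≤ T * K := by
        have := mul_le_mul (hts r hr).2 h1 (abs_nonneg _) hT.le
        have h4 := mul_le_mul_of_nonneg_left (le_abs_self (gt (y, r))) (hts r hr).1
        linarith
      have h4 : 0 ≤ N * r := mul_nonneg hN0.le (hI hr).1.le
      simp only
      linarith [(abs_le.1 h2).1]
    · have h1 := hA u F φ P y hy s ⟨hs.le, ht.1.trans_lt ht.2⟩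
      have h4 : 0 ≤ N * s := mul_nonneg hN0.le hs.le
      simp only [sub_self, zero_mul]
      linarith [(abs_le.1 h1).1]
    · have hr' := Ioc_subset_Icc_self hr
      have hp : (y, r) ∈ Ω ×ˢ Ioo (0:ℝ) T := ⟨hy, hI hr'⟩
      obtain ⟨e, E⟩ := P.S.frame hp
      obtain ⟨τ, σ, hL, hF⟩ := P.h_dd hp E st
      refine ⟨e, _, _, _, ((((HasL.tpow e (y, r) s 1).mul hL).sub (P.hu hp E)).sub
        ((HasL.time e _).cmul N)).sub (HasL.const e _ (T * K + A + K)) |>.congr' (fun v => rfl) rfl rfl |> fun h => by simpa using h, fun _ h1 h2 => ?_⟩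
      have h0 := hA u F φ P y hy r (Ioo_subset_Ico_self (hI hr'))
      have h4 : 0 ≤ N * r := mul_nonneg hN0.le (hI hr').1.le
      have hpos : 0 < dd st u (y, r) := by
        by_contra hneg
        push Not at hneg
        have := mul_nonpos_of_nonneg_of_nonpos (hts r hr').1 hneg
        simp only at hg
        linarith [(abs_le.1 h0).1]
      obtain ⟨f0, hf1, hf2, -, hf3, -⟩ := P.S.dF _ hp
      have h5 : dd st F (y, r) ≤ K := by
        have := mul_nonpos_of_nonpos_of_nonneg hf2 hpos.le
        linarith [(abs_le.1 hf3).2]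
      have h6 : (r - s) * dd st F (y, r) ≤ T * K := by
        have h7 := mul_le_mul_of_nonneg_left h5 (hts r hr').1
        have h8 := mul_le_mul_of_nonneg_right (hts r hr').2 hK0.le
        linarith
      rw [← hF] at h6
      simp [Gam] at h1 h2
      nlinarith
  have lo : (s - t) * dd st u (z, t) + 1 / c * ρ z - N * t - T * K ≤ 0 := by
    refine par_max D.op D.bd (s := s) (t1 := t) (g := fun p => (s - p.2) * dd st u p + 1 / c * lft ρ p - N * p.2 - T * K)
      (gh := fun p => (s - p.2) * gt p + 1 / c * lft ρ p - N * p.2 - T * K) ?_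
      (fun y hy r hr => ?_) (fun y hy r hr => ?_) (fun y hy => ?_) (fun y hy r hr hg => ?_) z hz t (right_mem_Icc.2 ht.1)
    · have h1 : ContinuousOn (fun p : En n => s - p.2) (closure Ω ×ˢ Icc s t) := by fun_prop
      have h2 : ContinuousOn (fun p : En n => N * p.2) (closure Ω ×ˢ Icc s t) := by fun_prop
      exact (((h1.mul (hgc.mono (prod_mono subset_rfl hI))).add
        (continuousOn_const.mul (P.ρ_cont _))).sub h2).sub continuousOn_const
    · simp only [hgi (y, r) ⟨hy, hI hr⟩]
    · have h1 := hgb y hy r (hI hr)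
      have h3 : (s - r) * gt (y, r) ≤ T * K := by
        have := mul_le_mul (hts r hr).2 h1 (abs_nonneg _) hT.le
        have h4 := mul_le_mul_of_nonneg_left (neg_abs_le (gt (y, r))) (hts r hr).1
        linarith
      have h4 : 0 ≤ N * r := mul_nonneg hN0.le (hI hr).1.le
      have h2 : lft ρ (y, r) = 0 := D.fr y hy
      simp only [h2]
      linarith
    · have h4 : 0 ≤ N * s := mul_nonneg hN0.le hs.le
      have h2 : lft ρ (y, s) ≤ 0 := (D.neg hy).le
      have h3 : 1 / c * lft ρ (y, s) ≤ 0 := mul_nonpos_of_nonneg_of_nonpos (by positivity) h2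
      simp only [sub_self, zero_mul]
      linarith
    · have hr' := Ioc_subset_Icc_self hr
      have hp : (y, r) ∈ Ω ×ˢ Ioo (0:ℝ) T := ⟨hy, hI hr'⟩
      obtain ⟨e, E⟩ := P.S.frame hp
      obtain ⟨τ, σ, hL, hF⟩ := P.h_dd hp E st
      obtain ⟨σρ, hρ, hσ⟩ := P.hρ hp e
      refine ⟨e, _, _, _, (((((HasL.const e (y, r) s).sub (HasL.time e (y, r))).mul hL).add (hρ.cmul (1 / c))).sub
        ((HasL.time e _).cmul N)).sub (HasL.const e _ (T * K)), fun _ h1 h2 => ?_⟩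
      have h4 : 0 ≤ N * r := mul_nonneg hN0.le (hI hr').1.le
      have h2' : lft ρ (y, r) ≤ 0 := (D.neg hy).le
      have h3 : 1 / c * lft ρ (y, r) ≤ 0 := mul_nonpos_of_nonneg_of_nonpos (by positivity) h2'
      have hneg : dd st u (y, r) < 0 := by
        by_contra hpos
        push Not at hpos
        have := mul_nonneg (hts r hr').1 hpos
        simp only at hg
        linarith
      obtain ⟨f0, hf1, hf2, -, hf3, -⟩ := P.S.dF _ hp
      have h5 : -K ≤ dd st F (y, r) := by
        have := mul_nonneg_of_nonpos_of_nonpos hf2 hneg.le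
        linarith [(abs_le.1 hf3).1]
      have h6 : (s - r) * dd st F (y, r) ≤ T * K := by
        have h7 := mul_le_mul_of_nonneg_left h5 (hts r hr').1
        have h8 := mul_le_mul_of_nonneg_right (hts r hr').2 hK0.le
        linarith
      have h9 : SS e ≤ 1 / c * σρ := by
        rw [one_div, inv_mul_eq_div, le_div_iff₀ hc]; linarith
      have h10 := P.frame_low hp E one_pos
      have h11 := (abs_le.1 (P.S.bF _ hp)).1
      rw [← hF] at h6
      simp [Gam] at h1 h2 h10 h9
      nlinarith
  have h1 : -C ≤ ρ z := (abs_le.1 (P.ρ_lb (D.sub hz))).1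
  have h2 : - (C / c) ≤ 1 / c * ρ z := by
    rw [one_div, inv_mul_eq_div, ← neg_div]; exact div_le_div_of_nonneg_right h1 hc.le
  have h3 : N * t ≤ N * T := mul_le_mul_of_nonneg_left ht.2.le hN0.le
  have h4 := (abs_le.1 (hA u F φ P z hz t ⟨hs.le.trans ht.1, ht.2⟩))
  have h5 : (t - s) * |dd st u (z, t)| = |(t - s) * dd st u (z, t)| := by
    rw [abs_mul, abs_of_nonneg (by linarith [ht.1] : 0 ≤ t - s)]
  have h6 : 0 ≤ C / c := by have := D.hC; positivity
  rw [h5, abs_le, abs_of_pos hT, abs_of_pos hK0]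
  constructor <;> linarith

theorem est2 (D : Dom Ω ρ O δ c C) (T K : ℝ) {s : ℝ} (hs : 0 < s) : ∃ A : ℝ, 1 ≤ A ∧
    ∀ u F φ, Pk Ω ρ O δ c C T K u F φ → E2 Ω T s A u F := by
  obtain ⟨A0, hA01, hA0⟩ := est0 D T K
  obtain ⟨A1, hA11, hA1⟩ := est_t D T K (half_pos hs)
  set A2 := 2 * A1 / s + |K| with hA2
  have hA2p : 0 ≤ A2 := by positivity
  have hA2' : 2 * A1 / s ≤ A2 := by linarith [abs_nonneg K]
  have hx : 0 ≤ 2 * A1 / s := by positivity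
  refine ⟨A0 + A2 + Real.exp A2, by linarith [Real.exp_pos A2], fun u F φ P => ?_⟩
  have bt : ∀ z ∈ Ω, ∀ t ∈ Ico s T, |dd st u (z, t)| ≤ 2 * A1 / s := by
    intro z hz t ht
    have h := hA1 u F φ P z hz t ⟨by linarith [ht.1], ht.2⟩
    rw [le_div_iff₀ hs]
    have : s / 2 ≤ t - s / 2 := by linarith [ht.1]
    have := mul_le_mul_of_nonneg_right this (abs_nonneg (dd st u (z, t)))
    linarith
  have ld : ∀ z ∈ Ω, ∀ t ∈ Ico s T, |dd st u (z, t) - F (z, t)| ≤ A2 := by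
    intro z hz t ht
    have h1 := bt z hz t ht
    have h2 := P.S.bF (z, t) ⟨hz, hs.trans_le ht.1, ht.2⟩
    have h3 := abs_sub (dd st u (z, t)) (F (z, t))
    linarith [le_abs_self K]
  have he := Real.exp_pos A2
  refine ⟨fun z hz t ht => ?_, fun z hz t ht => ?_, fun z hz t ht => ?_, fun z hz t ht e E => ?_⟩
  · linarith [hA0 u F φ P z hz t ⟨hs.le.trans ht.1, ht.2⟩]
  · linarith [bt z hz t ht]
  · linarith [ld z hz t ht]
  · have h := P.frame_low ⟨hz, hs.trans_le ht.1, ht.2⟩ E he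
    rw [Real.log_exp] at h
    have h1 : (1:ℝ) ≤ n := by exact_mod_cast P.hn
    have h2 := (abs_le.1 (ld z hz t ht)).2
    have h3 : A2 ≤ n * A2 := by nlinarith
    have h4 : 0 ≤ (A0 + A2) * SS e := mul_nonneg (by linarith) (SS_nonneg e)
    nlinarith

end Est

/-! ### Barriers at the boundary and the smoothing lemma -/

section Est2

variable {Ω O : Set (Cn n)} {ρ : Cn n → ℝ} {δ c C T K : ℝ} {u F φ : En n → ℝ}

theorem est3 (D : Dom Ω ρ O δ c C) (T K : ℝ) {s : ℝ} (hs : 0 < s) (A0 : ℝ) : ∃ A : ℝ, 1 ≤ A ∧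
    ∀ u F φ, Pk Ω ρ O δ c C T K u F φ → E2 Ω T s A0 u F →
    ∀ z ∈ Ω, ∀ t ∈ Ico s T, |u (z, t) - φ (z, t)| ≤ A * (- ρ z) := by
  set l := Real.exp (|A0| + 1) with hl
  have hlp : 0 < l := Real.exp_pos _
  have hc := D.hc
  set A := 1 + (l + |K| / 2) / c with hA
  have hAc : l + |K| / 2 ≤ A * c := by
    have : (l + |K| / 2) / c * c = l + |K| / 2 := by field_simp
    rw [hA]; nlinarith
  refine ⟨A, by rw [hA]; have : 0 ≤ (l + |K| / 2) / c := by positivity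
                linarith, fun u F φ P EE z hz t ht => ?_⟩
  have hK := P.hK
  rw [abs_of_pos (by linarith : 0 < K)] at hAc
  have htI : t ∈ Ioo 0 T := ⟨hs.trans_le ht.1, ht.2⟩
  obtain ⟨k1, k2, kt, R'⟩ := P.rp
  have sl : ∀ {g : En n → ℝ}, ContinuousOn g (closure Ω ×ˢ Ico (0:ℝ) T) → ContinuousOn (fun z => g (z, t)) (closure Ω) :=
    fun hg => hg.comp (by fun_prop) (fun z hz => ⟨hz, Ioo_subset_Ico_self htI⟩)
  have hn1 : (1:ℝ) ≤ n := by exact_mod_cast P.hn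
  have up : u (z, t) - φ (z, t) + A * ρ z ≤ 0 := by
    refine ell_max D.op D.bd (t := t) (g := fun p => u p - φ p + A * lft ρ p)
      (gh := fun z => u (z, t) - φ (z, t) + A * lft ρ (z, t)) ?_ (fun _ _ => rfl) (fun y hy => ?_) (fun y hy hg => ?_) z hz
    · exact ((sl P.u_cont).sub (sl R'.c0)).add (continuousOn_const.mul (sl (P.ρ_cont _)))
    · have h2 : lft ρ (y, t) = 0 := D.fr y hy
      rw [h2, P.bd y hy t (Ioo_subset_Ico_self htI)]; simp
    · have hp : (y, t) ∈ Ω ×ˢ Ioo (0:ℝ) T := ⟨hy, htI⟩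
      obtain ⟨e, E⟩ := P.S.frame hp
      obtain ⟨σρ, hρ, hσ⟩ := P.hρ hp e
      have hφ := HasL.of_cd e (smooth_at2 P.S.op P.C4.o0.sm hp)
      refine ⟨e, _, _, _, ((P.hu hp E).sub hφ).add (hρ.cmul A), fun _ h2 => ?_⟩
      have h3 := (abs_le.1 (hφ.sigma_abs (P.C4.o0.b2 _ hp))).2
      have hS := SS_nonneg e
      have hA0 : 0 ≤ A := by rw [hA]; positivity
      have h4 := mul_le_mul_of_nonneg_left hσ hA0
      have h5 := mul_le_mul_of_nonneg_right hAc hS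
      have h6 := mul_nonneg hlp.le hS
      nlinarith
  have lo : φ (z, t) + A * ρ z - u (z, t) ≤ 0 := by
    refine ell_max D.op D.bd (t := t) (g := fun p => φ p + A * lft ρ p - u p)
      (gh := fun z => φ (z, t) + A * lft ρ (z, t) - u (z, t)) ?_ (fun _ _ => rfl) (fun y hy => ?_) (fun y hy hg => ?_) z hz
    · exact ((sl R'.c0).add (continuousOn_const.mul (sl (P.ρ_cont _)))).sub (sl P.u_cont)
    · have h2 : lft ρ (y, t) = 0 := D.fr y hy
      rw [h2, P.bd y hy t (Ioo_subset_Ico_self htI)]; simp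
    · have hp : (y, t) ∈ Ω ×ˢ Ioo (0:ℝ) T := ⟨hy, htI⟩
      obtain ⟨e, E⟩ := P.S.frame hp
      obtain ⟨σρ, hρ, hσ⟩ := P.hρ hp e
      have hφ := HasL.of_cd e (smooth_at2 P.S.op P.C4.o0.sm hp)
      refine ⟨e, _, _, _, (hφ.add (hρ.cmul A)).sub (P.hu hp E), fun _ h2 => ?_⟩
      have h3 := (abs_le.1 (hφ.sigma_abs (P.C4.o0.b2 _ hp))).1
      have hS := SS_nonneg e
      have hA0 : 0 ≤ A := by rw [hA]; positivity
      have h4 := mul_le_mul_of_nonneg_left hσ hA0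
      have h5 := mul_le_mul_of_nonneg_right hAc hS
      have h6 : l * SS e ≤ n := by nlinarith
      have h7 := P.frame_low hp E hlp
      rw [hl, Real.log_exp] at h7
      rw [hl] at h6
      have h8 := (abs_le.1 (EE.ld y hy t ht)).2
      have h9 : |A0| + 1 ≤ n * (|A0| + 1) := by nlinarith [abs_nonneg A0]
      linarith [le_abs_self A0]
  rw [abs_le]
  constructor <;> linarith

theorem Dom.inward_deriv (D : Dom Ω ρ O δ c C) {p x : Cn n} (hp : p ∈ frontier Ω) (hx : dd x ρ p < 0)
    {G : Cn n → ℝ} {G' : Cn n →L[ℝ] ℝ} (hG : HasFDerivWithinAt G G' (closure Ω) p)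
    (h0 : ∀ z ∈ Ω, G z ≤ G p) : G' x ≤ 0 := by
  obtain ⟨r0, hr0, hin⟩ := D.inward hp hx
  have hin' : ∀ r ∈ Ioc 0 r0, p + r • x ∈ Ω := hin p (mem_ball_self hr0) (D.fr p hp).le
  have h1 : HasDerivWithinAt (fun s : ℝ => p + s • x) x (Icc 0 r0) 0 := by
    have : HasDerivAt (fun s : ℝ => p + s • x) x 0 := by
      simpa using ((hasDerivAt_id (0:ℝ)).smul_const x).const_add p
    exact this.hasDerivWithinAt
  have hm : MapsTo (fun s : ℝ => p + s • x) (Icc 0 r0) (closure Ω) := by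
    intro r hr
    rcases eq_or_lt_of_le hr.1 with h | h
    · rw [← h]; simpa using frontier_subset_closure hp
    · exact subset_closure (hin' r ⟨h, hr.2⟩)
  have hG0 : HasFDerivWithinAt G G' (closure Ω) (p + (0:ℝ) • x) := by simpa using hG
  have h2 := hG0.comp_hasDerivWithinAt (0:ℝ) h1 hm
  have h3 := h2.mono_of_mem_nhdsWithin (s := Ioi (0:ℝ)) (Icc_mem_nhdsGT hr0)
  rw [hasDerivWithinAt_iff_tendsto_slope' (by simp)] at h3
  refine le_of_tendsto h3 ?_
  filter_upwards [Ioc_mem_nhdsGT hr0] with r hr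
  have h4 := h0 _ (hin' r hr)
  rw [slope_def_field]
  refine div_nonpos_of_nonpos_of_nonneg ?_ (by linarith [hr.1])
  simpa using h4

theorem Dom.hasF (D : Dom Ω ρ O δ c C) {p : Cn n} (hp : p ∈ closure Ω) :
    HasFDerivWithinAt ρ (fderiv ℝ ρ p) (closure Ω) p :=
  (D.diff (D.cl_sub hp)).hasFDerivAt.hasFDerivWithinAt

theorem Dom.tan_prop (D : Dom Ω ρ O δ c C) {p : Cn n} (hp : p ∈ frontier Ω) {ν : Cn n} {γ : ℝ} (hν : ‖ν‖ = 1)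
    (hγ : c ≤ γ) (hg : ∀ x, dd x ρ p = γ * (inner ℂ ν x).re) {L : Cn n →L[ℝ] ℝ}
    (hL : ∀ τ, dd τ ρ p = 0 → L τ = 0) (v : Cn n) : L v = L ν / γ * dd v ρ p := by
  have hγ0 : 0 < γ := D.hc.trans_le hγ
  have hnn : dd ν ρ p = γ := by rw [hg, inner_self_eq_norm_sq_to_K, hν]; simp
  have h := hL (v - (dd v ρ p / γ) • ν) (by
    have : dd (v - (dd v ρ p / γ) • ν) ρ p = dd v ρ p - dd v ρ p / γ * dd ν ρ p := by
      simp [dd]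
    rw [this, hnn]; field_simp; ring)
  rw [map_sub, map_smul, smul_eq_mul, sub_eq_zero] at h
  rw [h]; ring

/-- The boundary gradient: `D(u-φ) = b Dρ` with `b` bounded. -/
theorem Pk.bgrad (P : Pk Ω ρ O δ c C T K u F φ) {s : ℝ} (hs : 0 < s) {A : ℝ}
    (hA : ∀ z ∈ Ω, ∀ t ∈ Ico s T, |u (z, t) - φ (z, t)| ≤ A * (- ρ z)) {w1 : Cn n → En n → ℝ}
    {w2 : Cn n → Cn n → En n → ℝ} {wt : En n → ℝ} (R : Reg Ω T (fun p => u p - φ p) w1 w2 wt)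
    {p : Cn n} (hp : p ∈ frontier Ω) {t : ℝ} (ht : t ∈ Ico s T) :
    ∃ b, |b| ≤ A ∧ ∀ v, w1 v (p, t) = b * dd v ρ p := by
  have htI : t ∈ Ioo 0 T := ⟨hs.trans_le ht.1, ht.2⟩
  have hpc := frontier_subset_closure hp
  obtain ⟨L, hL1, hL2⟩ := R.f1 (p, t) ⟨hpc, htI⟩
  simp only at hL2
  obtain ⟨ν, γ, hν, hγ, hγC, hg⟩ := P.D.grad p hp
  have hγ0 : 0 < γ := P.D.hc.trans_le hγ
  have hnn : dd ν ρ p = γ := by rw [hg, inner_self_eq_norm_sq_to_K, hν]; simp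
  have hw0 : u (p, t) - φ (p, t) = 0 := by rw [P.bd p hp t (Ioo_subset_Ico_self htI)]; simp
  have hρ0 := P.D.fr p hp
  have htan := P.D.tan_prop hp hν hγ hg (L := L) (fun τ hτ => P.D.tangential hp hτ hL2 fun z hz => by
    simp [P.bd z hz t (Ioo_subset_Ico_self htI)])
  refine ⟨L ν / γ, ?_, fun v => by rw [← hL1]; exact htan v⟩
  have hneg : dd (-ν) ρ p < 0 := by
    have : dd (-ν) ρ p = - dd ν ρ p := by simp [dd]
    rw [this, hnn]; linarith
  have f1 := P.D.inward_deriv hp hneg (hL2.add ((P.D.hasF hpc).const_smul A)) (fun z hz => by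
    have := (abs_le.1 (hA z hz t ht)).2
    simp only [Pi.add_apply, Pi.smul_apply, smul_eq_mul, hw0, hρ0]; linarith)
  have f2 := P.D.inward_deriv hp hneg (hL2.neg.add ((P.D.hasF hpc).const_smul A)) (fun z hz => by
    have := (abs_le.1 (hA z hz t ht)).1
    simp only [Pi.add_apply, Pi.smul_apply, Pi.neg_apply, smul_eq_mul, hw0, hρ0]; linarith)
  have e : fderiv ℝ ρ p ν = γ := hnn
  simp [e] at f1 f2
  rw [abs_le, le_div_iff₀ hγ0, div_le_iff₀ hγ0]
  constructor <;> linarith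

theorem Gam_comb_le (e : Fin n → Cn n) (θ U : ℝ) (d m : Cn n → ℝ) :
    Gam e (fun w => θ * (2 * U * d w + m w)) (fun w => θ * (2 * U * d w + m w))
      ≤ θ ^ 2 * (8 * U ^ 2 * Gam e d d + 2 * Gam e m m) := by
  simp only [Gam, Finset.mul_sum]
  rw [← Finset.sum_add_distrib, Finset.mul_sum]
  refine Finset.sum_le_sum fun i _ => ?_
  generalize d (e i) = d1
  generalize d (I • e i) = d2
  generalize m (e i) = m1
  generalize m (I • e i) = m2
  nlinarith [mul_nonneg (sq_nonneg θ) (sq_nonneg (2 * U * d1 - m1)), mul_nonneg (sq_nonneg θ) (sq_nonneg (2 * U * d2 - m2))]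

theorem smoothing_pt (e : Fin n → Cn n) (hn : 0 < n) {θ A C C0 C1 N T x E V U ut τv σv : ℝ} {d m b a M' : Cn n → ℝ}
    (hA : 1 ≤ A) (hC0 : 0 ≤ C0) (hθ0 : 0 < θ) (hθ1 : θ * (16 * (A ^ 2 + C ^ 2)) = 1) (hθle : θ ≤ 1)
    (hC1 : C1 = C0 + 2 * A * (A + n)) (hN : N = 4 * (n + T * C1) / θ) (hx0 : 0 < x) (hxT : x ≤ T)
    (hE : 0 < E) (hV : 0 < V) (hub : |U| ≤ A) (hutb : |ut| ≤ A)
    (ha : a = fun w => θ * (2 * U * d w + m w))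
    (hGm : Gam e m m ≤ 8 * C ^ 2 * SS e)
    (hcrit : ∀ w, x ^ n * (E * b w + V * (E * a w)) + E * V * 0 - 0 = 0)
    (hτ : 0 ≤ x ^ n * (E * τv + V * (E * (θ * (2 * U * ut + 0)))) + E * V * (n * x ^ (n - 1)) - 0)
    (hσ : x ^ n * (E * σv + V * (E * (θ * (2 * U * n + 1 / 2 * Gam e d d + SS e) + 1 / 4 * Gam e a a))
      + 1 / 2 * Gam e (fun w => E * a w) b) + E * V * 0 + 1 / 2 * Gam e (fun _ => 0) M' - 0 ≤ 0)
    (hLv : τv - σv ≤ C0 * V) (hvX : V ≤ C0 * (Gam e d d + SS e) ^ n) : x ^ n * V ≤ C0 * N ^ n := by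
  have hxp : 0 < x ^ n := by positivity
  have hT : 0 < T := hx0.trans_le hxT
  have hC10 : 0 ≤ C1 := by rw [hC1]; positivity
  have hcr : ∀ w, b w = - V * a w := by
    intro w
    have h := hcrit w
    have h2 : x ^ n * (E * (b w + V * a w)) = 0 := by linarith
    rcases mul_eq_zero.1 h2 with h | h
    · exact absurd h hxp.ne'
    rcases mul_eq_zero.1 h with h | h
    · exact absurd h hE.ne'
    · linarith
  have hG1 : Gam e (fun w => E * a w) b = - (E * V) * Gam e a a := by
    simp only [Gam, hcr, Finset.mul_sum]
    refine Finset.sum_congr rfl fun i _ => ?_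
    ring
  have hGz : Gam e (fun _ => 0) M' = 0 := by simp [Gam]
  have hgd := Gam_nonneg e d
  have hS := SS_nonneg e
  have hGa : Gam e a a ≤ θ ^ 2 * (8 * A ^ 2 * Gam e d d + 16 * C ^ 2 * SS e) := by
    have hu2 : U ^ 2 ≤ A ^ 2 := sq_le_sq' (abs_le.1 hub).1 (abs_le.1 hub).2
    have h5 := Gam_comb_le e θ U d m
    rw [← ha] at h5
    refine h5.trans (mul_le_mul_of_nonneg_left ?_ (sq_nonneg θ))
    have := mul_le_mul_of_nonneg_right hu2 hgd
    linarith
  rw [hG1, hGz] at hσ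
  generalize Gam e a a = G2 at *
  generalize Gam e d d = G at *
  generalize SS e = S at *
  set X := G + S with hX
  have hGa2 : 1 / 4 * G2 ≤ θ / 4 * X := by
    have h1 : θ * (2 * A ^ 2) ≤ 1 / 4 := by nlinarith [sq_nonneg C, mul_nonneg hθ0.le (sq_nonneg C)]
    have h2 : θ * (4 * C ^ 2) ≤ 1 / 4 := by nlinarith [sq_nonneg A, mul_nonneg hθ0.le (sq_nonneg A)]
    have h4 : 1 / 4 * G2 ≤ θ * (θ * (2 * A ^ 2) * G + θ * (4 * C ^ 2) * S) := by
      refine (mul_le_mul_of_nonneg_left hGa (by norm_num : (0:ℝ) ≤ 1/4)).trans (le_of_eq ?_)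
      ring
    have h5 := mul_le_mul_of_nonneg_right h1 hgd
    have h6 := mul_le_mul_of_nonneg_right h2 hS
    have h7 : θ * (θ * (2 * A ^ 2) * G + θ * (4 * C ^ 2) * S) ≤ θ * (1 / 4 * G + 1 / 4 * S) :=
      mul_le_mul_of_nonneg_left (by linarith) hθ0.le
    rw [hX]; linarith
  have hLu : 2 * U * (ut - n) ≤ 2 * A * (A + n) := by
    have h1 : |2 * U * (ut - n)| ≤ 2 * A * (A + n) := by
      rw [abs_mul, abs_mul, abs_of_pos (by norm_num : (0:ℝ) < 2)]
      have h2 : |ut - n| ≤ A + n := by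
        have := abs_sub ut (n:ℝ)
        rw [abs_of_nonneg (by positivity : (0:ℝ) ≤ n)] at this
        linarith
      have := mul_le_mul hub h2 (abs_nonneg _) (by linarith)
      linarith
    exact (le_abs_self _).trans h1
  have hn1 : x ^ n = x ^ (n - 1) * x := by
    rw [← pow_succ]; congr 1; omega
  have hxq : 0 < x ^ (n - 1) := by positivity
  have main : 0 ≤ x ^ (n - 1) * E * (n * V + x * ((τv - σv) + V *
      (θ * (2 * U * (ut - n) - 1 / 2 * G - S)) + V * (1 / 4 * G2))) := by
    rw [hn1] at hτ hσ
    have := sub_nonneg.2 (hσ.trans hτ)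
    refine this.trans (le_of_eq ?_)
    ring
  have main2 : 0 ≤ n * V + x * ((τv - σv) + V *
      (θ * (2 * U * (ut - n) - 1 / 2 * G - S)) + V * (1 / 4 * G2)) := by
    by_contra hneg
    push Not at hneg
    have := mul_neg_of_pos_of_neg (mul_pos hxq hE) hneg
    linarith
  have main3 : 0 ≤ n + x * (C1 - θ / 4 * X) := by
    have h5 : θ * (2 * U * (ut - n) - 1 / 2 * G - S) + 1 / 4 * G2 ≤ 2 * A * (A + n) - θ / 4 * X := by
      have h6 := mul_le_mul_of_nonneg_left hLu hθ0.le
      have h7 : 0 ≤ 2 * A * (A + n) := by positivity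
      have h8 := mul_le_mul_of_nonneg_right hθle h7
      have h9 := mul_nonneg hθ0.le hS
      rw [hX] at hGa2 ⊢
      linarith
    have h6 : (τv - σv) + V * (θ * (2 * U * (ut - n) - 1 / 2 * G - S)) + V * (1 / 4 * G2) ≤ V * (C1 - θ / 4 * X) := by
      have := mul_le_mul_of_nonneg_left h5 hV.le
      rw [hC1]; linarith
    have h7 := mul_le_mul_of_nonneg_left h6 hx0.le
    have h8 : 0 ≤ V * (n + x * (C1 - θ / 4 * X)) := by linarith
    by_contra hneg
    push Not at hneg
    have := mul_neg_of_pos_of_neg hV hneg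
    linarith
  have hxX : x * X ≤ N := by
    rw [hN, le_div_iff₀ hθ0]
    have := mul_le_mul_of_nonneg_right hxT hC10
    linarith
  have hX0 : 0 ≤ X := by rw [hX]; linarith
  have h6 := mul_le_mul_of_nonneg_left hvX hxp.le
  have h7 : (x * X) ^ n ≤ N ^ n := pow_le_pow_left₀ (by positivity) hxX n
  rw [mul_pow] at h7
  have h8 := mul_le_mul_of_nonneg_left h7 hC0
  linarith

set_option maxHeartbeats 1000000 in
theorem smoothing (D : Dom Ω ρ O δ c C) (T K : ℝ) {s : ℝ} (hs : 0 < s) {A B0 C0 : ℝ} (hA : 1 ≤ A) (hB : 0 ≤ B0)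
    (hC0 : 0 ≤ C0) : ∃ M : ℝ, 1 ≤ M ∧ ∀ u F φ, Pk Ω ρ O δ c C T K u F φ → E2 Ω T s A u F →
    ∀ v vh : En n → ℝ, ContDiffOn ℝ ∞ v (Ω ×ˢ Ioo (0:ℝ) T) → ContinuousOn vh (closure Ω ×ˢ Ioo (0:ℝ) T) →
    (∀ p ∈ Ω ×ˢ Ioo (0:ℝ) T, vh p = v p) → (∀ z ∈ frontier Ω, ∀ t ∈ Ico s T, vh (z, t) ≤ B0) →
    (∀ z ∈ Ω, ∀ t ∈ Ico s T, 1 < v (z, t) → ∀ e, FrameAt (hMat (D2 u (z, t))) e →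
      Lop e v (z, t) ≤ C0 * v (z, t) ∧
      v (z, t) ≤ C0 * (Gam e (fun x => dd (sx x) u (z, t)) (fun x => dd (sx x) u (z, t)) + SS e) ^ n) →
    ∀ z ∈ Ω, ∀ t ∈ Ico s T, (t - s) ^ n * v (z, t) ≤ M := by
  have hC := D.hC
  set θ : ℝ := 1 / (16 * (A ^ 2 + C ^ 2)) with hθ
  have hAC : 1 ≤ A ^ 2 + C ^ 2 := by nlinarith
  have hθ0 : 0 < θ := by positivity
  have hθ1 : θ * (16 * (A ^ 2 + C ^ 2)) = 1 := by rw [hθ]; field_simp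
  have hθle : θ ≤ 1 := by nlinarith
  set C1 := C0 + 2 * A * (A + n) with hC1
  set N := 4 * (n + |T| * C1) / θ with hN
  have hC10 : 0 ≤ C1 := by positivity
  have hN0 : 0 ≤ N := by positivity
  set Em := Real.exp (A ^ 2 + K ^ 2 + C ^ 2) with hEm
  have hEm0 : 0 < Em := Real.exp_pos _
  set M := 1 + Em * (C0 * N ^ n) + |T| ^ n * (Em * B0) + |T| ^ n * Em with hM
  have p1 : 0 ≤ Em * (C0 * N ^ n) := by positivity
  have p2 : 0 ≤ |T| ^ n * (Em * B0) := by positivity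
  have p3 : 0 ≤ |T| ^ n * Em := by positivity
  refine ⟨M, by rw [hM]; linarith, fun u F φ P EE v vh sv cv ev bv iv z hz t ht => ?_⟩
  have hT := P.hT
  have hn := P.hn
  rw [abs_of_pos hT] at hN hM p2 p3
  have hI : Icc s t ⊆ Ioo 0 T := fun r hr => ⟨hs.trans_le hr.1, hr.2.trans_lt ht.2⟩
  have hI' : Icc s t ⊆ Ico s T := Icc_subset_Ico_right ht.2
  have hts : ∀ r ∈ Icc s t, 0 ≤ r - s ∧ r - s ≤ T := fun r hr => ⟨by linarith [hr.1], by linarith [hr.2, ht.2]⟩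
  set Γ : En n → ℝ := fun q => θ * (u q ^ 2 + nsq 0 q) with hΓ
  have hΓ0 : ∀ q, 0 ≤ Γ q := fun q => by simp only [hΓ, nsq]; positivity
  have key : (t - s) ^ n * (Real.exp (Γ (z, t)) * v (z, t)) - M ≤ 0 := by
    refine par_max D.op D.bd (s := s) (t1 := t) (g := fun q => (q.2 - s) ^ n * (Real.exp (Γ q) * v q) - M)
      (gh := fun q => (q.2 - s) ^ n * (Real.exp (Γ q) * vh q) - M) ?_
      (fun y hy r hr => ?_) (fun y hy r hr => ?_) (fun y hy => ?_) (fun y hy r hr hg => ?_) z hz t (right_mem_Icc.2 ht.1)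
    · have h1 : ContinuousOn (fun q : En n => (q.2 - s) ^ n) (closure Ω ×ˢ Icc s t) := by fun_prop
      have h2 : ContinuousOn u (closure Ω ×ˢ Icc s t) := P.u_cont.mono (prod_mono subset_rfl (hI.trans Ioo_subset_Ico_self))
      have h3 : ContinuousOn (nsq (0 : Cn n)) (closure Ω ×ˢ Icc s t) := (nsq_smooth 0 _).continuousOn
      have h4 : ContinuousOn Γ (closure Ω ×ˢ Icc s t) := continuousOn_const.mul ((h2.pow 2).add h3)
      exact (h1.mul (h4.rexp.mul (cv.mono (prod_mono subset_rfl hI)))).sub continuousOn_const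
    · simp only [ev (y, r) ⟨hy, hI hr⟩]
    · have h1 := bv y hy r (hI' hr)
      have h2 := P.φ_bd (y, r) ⟨frontier_subset_closure hy, Ioo_subset_Ico_self (hI hr)⟩
      rw [← P.bd y hy r (Ioo_subset_Ico_self (hI hr))] at h2
      have h3 : Γ (y, r) ≤ A ^ 2 + K ^ 2 + C ^ 2 := by
        have h4 := D.bz y (D.cl_sub (frontier_subset_closure hy))
        have h5 : u (y, r) ^ 2 ≤ K ^ 2 := sq_le_sq' (abs_le.1 h2).1 (abs_le.1 h2).2
        have h6 : nsq 0 (y, r) ≤ C ^ 2 := by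
          simp only [nsq, sub_zero]; exact pow_le_pow_left₀ (norm_nonneg _) h4 2
        have h7 : 0 ≤ u (y, r) ^ 2 + nsq 0 (y, r) := by simp only [nsq]; positivity
        have h8 := mul_le_mul_of_nonneg_right hθle h7
        simp only [hΓ]; nlinarith [sq_nonneg A]
      have h4 : Real.exp (Γ (y, r)) * vh (y, r) ≤ Em * B0 := by
        have h5 := Real.exp_le_exp.2 h3
        exact (mul_le_mul_of_nonneg_left h1 (Real.exp_pos _).le).trans (mul_le_mul_of_nonneg_right h5 hB)
      have h5 : (r - s) ^ n ≤ T ^ n := pow_le_pow_left₀ (hts r hr).1 (hts r hr).2 n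
      have h6 : (r - s) ^ n * (Real.exp (Γ (y, r)) * vh (y, r)) ≤ T ^ n * (Em * B0) :=
        (mul_le_mul_of_nonneg_left h4 (pow_nonneg (hts r hr).1 n)).trans
          (mul_le_mul_of_nonneg_right h5 (by positivity))
      simp only
      linarith
    · simp only [sub_self, zero_pow hn.ne']
      linarith
    · have hr' := Ioc_subset_Icc_self hr
      have hp : (y, r) ∈ Ω ×ˢ Ioo (0:ℝ) T := ⟨hy, hI hr'⟩
      set x := r - s with hx
      have hx0 : 0 < x := by rw [hx]; linarith [hr.1]
      have hxT : x ≤ T := (hts r hr').2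
      have hub := EE.b0 y hy r (hI' hr')
      have hutb := EE.bt y hy r (hI' hr')
      have hyC := D.bz y (D.sub hy)
      have h3 : Γ (y, r) ≤ A ^ 2 + K ^ 2 + C ^ 2 := by
        have h5 : u (y, r) ^ 2 ≤ A ^ 2 := sq_le_sq' (abs_le.1 hub).1 (abs_le.1 hub).2
        have h6 : nsq 0 (y, r) ≤ C ^ 2 := by
          simp only [nsq, sub_zero]; exact pow_le_pow_left₀ (norm_nonneg _) hyC 2
        have h7 : 0 ≤ u (y, r) ^ 2 + nsq 0 (y, r) := by simp only [nsq]; positivity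
        have h8 := mul_le_mul_of_nonneg_right hθle h7
        simp only [hΓ]; nlinarith [sq_nonneg K]
      have hE : Real.exp (Γ (y, r)) ≤ Em := Real.exp_le_exp.2 h3
      have hEp := Real.exp_pos (Γ (y, r))
      have hxn : x ^ n ≤ T ^ n := pow_le_pow_left₀ hx0.le hxT n
      have hxp : 0 < x ^ n := by positivity
      have hv1 : 1 < v (y, r) := by
        by_contra hv
        push Not at hv
        have h5 : Real.exp (Γ (y, r)) * v (y, r) ≤ Em := by nlinarith
        have h6 : x ^ n * (Real.exp (Γ (y, r)) * v (y, r)) ≤ T ^ n * Em :=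
          (mul_le_mul_of_nonneg_left h5 hxp.le).trans (mul_le_mul_of_nonneg_right hxn hEm0.le)
        have hg' : 0 < x ^ n * (Real.exp (Γ (y, r)) * v (y, r)) - M := hg
        linarith
      obtain ⟨e, E⟩ := P.S.frame hp
      obtain ⟨hLv, hvX⟩ := iv y hy r (hI' hr') hv1 e E
      have Hv := HasL.of_cd e (smooth_at2 P.S.op sv hp)
      have HΓ := ((P.hu hp E).sq.add (HasL.nsq e 0 (y, r))).cmul θ
      have HG := ((HasL.tpow e (y, r) s n).mul (HΓ.exp.mul Hv)).sub (HasL.const e (y, r) M)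
      refine ⟨e, _, _, _, HG, fun hcrit hτ hσ => ?_⟩
      rw [Hv.lop] at hLv
      have hGm : Gam e (fun v => 2 * (inner ℂ (y - 0) v).re) (fun v => 2 * (inner ℂ (y - 0) v).re) ≤ 8 * C ^ 2 * SS e := by
        have : Gam e (fun v => 2 * (inner ℂ (y - 0) v).re) (fun v => 2 * (inner ℂ (y - 0) v).re) ≤ 2 * (2 * C) ^ 2 * SS e := by
          refine Gam_le fun w => ?_
          have h4 := re_inner_le (y - 0) w
          rw [sub_zero] at h4 ⊢
          rw [abs_mul, abs_of_pos (by norm_num : (0:ℝ) < 2)]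
          linarith [norm_nonneg w, mul_le_mul_of_nonneg_right hyC (norm_nonneg w)]
        linarith
      have h5 : x ^ n * v (y, r) ≤ C0 * N ^ n :=
        smoothing_pt e hn hA hC0 hθ0 hθ1 hθle hC1 hN hx0 hxT hEp (by linarith) hub hutb rfl hGm hcrit hτ hσ hLv hvX
      have h6 : x ^ n * (Real.exp (Γ (y, r)) * v (y, r)) ≤ Em * (C0 * N ^ n) := by
        have h7 : x ^ n * (Real.exp (Γ (y, r)) * v (y, r)) = Real.exp (Γ (y, r)) * (x ^ n * v (y, r)) := by ring
        rw [h7]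
        exact mul_le_mul hE h5 (by positivity) hEm0.le
      have hg' : 0 < x ^ n * (Real.exp (Γ (y, r)) * v (y, r)) - M := hg
      linarith
  have hts' := hts t (right_mem_Icc.2 ht.1)
  rcases le_or_gt (v (z, t)) 0 with h | h
  · have := mul_nonpos_of_nonneg_of_nonpos (pow_nonneg hts'.1 n) h
    linarith
  · have h1 : 1 ≤ Real.exp (Γ (z, t)) := Real.one_le_exp (hΓ0 _)
    have h2 := mul_le_mul_of_nonneg_left (le_mul_of_one_le_left h.le h1) (pow_nonneg hts'.1 n)
    linarith

end Est2

/-! ### The gradient estimate -/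

section Est3

variable {Ω O : Set (Cn n)} {ρ : Cn n → ℝ} {δ c C T K : ℝ} {u F φ : En n → ℝ}

theorem Pk.det_eq (P : Pk Ω ρ O δ c C T K u F φ) {p : En n} (hp : p ∈ Ω ×ˢ Ioo (0:ℝ) T) :
    (hMat (D2 u p)).det.re = Real.exp (dd st u p - F p) := by
  have h1 : 0 < (hMat (D2 u p)).det.re := (Complex.pos_iff.1 (P.S.pos p hp).det_pos).1
  rw [P.S.eq p hp, add_sub_cancel_right, Real.exp_log h1]

theorem Pk.det_bd (P : Pk Ω ρ O δ c C T K u F φ) {s A : ℝ} (hs : 0 < s) (EE : E2 Ω T s A u F) {z : Cn n} {t : ℝ}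
    (hz : z ∈ Ω) (ht : t ∈ Ico s T) :
    Real.exp (-A) ≤ (hMat (D2 u (z, t))).det.re ∧ (hMat (D2 u (z, t))).det.re ≤ Real.exp A := by
  rw [P.det_eq ⟨hz, hs.trans_le ht.1, ht.2⟩]
  have := abs_le.1 (EE.ld z hz t ht)
  exact ⟨Real.exp_le_exp.2 this.1, Real.exp_le_exp.2 this.2⟩

theorem Dom.dd_le (D : Dom Ω ρ O δ c C) {p : Cn n} (hp : p ∈ frontier Ω) (v : Cn n) : |dd v ρ p| ≤ C * ‖v‖ := by
  obtain ⟨ν, γ, hν, hγ, hγ2, h⟩ := D.grad p hp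
  rw [h, abs_mul, abs_of_pos (D.hc.trans_le hγ)]
  have := re_inner_le ν v
  rw [hν, one_mul] at this
  exact mul_le_mul hγ2 this (abs_nonneg _) (by linarith [D.hC])

theorem Pk.φ1_bd (P : Pk Ω ρ O δ c C T K u F φ) {k1 : Cn n → En n → ℝ} {k2 : Cn n → Cn n → En n → ℝ} {kt : En n → ℝ}
    (R : Reg Ω T φ k1 k2 kt) (v : Cn n) : ∀ p ∈ closure Ω ×ˢ Ioo (0:ℝ) T, |k1 v p| ≤ K * ‖v‖ :=
  cl_le_Ioo (R.c1 v).abs continuousOn_const fun p hp => by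
    rw [R.i1 v p hp]; exact P.C4.o0.b1 p hp v

theorem Pk.φ2_bd (P : Pk Ω ρ O δ c C T K u F φ) {k1 : Cn n → En n → ℝ} {k2 : Cn n → Cn n → En n → ℝ} {kt : En n → ℝ}
    (R : Reg Ω T φ k1 k2 kt) (v w : Cn n) : ∀ p ∈ closure Ω ×ˢ Ioo (0:ℝ) T, |k2 v w p| ≤ K * ‖v‖ * ‖w‖ :=
  cl_le_Ioo (R.c2 v w).abs continuousOn_const fun p hp => by
    rw [R.i2 v w p hp]; exact P.C4.o0.b2 p hp v w

structure E3 (Ω : Set (Cn n)) (ρ : Cn n → ℝ) (T s A : ℝ) (u F φ : En n → ℝ) : Prop where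
  e2 : E2 Ω T s A u F
  bb : ∀ z ∈ Ω, ∀ t ∈ Ico s T, |u (z, t) - φ (z, t)| ≤ A * (- ρ z)
  b1 : ∀ z ∈ Ω, ∀ t ∈ Ico s T, ∀ v, |dd (sx v) u (z, t)| ≤ A * ‖v‖

theorem E2.mono {s s' A A' : ℝ} (hs : s ≤ s') (hA0 : 0 ≤ A) (hA : A ≤ A') (E : E2 Ω T s A u F) : E2 Ω T s' A' u F where
  b0 z hz t ht := (E.b0 z hz t ⟨hs.trans ht.1, ht.2⟩).trans hA
  bt z hz t ht := (E.bt z hz t ⟨hs.trans ht.1, ht.2⟩).trans hA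
  ld z hz t ht := (E.ld z hz t ⟨hs.trans ht.1, ht.2⟩).trans hA
  lS z hz t ht e he := (E.lS z hz t ⟨hs.trans ht.1, ht.2⟩ e he).trans
    (mul_le_mul_of_nonneg_right hA (SS_nonneg e))

theorem est_grad (D : Dom Ω ρ O δ c C) (T K : ℝ) {s : ℝ} (hs : 0 < s) : ∃ A : ℝ, 1 ≤ A ∧
    ∀ u F φ, Pk Ω ρ O δ c C T K u F φ → E3 Ω ρ T s A u F φ := by
  have hs2 : 0 < s / 2 := by positivity
  obtain ⟨A0, hA0, h0⟩ := est2 D T K hs2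
  obtain ⟨A1, hA1, h1⟩ := est3 D T K hs2 A0
  have hC := D.hC
  have hB : 0 ≤ |K| + A1 * C := by positivity
  have hC0 : 0 ≤ |K| + n * Real.exp A0 := by positivity
  obtain ⟨M, hM, h⟩ := smoothing D T K hs2 hA0 hB hC0
  have hMq : 0 ≤ M / (s / 2) ^ n := by positivity
  refine ⟨A0 + A1 + M / (s / 2) ^ n, by linarith, fun u F φ P => ?_⟩
  have EE := h0 u F φ P
  have BB := h1 u F φ P EE
  have hK := P.hK
  rw [abs_of_pos (by linarith : 0 < K)] at h
  have key : ∀ ξ : Cn n, ‖ξ‖ = 1 → ∀ z ∈ Ω, ∀ t ∈ Ico s T, dd (sx ξ) u (z, t) ≤ M / (s / 2) ^ n := by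
    intro ξ hξ z hz t ht
    obtain ⟨u1, u2, ut, R⟩ := P.ru
    obtain ⟨k1, k2, kt, R'⟩ := P.rp
    have hh := h u F φ P EE (dd (sx ξ) u) (u1 ξ) (dd_smooth P.S.op P.S.su _) (R.c1 ξ) (R.i1 ξ) ?_ ?_ z hz t
      ⟨by linarith [ht.1], ht.2⟩
    · rw [le_div_iff₀ (by positivity), mul_comm]
      rcases le_or_gt (dd (sx ξ) u (z, t)) 0 with h | h
      · have := mul_nonpos_of_nonneg_of_nonpos (by positivity : 0 ≤ (s / 2) ^ n) h
        linarith
      · refine le_trans (mul_le_mul_of_nonneg_right ?_ h.le) hh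
        exact pow_le_pow_left₀ (by positivity) (by linarith [ht.1]) n
    · intro y hy r hr
      obtain ⟨b, hb, hb2⟩ := P.bgrad hs2 BB (R.sub P.D.op R') hy hr
      have h2 := hb2 ξ
      have h3 := P.φ1_bd R' ξ (y, r) ⟨frontier_subset_closure hy, hs2.trans_le hr.1, hr.2⟩
      have h4 := P.D.dd_le hy ξ
      rw [hξ, mul_one] at h3 h4
      have h5 : |b * dd ξ ρ y| ≤ A1 * C := by
        rw [abs_mul]; exact mul_le_mul hb h4 (abs_nonneg _) (by linarith)
      have h6 := abs_le.1 h5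
      have h7 := abs_le.1 h3

      linarith
    · intro y hy r hr hv e E
      have hp : (y, r) ∈ Ω ×ˢ Ioo (0:ℝ) T := ⟨hy, hs2.trans_le hr.1, hr.2⟩
      constructor
      · rw [(P.S.lin hp E _).1]
        obtain ⟨cc, hc1, hc2, hc3, -, -⟩ := P.S.dF _ hp
        have h2 := (abs_le.1 (hc3 ξ)).2
        rw [hξ, mul_one] at h2
        have h3 := mul_nonpos_of_nonpos_of_nonneg hc2 (by linarith : 0 ≤ dd (sx ξ) u (y, r))
        have h4 : 0 ≤ n * Real.exp A0 := by positivity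
        nlinarith
      · have hS := SS_nonneg e
        have hG := Gam_nonneg e (fun x => dd (sx x) u (y, r))
        have h2 := frame_cs (D2_bil (smooth_at2 P.S.op P.S.su hp)) E (D1 u (y, r)) ξ
        have h3 := E.qf_le ξ
        rw [hξ, one_pow, mul_one] at h3
        have h4 := E.trace_le
        have hd := (P.det_bd hs2 EE hy hr).2
        have e1 : ∑ k, (D1 u (y, r) (e k) ^ 2 + D1 u (y, r) (I • e k) ^ 2) =
            Gam e (fun x => dd (sx x) u (y, r)) (fun x => dd (sx x) u (y, r)) := by
          simp only [Gam, pow_two]; rfl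
        rw [e1] at h2
        have e2 : D1 u (y, r) ξ = dd (sx ξ) u (y, r) := rfl
        rw [e2] at h2
        change _ ≤ n * (_ * (SS e) ^ (n - 1)) at h4
        generalize Gam e (fun x => dd (sx x) u (y, r)) (fun x => dd (sx x) u (y, r)) = G at *
        generalize SS e = S at *
        have hSp : S ^ (n - 1) ≤ (G + S) ^ (n - 1) := pow_le_pow_left₀ hS (by linarith) _
        have hn1 : (G + S) ^ n = (G + S) ^ (n - 1) * (G + S) := by
          rw [← pow_succ]; congr 1; have := P.hn; omega
        have h5 : (hMat (D2 u (y, r))).det.re * S ^ (n - 1) ≤ Real.exp A0 * (G + S) ^ (n - 1) :=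
          mul_le_mul hd hSp (by positivity) (by positivity)
        have h6 : qf (hMat (D2 u (y, r))) ξ ≤ n * (Real.exp A0 * (G + S) ^ (n - 1)) :=
          (h3.trans h4).trans (mul_le_mul_of_nonneg_left h5 (by positivity))
        have h7 : dd (sx ξ) u (y, r) ^ 2 ≤ n * (Real.exp A0 * (G + S) ^ (n - 1)) * (G + S) :=
          h2.trans (mul_le_mul h6 (by linarith) hG (by positivity))
        have h8 : 0 ≤ K * (G + S) ^ n := by positivity
        calc dd (sx ξ) u (y, r) ≤ dd (sx ξ) u (y, r) ^ 2 := by nlinarith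
          _ ≤ _ := h7
          _ ≤ _ := by rw [hn1] at h8 ⊢; linarith
  refine ⟨EE.mono (by linarith) (by linarith) (by linarith), fun z hz t ht => ?_, fun z hz t ht v => ?_⟩
  · refine (BB z hz t ⟨by linarith [ht.1], ht.2⟩).trans (mul_le_mul_of_nonneg_right (by linarith) ?_)
    linarith [P.D.neg hz]
  · have k2 : ∀ v : Cn n, dd (sx v) u (z, t) ≤ M / (s / 2) ^ n * ‖v‖ := by
      intro v
      rcases eq_or_ne v 0 with rfl | hv
      · have : sx (0 : Cn n) = 0 := rfl
        simp [this, dd]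
      · have hv0 : 0 < ‖v‖ := norm_pos_iff.2 hv
        have h2 := key (‖v‖⁻¹ • v) (by rw [norm_smul, norm_inv, norm_norm]; field_simp) z hz t ht
        rw [sx_smul, dd_smul_dir, inv_mul_le_iff₀ hv0] at h2
        linarith
    have h3 := k2 (-v)
    have e1 : dd (sx (-v)) u (z, t) = - dd (sx v) u (z, t) := (D1 u (z, t)).map_neg v
    rw [e1, norm_neg] at h3
    have h4 : M / (s / 2) ^ n * ‖v‖ ≤ (A0 + A1 + M / (s / 2) ^ n) * ‖v‖ :=
      mul_le_mul_of_nonneg_right (by linarith) (norm_nonneg _)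
    exact abs_le.2 ⟨by linarith, by linarith [k2 v]⟩

end Est3

/-! ### Mixed second derivatives at the boundary -/

section Mixed

variable {Ω O : Set (Cn n)} {ρ : Cn n → ℝ} {δ c C T K : ℝ} {u F φ : En n → ℝ}

theorem Dom.dd2_le (D : Dom Ω ρ O δ c C) {z : Cn n} (hz : z ∈ O) (v w : Cn n) :
    |dd v (dd w ρ) z| ≤ C * ‖v‖ * ‖w‖ := by
  have := D.C4b.o0.b2 (z, 0) ⟨hz, mem_univ _⟩ v w
  rwa [D.D2_lft (p := (z, 0)) hz] at this

theorem Dom.dd1_le (D : Dom Ω ρ O δ c C) {z : Cn n} (hz : z ∈ O) (v : Cn n) :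
    |dd v ρ z| ≤ C * ‖v‖ := by
  have := D.C4b.o0.b1 (z, 0) ⟨hz, mem_univ _⟩ v
  rwa [D.dd_lft (p := (z, 0)) hz] at this

theorem Dom.lip (D : Dom Ω ρ O δ c C) {z p : Cn n} (hz : z ∈ closure Ω) (hp : p ∈ closure Ω) (v : Cn n) :
    |dd v ρ z - dd v ρ p| ≤ (C + 2 * C / δ) * ‖v‖ * ‖z - p‖ := by
  have hC := D.hC
  have hδ := D.hδ
  rcases lt_or_ge ‖z - p‖ δ with h | h
  · have h1 : ‖dd v ρ z - dd v ρ p‖ ≤ C * ‖v‖ * ‖z - p‖ := by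
      refine (convex_ball p δ).norm_image_sub_le_of_norm_fderiv_le (𝕜 := ℝ) (f := dd v ρ) (fun y hy => ?_) (fun y hy => ?_)
        (mem_ball_self hδ) (by rwa [mem_ball_iff_norm])
      · exact smooth_diff D.opO (dd_smooth D.opO D.sm v) (D.ball p hp hy)
      · refine ContinuousLinearMap.opNorm_le_bound _ (by positivity) fun w => ?_
        have := D.dd2_le (D.ball p hp hy) w v
        rw [Real.norm_eq_abs]
        refine this.trans (le_of_eq ?_)
        ring
    rw [Real.norm_eq_abs] at h1
    refine h1.trans ?_
    have : 0 ≤ 2 * C / δ * ‖v‖ * ‖z - p‖ := by positivity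
    linarith
  · have h1 := D.dd1_le (D.cl_sub hz) v
    have h2 := D.dd1_le (D.cl_sub hp) v
    have h3 := abs_sub (dd v ρ z) (dd v ρ p)
    have h4 : 2 * C * ‖v‖ ≤ 2 * C / δ * ‖v‖ * ‖z - p‖ := by
      have : 2 * C * ‖v‖ = 2 * C / δ * ‖v‖ * δ := by field_simp
      rw [this]
      exact mul_le_mul_of_nonneg_left h (by positivity)
    have : 0 ≤ C * ‖v‖ * ‖z - p‖ := by positivity
    linarith

theorem Gam_neg_le (e : Fin n → Cn n) (a b : Cn n → ℝ) : - Gam e a b ≤ 1 / 4 * Gam e a a + Gam e b b := by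
  simp only [Gam, Finset.mul_sum, ← Finset.sum_neg_distrib, ← Finset.sum_add_distrib]
  refine Finset.sum_le_sum fun i _ => ?_
  nlinarith [sq_nonneg (1 / 2 * a (e i) + b (e i)), sq_nonneg (1 / 2 * a (I • e i) + b (I • e i))]

theorem cross_le {B : Cn n → Cn n → ℝ} {e : Fin n → Cn n} (h : IsBil B) (E : FrameAt (hMat B) e) (l : Cn n →ₗ[ℝ] ℝ)
    (ν : Cn n) (a b : Cn n → ℝ) :
    Gam e l (fun v => B v ν - a v) ≤ 4 * l ν + Gam e (fun v => B v (I • ν) - b v) (fun v => B v (I • ν) - b v)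
      + 5 / 4 * Gam e l l + 1 / 2 * Gam e b b + 1 / 2 * Gam e a a := by
  rw [← frame_expand h E l ν]
  simp only [Gam, Finset.mul_sum, ← Finset.sum_add_distrib]
  refine Finset.sum_le_sum fun k _ => ?_
  have hI : I • I • e k = - e k := by rw [smul_smul, I_mul_I, neg_one_smul]
  have e1 : B (I • ν) (- e k) = - B (I • ν) (e k) := by
    have := h.smulr (-1) (I • ν) (e k)
    rw [neg_one_smul] at this; linarith
  simp only [hf, hI, e1]
  rw [h.symm (e k) ν, h.symm (I • e k) ν, h.symm (e k) (I • ν), h.symm (I • e k) (I • ν)]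
  generalize B ν (e k) = b1
  generalize B ν (I • e k) = b2
  generalize B (I • ν) (e k) = b3
  generalize B (I • ν) (I • e k) = b4
  generalize l (e k) = l1
  generalize l (I • e k) = l2
  generalize a (e k) = a1
  generalize a (I • e k) = a2
  generalize b (e k) = c1
  generalize b (I • e k) = c2
  have k1 := sq_nonneg (1 / 2 * l1 + (b4 - c2))
  have k2 := sq_nonneg (1 / 2 * l2 - (b3 - c1))
  have k3 := sq_nonneg (l1 + c2)
  have k4 := sq_nonneg (l2 - c1)
  have k5 := sq_nonneg (l1 + a1)
  have k6 := sq_nonneg (l2 + a2)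
  nlinarith

theorem Pk.h_w (P : Pk Ω ρ O δ c C T K u F φ) {s A : ℝ} (hs : 0 < s) (hA : 1 ≤ A) (EE : E3 Ω ρ T s A u F φ) {z : Cn n} {t : ℝ}
    (hz : z ∈ Ω) (ht : t ∈ Ico s T) {e : Fin n → Cn n} (E : FrameAt (hMat (D2 u (z, t))) e) {q : Cn n} (hq : ‖q‖ ≤ 1) :
    ∃ τ σ, HasL e (fun p => dd (sx q) u p - dd (sx q) φ p) (z, t)
      (fun v => D2 u (z, t) v q - D2 φ (z, t) v q) τ σ ∧ |τ - σ| ≤ (5 * K * A * A) * SS e := by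
  have hp : (z, t) ∈ Ω ×ˢ Ioo (0:ℝ) T := ⟨hz, hs.trans_le ht.1, ht.2⟩
  have hK := P.hK
  obtain ⟨τ, σ, H, hL⟩ := P.h_dd hp E (sx q)
  have H2 := HasL.of_cd e (smooth_at2 P.S.op (dd_smooth P.S.op P.C4.o0.sm (sx q)) hp)
  have hb := P.C4.o1 q
  have hKq : K * ‖q‖ ≤ K := by nlinarith [norm_nonneg q]
  have h1 := hb.bt _ hp
  have h2 := H2.sigma_abs (hb.b2 _ hp)
  have hS := SS_nonneg e
  have h3 : K * ‖q‖ / 2 * SS e ≤ K / 2 * SS e := mul_le_mul_of_nonneg_right (by linarith) hS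
  have hS1 := EE.e2.lS z hz t ht e E
  obtain ⟨cc, hc1, hc2, hc3, -, -⟩ := P.S.dF _ hp
  have h4 := hc3 q
  have h5 := EE.b1 z hz t ht q
  have h6 : |cc * dd (sx q) u (z, t)| ≤ K * A := by
    rw [abs_mul]
    refine mul_le_mul (abs_le.2 ⟨hc1, by linarith⟩) (h5.trans ?_) (abs_nonneg _) (by linarith)
    nlinarith [norm_nonneg q]
  refine ⟨_, _, H.sub H2, ?_⟩
  have e1 : (τ - dd st (dd (sx q) φ) (z, t) - (σ - 1 / 4 * ∑ k, hf (D2 (dd (sx q) φ) (z, t)) (e k) (e k)))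
    = dd (sx q) F (z, t) - dd st (dd (sx q) φ) (z, t) + 1 / 4 * ∑ k, hf (D2 (dd (sx q) φ) (z, t)) (e k) (e k) := by linarith
  rw [e1]
  generalize 1 / 4 * ∑ k, hf (D2 (dd (sx q) φ) (z, t)) (e k) (e k) = sg at *
  have hKA : K ≤ K * A := by nlinarith
  have hKS : K * A * 1 ≤ K * A * (A * SS e) := mul_le_mul_of_nonneg_left hS1 (by positivity)
  have hKS2 : K * SS e ≤ K * A * A * SS e := mul_le_mul_of_nonneg_right (by nlinarith [mul_pos (by linarith : 0 < K) (by linarith : 0 < A)]) hS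
  rw [abs_le] at *
  constructor <;> linarith

theorem mixed_pt {x T rν rτ wτ wν wJ Lτ Lν LJ ττ τν τJ στ σν σJ σrν σrτ σρ S Gντ Gτν Gττ GJJ Cb K' C W Cw c A lν : ℝ}
    (hx : 0 ≤ x) (hxT : x ≤ T) (hC : 1 ≤ C) (hW : 0 ≤ W) (hCw : 0 ≤ Cw) (hS : 0 ≤ S) (hS1 : 1 ≤ A * S)
    (h1 : |rν| ≤ C) (h2 : |rτ| ≤ C) (h3 : |wτ| ≤ W) (h4 : |wν| ≤ W) (h5 : |wJ| ≤ W)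
    (eτ : ττ - στ = Lτ) (eν : τν - σν = Lν) (eJ : τJ - σJ = LJ)
    (l1 : |Lτ| ≤ Cw * S) (l2 : |Lν| ≤ Cw * S) (l3 : |LJ| ≤ Cw * S)
    (r1 : |σrν| ≤ C * S) (r2 : |σrτ| ≤ C * S) (hρ : c * S ≤ σρ)
    (g1 : - Gντ ≤ Gττ + C ^ 2 * S) (g2 : Gτν ≤ 4 * lν + GJJ + Cw * S) (hlν : |lν| ≤ C)
    (hK' : 0 ≤ K')
    (hK : (2 * C * W + 2 * W ^ 2 + 2 * T * C + 1) * A + T * (2 * C * Cw + 2 * W * C + 4 * W * Cw + C ^ 2 + Cw) + Cb ≤ K' * c)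
    (hτ : 0 ≤ x * (rν * ττ + wτ * 0 - (rτ * τν + wν * 0) + (2 * wτ * ττ + 2 * wJ * τJ))
      + (rν * wτ - rτ * wν + (wτ ^ 2 + wJ ^ 2)) * 1 - Cb * 0 + K' * 0)
    (hσ : x * (rν * στ + wτ * σrν + 1 / 2 * Gντ - (rτ * σν + wν * σrτ + 1 / 2 * Gτν)
      + (2 * wτ * στ + 1 / 2 * Gττ + (2 * wJ * σJ + 1 / 2 * GJJ))) - Cb * S + K' * σρ ≤ 0) : False := by
  have hT : 0 ≤ T := hx.trans hxT
  have mm : ∀ {a b X Y : ℝ}, |a| ≤ X → |b| ≤ Y → 0 ≤ X → a * b ≤ X * Y ∧ -(X * Y) ≤ a * b := by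
    intro a b X Y ha hb hX
    have : |a * b| ≤ X * Y := by rw [abs_mul]; exact mul_le_mul ha hb (abs_nonneg _) hX
    exact ⟨(abs_le.1 this).2, (abs_le.1 this).1⟩
  have hC0 : 0 ≤ C := by linarith
  have m1 := (mm h1 l1 hC0).1
  have m2 := (mm h2 l2 hC0).2
  have m3 := (mm h3 r1 hW).2
  have m4 := (mm h4 r2 hW).1
  have m5 := (mm h3 l1 hW).1
  have m6 := (mm h5 l3 hW).1
  have m7 := (mm h1 h3 hC0).1
  have m8 := (mm h2 h4 hC0).2
  have m9 := (mm h3 h3 hW).1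
  have m10 := (mm h5 h5 hW).1
  have hl := (abs_le.1 hlν).2
  subst eτ eν eJ
  have inner : rν * (ττ - στ) - wτ * σrν - 1 / 2 * Gντ - rτ * (τν - σν) + wν * σrτ + 1 / 2 * Gτν
      + 2 * wτ * (ττ - στ) - 1 / 2 * Gττ + 2 * wJ * (τJ - σJ) - 1 / 2 * GJJ
      ≤ 2 * C + (2 * C * Cw + 2 * W * C + 4 * W * Cw + C ^ 2 + Cw) * S := by
    have : 0 ≤ C ^ 2 * S := by positivity
    have : 0 ≤ Cw * S := by positivity
    linarith
  have h6 := mul_le_mul_of_nonneg_left inner hx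
  have h7 : 0 ≤ 2 * C + (2 * C * Cw + 2 * W * C + 4 * W * Cw + C ^ 2 + Cw) * S := by positivity
  have h8 := mul_le_mul_of_nonneg_right hxT h7
  have h9 := mul_le_mul_of_nonneg_right hK hS
  have h10 := mul_le_mul_of_nonneg_left hρ hK'
  have h11 : (2 * C * W + 2 * W ^ 2 + 2 * T * C + 1) * 1 ≤ (2 * C * W + 2 * W ^ 2 + 2 * T * C + 1) * (A * S) :=
    mul_le_mul_of_nonneg_left hS1 (by positivity)
  linarith

end Mixed

section Mixed2

variable {Ω O : Set (Cn n)} {ρ : Cn n → ℝ} {δ c C T K : ℝ} {u F φ : En n → ℝ}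

theorem Pk.w1_eq (P : Pk Ω ρ O δ c C T K u F φ) {w1 : Cn n → En n → ℝ} {w2 : Cn n → Cn n → En n → ℝ} {wt : En n → ℝ}
    (R : Reg Ω T (fun p => u p - φ p) w1 w2 wt) {p : En n} (hp : p ∈ Ω ×ˢ Ioo (0:ℝ) T) (q : Cn n) :
    w1 q p = dd (sx q) u p - dd (sx q) φ p := by
  rw [R.i1 q p hp, dd_sub (smooth_diff P.S.op P.S.su hp) (smooth_diff P.S.op P.C4.o0.sm hp)]

theorem Pk.h_x (e : Fin n → Cn n) (p : En n) (s : ℝ) : HasL e (fun q => q.2 - s) p (fun _ => 0) 1 0 :=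
  ((HasL.time e p).sub (HasL.const e p s)).congr' (fun _ => by simp) (by simp) (by simp)

theorem Gam_zero (e : Fin n → Cn n) (b : Cn n → ℝ) : Gam e (fun _ => 0) b = 0 := by simp [Gam]

theorem Pk.h_r (P : Pk Ω ρ O δ c C T K u F φ) {p : En n} (hp : p ∈ Ω ×ˢ Ioo (0:ℝ) T) (e : Fin n → Cn n) {q : Cn n} (hq : ‖q‖ ≤ 1) :
    ∃ σ, HasL e (dd (sx q) (lft ρ)) p (D1 (dd (sx q) (lft ρ)) p) 0 σ ∧ |σ| ≤ C * SS e ∧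
      (∀ v, |D1 (dd (sx q) (lft ρ)) p v| ≤ C * ‖v‖) ∧ |dd (sx q) (lft ρ) p| ≤ C := by
  have hC := P.D.hC
  have hb := P.D.C4b.o1 q
  have hO : IsOpen (O ×ˢ (univ : Set ℝ)) := P.D.opO.prod isOpen_univ
  have hpO : p ∈ O ×ˢ (univ : Set ℝ) := ⟨P.D.sub hp.1, mem_univ _⟩
  have H := HasL.of_cd e (smooth_at2 hO hb.sm hpO)
  have hCq : C * ‖q‖ ≤ C := by nlinarith [norm_nonneg q]
  have hst : dd st (dd (sx q) (lft ρ)) p = 0 := by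
    have : dd (sx q) (lft ρ) =ᶠ[𝓝 p] lft (dd q ρ) := by
      filter_upwards [hO.mem_nhds hpO] with y hy
      exact P.D.dd_lft hy.1 q
    rw [dd_congr this]
    exact dd_st_lift _ _
  refine ⟨_, H.congr' (fun _ => rfl) hst rfl, ?_, fun v => ?_, ?_⟩
  · have h2 := H.sigma_abs (hb.b2 _ hpO)
    refine h2.trans (mul_le_mul_of_nonneg_right ?_ (SS_nonneg e))
    have := mul_nonneg (by linarith : 0 ≤ C) (norm_nonneg q)
    linarith
  · exact (hb.b1 _ hpO v).trans (mul_le_mul_of_nonneg_right hCq (norm_nonneg _))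
  · exact (hb.b0 _ hpO).trans hCq

set_option maxHeartbeats 1000000 in
theorem mixed_barrier (D : Dom Ω ρ O δ c C) {T K : ℝ} (hT : 0 < T) (hK : 1 ≤ K) {s A : ℝ} (hs : 0 < s) (hA : 1 ≤ A) :
    ∃ Cb K' : ℝ, 0 ≤ K' ∧ ∀ u F φ, Pk Ω ρ O δ c C T K u F φ → E3 Ω ρ T s A u F φ → ∀ w1 w2 wt,
    Reg Ω T (fun p => u p - φ p) w1 w2 wt → ∀ p ∈ frontier Ω, ∀ ν τ : Cn n, ‖ν‖ = 1 → ‖τ‖ ≤ 1 → dd τ ρ p = 0 →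
    dd (I • ν) ρ p = 0 → ∀ t ∈ Ico s T, ∀ z ∈ Ω,
    (t - s) * (dd ν ρ z * w1 τ (z, t) - dd τ ρ z * w1 ν (z, t) + (w1 τ (z, t) ^ 2 + w1 (I • ν) (z, t) ^ 2))
      - Cb * ‖z - p‖ ^ 2 + K' * ρ z ≤ 0 := by
  have hC := D.hC
  have hc := D.hc
  have hδ := D.hδ
  set L := C + 2 * C / δ with hL
  have hL0 : 0 ≤ L := by positivity
  set Cb := 2 * T * A ^ 2 * L ^ 2 with hCb
  have hCb0 : 0 ≤ Cb := by positivity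
  set Cw := 5 * K * A * A + 5 / 2 * C ^ 2 + 2 * K ^ 2 with hCw
  have hCw0 : 0 ≤ Cw := by positivity
  set W := A + K with hW
  have hW0 : 0 ≤ W := by positivity
  set K' := ((2 * C * W + 2 * W ^ 2 + 2 * T * C + 1) * A + T * (2 * C * Cw + 2 * W * C + 4 * W * Cw + C ^ 2 + Cw) + Cb) / c with hK'
  have hK'0 : 0 ≤ K' := by positivity
  have hK'c : (2 * C * W + 2 * W ^ 2 + 2 * T * C + 1) * A + T * (2 * C * Cw + 2 * W * C + 4 * W * Cw + C ^ 2 + Cw) + Cb ≤ K' * c := by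
    rw [hK']; field_simp; exact le_rfl
  clear_value K' Cb Cw W
  refine ⟨Cb, K', hK'0, fun u F φ P EE w1 w2 wt R p hp ν τ hν hτ hτp hJp t ht z hz => ?_⟩
  have hJ : ‖I • ν‖ ≤ 1 := by rw [norm_I_smul', hν]
  have hpc := frontier_subset_closure hp
  have hI : Icc s t ⊆ Ioo 0 T := fun r hr => ⟨hs.trans_le hr.1, hr.2.trans_lt ht.2⟩
  have hI' : Icc s t ⊆ Ico s T := Icc_subset_Ico_right ht.2
  have hO : IsOpen (O ×ˢ (univ : Set ℝ)) := P.D.opO.prod isOpen_univ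
  have rc : ∀ q, ContinuousOn (fun y : En n => dd q ρ y.1) (closure Ω ×ˢ Icc s t) := fun q =>
    (dd_smooth D.opO D.sm q).continuousOn.comp continuousOn_fst (fun y hy => D.cl_sub hy.1)
  refine par_max D.op D.bd (s := s) (t1 := t)
    (g := fun q => (q.2 - s) * (dd (sx ν) (lft ρ) q * (dd (sx τ) u q - dd (sx τ) φ q)
      - dd (sx τ) (lft ρ) q * (dd (sx ν) u q - dd (sx ν) φ q)
      + ((dd (sx τ) u q - dd (sx τ) φ q) ^ 2 + (dd (sx (I • ν)) u q - dd (sx (I • ν)) φ q) ^ 2)) - Cb * nsq p q + K' * lft ρ q)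
    (gh := fun q => (q.2 - s) * (dd ν ρ q.1 * w1 τ q - dd τ ρ q.1 * w1 ν q + (w1 τ q ^ 2 + w1 (I • ν) q ^ 2))
      - Cb * nsq p q + K' * lft ρ q) ?_ (fun y hy r hr => ?_) (fun y hy r hr => ?_) (fun y hy => ?_) (fun y hy r hr hg => ?_)
      z hz t (right_mem_Icc.2 ht.1) |> fun h => ?_
  · have hzp : (z, t) ∈ Ω ×ˢ Ioo (0:ℝ) T := ⟨hz, hI (right_mem_Icc.2 ht.1)⟩
    simp only [P.w1_eq R hzp]
    simp only [D.dd_lft (p := (z, t)) (D.sub hz)] at h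
    exact h
  · have h1 : ContinuousOn (fun q : En n => q.2 - s) (closure Ω ×ˢ Icc s t) := by fun_prop
    have wc : ∀ q, ContinuousOn (w1 q) (closure Ω ×ˢ Icc s t) := fun q => (R.c1 q).mono (prod_mono subset_rfl hI)
    exact ((h1.mul ((((rc ν).mul (wc τ)).sub ((rc τ).mul (wc ν))).add (((wc τ).pow 2).add ((wc _).pow 2)))).sub
      (continuousOn_const.mul (nsq_smooth p _).continuousOn)).add (continuousOn_const.mul (P.ρ_cont _))
  · have hyp : (y, r) ∈ Ω ×ˢ Ioo (0:ℝ) T := ⟨hy, hI hr⟩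
    simp only [P.w1_eq R hyp, D.dd_lft (p := (y, r)) (D.sub hy)]
  · obtain ⟨b, hb, hb2⟩ := P.bgrad hs EE.bb R hy (hI' hr)
    have h0 : lft ρ (y, r) = 0 := D.fr y hy
    have hb3 : b ^ 2 ≤ A ^ 2 := sq_le_sq' (abs_le.1 hb).1 (abs_le.1 hb).2
    have lp : ∀ q : Cn n, ‖q‖ ≤ 1 → dd q ρ p = 0 → dd q ρ y ^ 2 ≤ L ^ 2 * ‖y - p‖ ^ 2 := by
      intro q hq hq0
      have h1 := D.lip (frontier_subset_closure hy) hpc q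
      rw [hq0, sub_zero, ← hL] at h1
      have h2 : |dd q ρ y| ≤ L * ‖y - p‖ := h1.trans (mul_le_mul_of_nonneg_right (by nlinarith [norm_nonneg q]) (norm_nonneg _))
      rw [← mul_pow]
      exact sq_le_sq' (abs_le.1 h2).1 (abs_le.1 h2).2
    have l1 := lp τ hτ hτp
    have l2 := lp _ hJ hJp
    have hx : 0 ≤ r - s := by linarith [hr.1]
    have hxT : r - s ≤ T := by linarith [hr.2, ht.2]
    simp only [hb2, h0, nsq]
    have h3 : (b * dd τ ρ y) ^ 2 + (b * dd (I • ν) ρ y) ^ 2 ≤ A ^ 2 * (2 * L ^ 2 * ‖y - p‖ ^ 2) := by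
      have : (b * dd τ ρ y) ^ 2 + (b * dd (I • ν) ρ y) ^ 2 = b ^ 2 * (dd τ ρ y ^ 2 + dd (I • ν) ρ y ^ 2) := by ring
      rw [this]
      exact mul_le_mul hb3 (by linarith) (by positivity) (by positivity)
    have h4 := mul_le_mul hxT h3 (by positivity) hT.le
    have e1 : dd ν ρ y * (b * dd τ ρ y) - dd τ ρ y * (b * dd ν ρ y) = 0 := by ring
    rw [e1, zero_add, hCb]
    linarith
  · have h1 := mul_nonpos_of_nonneg_of_nonpos hK'0 (P.D.neg hy).le
    have h2 : 0 ≤ Cb * nsq p (y, s) := mul_nonneg hCb0 (sq_nonneg _)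
    have h3 : lft ρ (y, s) = ρ y := rfl
    simp only [sub_self, zero_mul, h3]
    linarith
  · have hr' := Ioc_subset_Icc_self hr
    have hyp : (y, r) ∈ Ω ×ˢ Ioo (0:ℝ) T := ⟨hy, hI hr'⟩
    obtain ⟨e, E⟩ := P.S.frame hyp
    obtain ⟨ττ, στ, Hτ, lτ⟩ := P.h_w hs hA EE hy (hI' hr') E hτ
    obtain ⟨τν, σν, Hν, lν⟩ := P.h_w hs hA EE hy (hI' hr') E hν.le
    obtain ⟨τJ, σJ, HJ, lJ⟩ := P.h_w hs hA EE hy (hI' hr') E hJ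
    obtain ⟨σrτ, Hrτ, srτ, arτ, brτ⟩ := P.h_r hyp e hτ
    obtain ⟨σrν, Hrν, srν, arν, brν⟩ := P.h_r hyp e hν.le
    obtain ⟨σρ, Hρ, sρ⟩ := P.hρ hyp e
    have HG := ((((Pk.h_x e (y, r) s).mul (((Hrν.mul Hτ).sub (Hrτ.mul Hν)).add (Hτ.sq.add HJ.sq))).sub
      ((HasL.nsq e p (y, r)).cmul Cb)).add (Hρ.cmul K')).congr' (fun _ => rfl) rfl
      (by rw [Gam_zero, mul_zero, mul_zero, add_zero, add_zero])
    refine ⟨e, _, _, _, HG, fun _ hτ0 hσ0 => ?_⟩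
    have hS := SS_nonneg e
    have hCwS : ∀ {x : ℝ}, |x| ≤ 5 * K * A * A * SS e → |x| ≤ Cw * SS e := fun h =>
      h.trans (mul_le_mul_of_nonneg_right (by rw [hCw]; nlinarith [sq_nonneg C, sq_nonneg K]) hS)
    have hw : ∀ q : Cn n, ‖q‖ ≤ 1 → |dd (sx q) u (y, r) - dd (sx q) φ (y, r)| ≤ W := by
      intro q hq
      have h1 := EE.b1 y hy r (hI' hr') q
      have h2 := P.C4.o0.b1 _ hyp q
      have h3 := abs_sub (dd (sx q) u (y, r)) (dd (sx q) φ (y, r))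
      rw [hW]
      nlinarith [norm_nonneg q]
    have hφ : ∀ q : Cn n, ‖q‖ ≤ 1 → Gam e (fun v => D2 φ (y, r) v q) (fun v => D2 φ (y, r) v q) ≤ 2 * K ^ 2 * SS e := by
      intro q hq
      refine Gam_le fun v => (P.C4.o0.b2 _ hyp v q).trans ?_
      have := mul_le_mul_of_nonneg_left hq (by positivity : 0 ≤ K * ‖v‖)
      linarith
    have hlτ := Gam_le (e := e) arτ
    have hlν := Gam_le (e := e) arν
    have cr := cross_le (D2_bil (smooth_at2 P.S.op P.S.su hyp)) E (D1 (dd (sx τ) (lft ρ)) (y, r)) ν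
      (fun v => D2 φ (y, r) v ν) (fun v => D2 φ (y, r) v (I • ν))
    have g1 := Gam_neg_le e (D1 (dd (sx ν) (lft ρ)) (y, r)) (fun v => D2 u (y, r) v τ - D2 φ (y, r) v τ)
    have f1 := hφ ν hν.le
    have f2 := hφ _ hJ
    have al := arτ ν
    rw [hν, mul_one] at al
    have hm0 : 0 ≤ 5 * K * A * A * SS e := by positivity
    have hm1 : 0 ≤ C ^ 2 * SS e := by positivity
    have g1' : - Gam e (D1 (dd (sx ν) (lft ρ)) (y, r)) (fun v => D2 u (y, r) v τ - D2 φ (y, r) v τ)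
        ≤ Gam e (fun v => D2 u (y, r) v τ - D2 φ (y, r) v τ) (fun v => D2 u (y, r) v τ - D2 φ (y, r) v τ) + C ^ 2 * SS e := by
      linarith
    have g2' : Gam e (D1 (dd (sx τ) (lft ρ)) (y, r)) (fun v => D2 u (y, r) v ν - D2 φ (y, r) v ν)
        ≤ 4 * D1 (dd (sx τ) (lft ρ)) (y, r) ν + Gam e (fun v => D2 u (y, r) v (I • ν) - D2 φ (y, r) v (I • ν))
          (fun v => D2 u (y, r) v (I • ν) - D2 φ (y, r) v (I • ν)) + Cw * SS e := by
      rw [hCw]; linarith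
    exact mixed_pt (x := r - s) (T := T) (rν := dd (sx ν) (lft ρ) (y, r)) (rτ := dd (sx τ) (lft ρ) (y, r))
      (wτ := dd (sx τ) u (y, r) - dd (sx τ) φ (y, r)) (wν := dd (sx ν) u (y, r) - dd (sx ν) φ (y, r))
      (wJ := dd (sx (I • ν)) u (y, r) - dd (sx (I • ν)) φ (y, r)) (S := SS e) (ττ := ττ) (τν := τν) (τJ := τJ)
      (στ := στ) (σν := σν) (σJ := σJ) (σrν := σrν) (σrτ := σrτ) (σρ := σρ) (Cb := Cb) (K' := K') (C := C) (W := W) (Cw := Cw)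
      (c := c) (A := A)
      (Gντ := Gam e (D1 (dd (sx ν) (lft ρ)) (y, r)) (fun v => D2 u (y, r) v τ - D2 φ (y, r) v τ))
      (Gτν := Gam e (D1 (dd (sx τ) (lft ρ)) (y, r)) (fun v => D2 u (y, r) v ν - D2 φ (y, r) v ν))
      (Gττ := Gam e (fun v => D2 u (y, r) v τ - D2 φ (y, r) v τ) (fun v => D2 u (y, r) v τ - D2 φ (y, r) v τ))
      (GJJ := Gam e (fun v => D2 u (y, r) v (I • ν) - D2 φ (y, r) v (I • ν)) (fun v => D2 u (y, r) v (I • ν) - D2 φ (y, r) v (I • ν)))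
      (by linarith [hr.1]) (by linarith [hr.2, ht.2]) hC hW0 hCw0 hS
      (EE.e2.lS y hy r (hI' hr') e E) brν brτ (hw τ hτ) (hw ν hν.le) (hw _ hJ) rfl rfl rfl (hCwS lτ) (hCwS lν) (hCwS lJ)
      srν srτ sρ g1' g2' al hK'0 hK'c hτ0 hσ0

end Mixed2

/-! ### Second derivatives at the boundary: mixed and tangential -/

section Bdry

variable {Ω O : Set (Cn n)} {ρ : Cn n → ℝ} {δ c C T K : ℝ} {u F φ : En n → ℝ}

theorem Dom.has_dd (D : Dom Ω ρ O δ c C) {p : Cn n} (hp : p ∈ closure Ω) (v : Cn n) :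
    HasFDerivWithinAt (dd v ρ) (fderiv ℝ (dd v ρ) p) (closure Ω) p :=
  (smooth_diff D.opO (dd_smooth D.opO D.sm v) (D.cl_sub hp)).hasFDerivAt.hasFDerivWithinAt

theorem has_nsq_zero (p : Cn n) (s : Set (Cn n)) :
    HasFDerivWithinAt (fun z => ‖z - p‖ ^ 2) (0 : Cn n →L[ℝ] ℝ) s p := by
  have : HasFDerivAt (fun z => ‖z - p‖ ^ 2) (0 : Cn n →L[ℝ] ℝ) p := by
    rw [hasFDerivAt_iff_isLittleO]
    have h := Asymptotics.isLittleO_pow_sub_sub p (one_lt_two : 1 < 2)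
    simpa using h
  exact this.hasFDerivWithinAt

theorem Dom.tan_J (D : Dom Ω ρ O δ c C) {p ν : Cn n} {γ : ℝ} (hg : ∀ x, dd x ρ p = γ * (inner ℂ ν x).re) :
    dd (I • ν) ρ p = 0 := by
  have h : inner ℂ ν ν = ((‖ν‖ ^ 2 : ℝ) : ℂ) := by
    rw [inner_self_eq_norm_sq_to_K]; push_cast; rfl
  rw [hg, inner_smul_right, h]
  simp [← ofReal_pow]

theorem Dom.nn (D : Dom Ω ρ O δ c C) {p ν : Cn n} {γ : ℝ} (hν : ‖ν‖ = 1)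
    (hg : ∀ x, dd x ρ p = γ * (inner ℂ ν x).re) : dd ν ρ p = γ := by
  have h : inner ℂ ν ν = ((‖ν‖ ^ 2 : ℝ) : ℂ) := by
    rw [inner_self_eq_norm_sq_to_K]; push_cast; rfl
  rw [hg, h, hν]
  simp

theorem est_mixed (D : Dom Ω ρ O δ c C) (hT : 0 < T) (hK : 1 ≤ K) {s : ℝ} (hs : 0 < s) : ∃ A : ℝ, 1 ≤ A ∧
    ∀ u F φ, Pk Ω ρ O δ c C T K u F φ → ∀ w1 w2 wt, Reg Ω T (fun p => u p - φ p) w1 w2 wt →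
    ∀ p ∈ frontier Ω, ∀ (ν τ : Cn n) (γ : ℝ), ‖ν‖ = 1 → c ≤ γ → (∀ x, dd x ρ p = γ * (inner ℂ ν x).re) →
    ‖τ‖ ≤ 1 → dd τ ρ p = 0 → ∀ t ∈ Ico s T, |w2 ν τ (p, t)| ≤ A := by
  obtain ⟨A, hA, HE⟩ := est_grad (Ω := Ω) (ρ := ρ) D T K (half_pos hs)
  obtain ⟨Cb, K', hK', HB⟩ := mixed_barrier D hT hK (half_pos hs) hA
  have hC := D.hC
  have hc := D.hc
  refine ⟨1 + A * C + K' * (2 / s), by have := mul_nonneg (by linarith : 0 ≤ A) (by linarith : 0 ≤ C); have : 0 ≤ K' * (2 / s) := by positivity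
                                       linarith, ?_⟩
  intro u F φ P w1 w2 wt R p hp ν τ γ hν hγ hg hτ hτ0 t ht
  have EE := HE u F φ P
  have ht' : t ∈ Ico (s / 2) T := ⟨by linarith [ht.1], ht.2⟩
  have htI : t ∈ Ioo (0:ℝ) T := ⟨by linarith [ht.1], ht.2⟩
  have hpc := frontier_subset_closure hp
  obtain ⟨b, hb, hbv⟩ := P.bgrad (half_pos hs) EE.bb R hp ht'
  have key : ∀ τ : Cn n, ‖τ‖ ≤ 1 → dd τ ρ p = 0 → - w2 ν τ (p, t) ≤ A * C + K' * (2 / s) := by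
    intro τ hτ hτ0
    have hJ := D.tan_J hg
    have hnn := D.nn hν hg
    have bar := HB u F φ P EE w1 w2 wt R p hp ν τ hν hτ hτ0 hJ t ht'
    obtain ⟨Lτ, eτ, hLτ⟩ := R.f2 τ (p, t) ⟨hpc, htI⟩
    obtain ⟨Lν, eν, hLν⟩ := R.f2 ν (p, t) ⟨hpc, htI⟩
    obtain ⟨LJ, eJ, hLJ⟩ := R.f2 (I • ν) (p, t) ⟨hpc, htI⟩
    have hG := (((((((D.has_dd hpc ν).mul hLτ).sub ((D.has_dd hpc τ).mul hLν)).add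
      ((hLτ.mul hLτ).add (hLJ.mul hLJ)))).const_mul (t - s / 2)).sub ((has_nsq_zero p (closure Ω)).const_mul Cb)).add
      ((D.hasF hpc).const_mul K')
    have hfin := D.inward_deriv (x := -ν) hp (by
      have h2 : dd (-ν) ρ p = - dd ν ρ p := by unfold dd; simp
      rw [h2, hnn]; linarith) hG (by
      intro z hz
      have h := bar z hz
      have w0 : w1 τ (p, t) = 0 := by rw [hbv, hτ0, mul_zero]
      have wJ0 : w1 (I • ν) (p, t) = 0 := by rw [hbv, hJ, mul_zero]
      have e1 := D.fr p hp
      simp only [Pi.add_apply, Pi.sub_apply, Pi.mul_apply, w0, wJ0, hτ0, e1, sub_self, norm_zero]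
      have h' : (t - s / 2) * (dd ν ρ z * w1 τ (z, t) - dd τ ρ z * w1 ν (z, t) +
        (w1 τ (z, t) * w1 τ (z, t) + w1 (I • ν) (z, t) * w1 (I • ν) (z, t))) - Cb * ‖z - p‖ ^ 2 + K' * ρ z ≤ 0 := by
        refine le_trans (le_of_eq ?_) h
        ring
      refine le_trans h' (le_of_eq ?_)
      ring)
    have w0 : w1 τ (p, t) = 0 := by rw [hbv, hτ0, mul_zero]
    have wJ0 : w1 (I • ν) (p, t) = 0 := by rw [hbv, hJ, mul_zero]
    have e3 : fderiv ℝ ρ p ν = γ := hnn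
    simp only [ContinuousLinearMap.add_apply, ContinuousLinearMap.sub_apply, ContinuousLinearMap.smul_apply, w0, wJ0,
      hτ0, hnn, map_neg, smul_eq_mul, eτ, e3, ContinuousLinearMap.zero_apply, hbv ν] at hfin
    have hd := D.dd2_le (D.cl_sub hpc) ν τ
    have hd' : |fderiv ℝ (dd τ ρ) p ν| ≤ C := by
      refine hd.trans ?_
      rw [hν]; nlinarith
    have hx : s / 2 ≤ t - s / 2 := by linarith [ht.1]
    have hγ0 : 0 < γ := by linarith
    have h5 : γ * ((t - s / 2) * (- w2 ν τ (p, t) + b * fderiv ℝ (dd τ ρ) p ν) - K') ≤ 0 := by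
      refine le_trans (le_of_eq ?_) hfin
      ring
    have h6 : (t - s / 2) * (- w2 ν τ (p, t) + b * fderiv ℝ (dd τ ρ) p ν) - K' ≤ 0 := by
      by_contra hh
      push Not at hh
      have := mul_pos hγ0 hh
      linarith
    have h7 : - w2 ν τ (p, t) + b * fderiv ℝ (dd τ ρ) p ν ≤ K' * (2 / s) := by
      have : - w2 ν τ (p, t) + b * fderiv ℝ (dd τ ρ) p ν ≤ K' / (t - s / 2) := by
        rw [le_div_iff₀ (by linarith)]; linarith
      refine this.trans ?_
      rw [show K' * (2 / s) = K' / (s / 2) by field_simp]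
      exact div_le_div_of_nonneg_left hK' (by linarith) hx
    have h8 : |b * fderiv ℝ (dd τ ρ) p ν| ≤ A * C := by
      rw [abs_mul]; exact mul_le_mul hb hd' (abs_nonneg _) (by linarith)
    linarith [(abs_le.1 h8).1]
  have k1 := key τ hτ hτ0
  have k2 := key (-τ) (by rwa [norm_neg]) (by unfold dd at *; simpa using hτ0)
  have e : w2 ν (-τ) (p, t) = - w2 ν τ (p, t) := by
    have hcl : closure (Ω ×ˢ Ioo (0:ℝ) T) ⊇ closure Ω ×ˢ Ioo (0:ℝ) T := by
      rw [closure_prod_eq]; exact prod_mono le_rfl subset_closure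
    refine (show EqOn (w2 ν (-τ)) (fun q => - w2 ν τ q) (closure Ω ×ˢ Ioo (0:ℝ) T) from
      EqOn.of_subset_closure (s := Ω ×ˢ Ioo (0:ℝ) T) ?_ (R.c2 _ _) (R.c2 _ _).neg (prod_mono subset_closure le_rfl) hcl) ⟨hpc, htI⟩
    intro q hq
    have B := D2_bil (smooth_at2 (P.D.op.prod isOpen_Ioo) R.sm hq)
    simp only [R.i2 _ _ q hq]
    have := B.smulr (-1 : ℝ) ν τ
    simpa using this
  rw [e] at k2
  rw [abs_le]
  constructor <;> linarith

theorem Pk.tan2 (P : Pk Ω ρ O δ c C T K u F φ) {s : ℝ} (hs : 0 < s) {A : ℝ}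
    (hA : ∀ z ∈ Ω, ∀ t ∈ Ico s T, |u (z, t) - φ (z, t)| ≤ A * (- ρ z)) {w1 : Cn n → En n → ℝ}
    {w2 : Cn n → Cn n → En n → ℝ} {wt : En n → ℝ} (R : Reg Ω T (fun p => u p - φ p) w1 w2 wt)
    {p : Cn n} (hp : p ∈ frontier Ω) {t : ℝ} (ht : t ∈ Ico s T) :
    ∃ b, |b| ≤ A ∧ (∀ v, w1 v (p, t) = b * dd v ρ p) ∧
      ∀ τ τ', dd τ ρ p = 0 → dd τ' ρ p = 0 → w2 τ τ' (p, t) = b * dd τ (dd τ' ρ) p := by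
  obtain ⟨b, hb, hbv⟩ := P.bgrad hs hA R hp ht
  refine ⟨b, hb, hbv, ?_⟩
  intro τ τ' h h'
  have D := P.D
  obtain ⟨ν, γ, hν, hγ, -, hg⟩ := D.grad p hp
  have hpc := frontier_subset_closure hp
  have htI : t ∈ Ioo (0:ℝ) T := ⟨by linarith [ht.1], ht.2⟩
  obtain ⟨Lτ, eτ, hLτ⟩ := R.f2 τ' (p, t) ⟨hpc, htI⟩
  obtain ⟨Lν, eν, hLν⟩ := R.f2 ν (p, t) ⟨hpc, htI⟩
  have hG := ((D.has_dd hpc ν).mul hLτ).sub ((D.has_dd hpc τ').mul hLν)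
  have hfin := D.tangential hp h hG (by
    intro z hz
    obtain ⟨b', -, hb'⟩ := P.bgrad hs hA R hz ht
    simp only [Pi.sub_apply, Pi.mul_apply, hb']
    ring)
  have w0 : w1 τ' (p, t) = 0 := by rw [hbv, h', mul_zero]
  have hnn := D.nn hν hg
  simp only [ContinuousLinearMap.add_apply, ContinuousLinearMap.sub_apply, ContinuousLinearMap.smul_apply, w0,
      h', hnn, smul_eq_mul, eτ, hbv ν] at hfin
  have e2 : γ * (w2 τ τ' (p, t) - b * dd τ (dd τ' ρ) p) = 0 := by
    rw [← hfin]; unfold dd; ring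
  have hγ0 : γ ≠ 0 := by have := D.hc; intro h0; linarith
  have := (mul_eq_zero.1 e2).resolve_left hγ0
  linarith

end Bdry

/-! ### Tangential vector fields -/

section Tan1

variable {Ω O : Set (Cn n)} {ρ : Cn n → ℝ} {δ c C T K : ℝ} {u F φ : En n → ℝ}

def Qn (a1 a2 a3 a4 : ℝ) (B : Cn n → Cn n → ℝ) (ξ ν : Cn n) : ℝ :=
  (a1 * a1 + a2 * a2) * hf B ξ ξ + (a3 * a3 + a4 * a4) * hf B ν ν
    + (-2) * ((a1 * a3 + a2 * a4) * hf B ξ ν + (a2 * a3 + (-1) * (a1 * a4)) * hf B ξ (I • ν))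

def zt (a1 a2 a3 a4 : ℝ) (ξ ν : Cn n) : Cn n :=
  a1 • ξ + (-a2) • (I • ξ) + (-a3) • ν + a4 • (I • ν)

theorem I_smul_I (v : Cn n) : (I : ℂ) • (I • v) = (-1 : ℝ) • v := by
  rw [smul_smul, I_mul_I]; simp

theorem I_smul_zt (a1 a2 a3 a4 : ℝ) (ξ ν : Cn n) :
    I • zt a1 a2 a3 a4 ξ ν = a1 • (I • ξ) + a2 • ξ + (-a3) • (I • ν) + (-a4) • ν := by
  unfold zt
  simp only [smul_add, smul_comm I (_ : ℝ), I_smul_I]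
  module

theorem Qn_eq {B : Cn n → Cn n → ℝ} (h : IsBil B) (a1 a2 a3 a4 : ℝ) (ξ ν : Cn n) :
    hf B (zt a1 a2 a3 a4 ξ ν) (zt a1 a2 a3 a4 ξ ν) = Qn a1 a2 a3 a4 B ξ ν := by
  simp only [hf, Qn, I_smul_zt]
  simp only [zt, h.add, h.addr, h.smul, h.smulr, I_smul_I]
  rw [h.symm ν ξ, h.symm (I • ν) ξ, h.symm ν (I • ξ), h.symm (I • ν) (I • ξ), h.symm (I • ξ) ξ, h.symm (I • ν) ν]
  ring

theorem zt_norm {a1 a2 a3 a4 C : ℝ} {ξ ν : Cn n} (hξ : ‖ξ‖ ≤ 1) (hν : ‖ν‖ ≤ 1) (h1 : |a1| ≤ C) (h2 : |a2| ≤ C)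
    (h3 : |a3| ≤ C) (h4 : |a4| ≤ C) : ‖zt a1 a2 a3 a4 ξ ν‖ ≤ 4 * C := by
  have key : ∀ (a : ℝ) (x : Cn n), |a| ≤ C → ‖x‖ ≤ 1 → ‖a • x‖ ≤ C := by
    intro a x ha hx
    rw [norm_smul, Real.norm_eq_abs]
    calc |a| * ‖x‖ ≤ C * 1 := mul_le_mul ha hx (norm_nonneg _) ((abs_nonneg _).trans ha)
      _ = C := mul_one C
  have k1 := key a1 ξ h1 hξ
  have k2 := key (-a2) (I • ξ) (by rwa [abs_neg]) (by rwa [norm_I_smul'])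
  have k3 := key (-a3) ν (by rwa [abs_neg]) hν
  have k4 := key a4 (I • ν) h4 (by rwa [norm_I_smul'])
  unfold zt
  have n1 := norm_add_le (a1 • ξ + (-a2) • (I • ξ) + (-a3) • ν) (a4 • (I • ν))
  have n2 := norm_add_le (a1 • ξ + (-a2) • (I • ξ)) ((-a3) • ν)
  have n3 := norm_add_le (a1 • ξ) ((-a2) • (I • ξ))
  linarith

theorem zt_tan (l : Cn n →ₗ[ℝ] ℝ) (ξ ν : Cn n) :
    l (zt (l ν) (l (I • ν)) (l ξ) (l (I • ξ)) ξ ν) = 0 ∧ l (I • zt (l ν) (l (I • ν)) (l ξ) (l (I • ξ)) ξ ν) = 0 := by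
  rw [I_smul_zt]
  unfold zt
  simp only [map_add, map_smul, smul_eq_mul]
  constructor <;> ring

def Nf (ρ : Cn n → ℝ) (B : Cn n → Cn n → En n → ℝ) (ξ ν : Cn n) (p : En n) : ℝ :=
  Qn (dd (sx ν) (lft ρ) p) (dd (sx (I • ν)) (lft ρ) p) (dd (sx ξ) (lft ρ) p) (dd (sx (I • ξ)) (lft ρ) p)
    (fun v w => B v w p) ξ ν

def CN (C K : ℝ) : ℝ :=
  4 * ((4 * (C * C) + 4 * (C * C)) * (K + K)) + 4 * ((4 * (C * C) + 4 * (C * C)) * (K + K))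
    + 4 * (|(-2:ℝ)| * (4 * ((4 * (C * C) + 4 * (C * C)) * (K + K)) +
      4 * ((4 * (C * C) + 4 * (|(-1:ℝ)| * (4 * (C * C)))) * (K + K))))

theorem Dom.a_C2b (D : Dom Ω ρ O δ c C) {v : Cn n} (hv : ‖v‖ ≤ 1) :
    C2b (O ×ˢ (univ : Set ℝ)) C (dd (sx v) (lft ρ)) :=
  (D.C4b.o1 v).mono le_rfl (by have := D.hC; nlinarith)

theorem Nf_C2b (D : Dom Ω ρ O δ c C) {Q : Set (En n)} (hQ : IsOpen Q) (hQO : Q ⊆ O ×ˢ (univ : Set ℝ)) {g : En n → ℝ}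
    (hK : 0 ≤ K) (h : C4b Q K g) {ξ ν : Cn n} (hξ : ‖ξ‖ ≤ 1) (hν : ‖ν‖ ≤ 1) :
    C2b Q (CN C K) (Nf ρ (fun v w p => D2 g p v w) ξ ν) := by
  have a : ∀ {v : Cn n}, ‖v‖ ≤ 1 → C2b Q C (dd (sx v) (lft ρ)) := fun hv => (D.a_C2b hv).mono hQO le_rfl
  have hJ : ∀ {v : Cn n}, ‖v‖ ≤ 1 → ‖I • v‖ ≤ 1 := fun hv => by rwa [norm_I_smul']
  have o : ∀ {v w : Cn n}, ‖v‖ ≤ 1 → ‖w‖ ≤ 1 → C2b Q K (fun p => D2 g p v w) := fun {v w} hv hw =>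
    (h.o2 v w).mono le_rfl (by
      have := mul_le_mul hv hw (norm_nonneg _) zero_le_one
      nlinarith)
  have hh : ∀ {v w : Cn n}, ‖v‖ ≤ 1 → ‖w‖ ≤ 1 → C2b Q (K + K) (fun p => hf (D2 g p) v w) := fun hv hw =>
    (o hv hw).add hQ (o (hJ hv) (hJ hw))
  have a1 := a hν
  have a2 := a (hJ hν)
  have a3 := a hξ
  have a4 := a (hJ hξ)
  exact (((((a1.mul hQ a1).add hQ (a2.mul hQ a2)).mul hQ (hh hξ hξ)).add hQ
    (((a3.mul hQ a3).add hQ (a4.mul hQ a4)).mul hQ (hh hν hν))).add hQ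
    ((C2b.const Q (-2)).mul hQ ((((a1.mul hQ a3).add hQ (a2.mul hQ a4)).mul hQ (hh hξ hν)).add hQ
      (((a2.mul hQ a3).add hQ ((C2b.const Q (-1)).mul hQ (a1.mul hQ a4))).mul hQ (hh hξ (hJ hν))))))

theorem tan_pt {N D d κ1 r m x z2 Hκ c0 Kb Bb Cn' Cd CK d0 Z : ℝ} (hκ : κ1 = -(1 / d ^ 2) * (N * (2 * d + (-1) * D)))
    (hN : |N| ≤ Cn') (hm : m = x ^ 2) (hx : 0 ≤ x) (hDd : |D - d| ≤ Cd * x) (hd0 : 0 < d0) (hd : d0 ≤ d) (hD : d0 / 2 ≤ D)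
    (hr : 0 ≤ r) (hH : |Hκ| ≤ 2 * CK * z2) (hz0 : 0 ≤ z2) (hz : z2 ≤ Z) (hCK : 0 ≤ CK) (hKb : 0 ≤ Kb)
    (hK1 : Cn' * Cd ^ 2 / d0 ^ 2 ≤ Kb * (d0 / 2)) (hB : (2 * CK + 4 * Kb) * Z ≤ Bb * d0) (hB0 : 0 ≤ Bb) :
    N + (κ1 + c0 - Kb * m) * D - r * (Hκ - 4 * Kb * z2) - 2 * Bb * r * D ≤ c0 * D := by
  have hdp : 0 < d := by linarith
  have e1 : N + κ1 * D = N * (D - d) ^ 2 / d ^ 2 := by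
    rw [hκ]; field_simp; ring
  have hC0 : 0 ≤ Cn' := (abs_nonneg _).trans hN
  have e2 : N * (D - d) ^ 2 / d ^ 2 ≤ Kb * (d0 / 2) * m := by
    have h1 : (D - d) ^ 2 ≤ Cd ^ 2 * m := by
      rw [hm, ← mul_pow, ← sq_abs]
      exact pow_le_pow_left₀ (abs_nonneg _) hDd 2
    have h2 : N * (D - d) ^ 2 ≤ Cn' * (Cd ^ 2 * m) :=
      (mul_le_mul_of_nonneg_right ((le_abs_self _).trans hN) (sq_nonneg _)).trans (mul_le_mul_of_nonneg_left h1 hC0)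
    have h3 : N * (D - d) ^ 2 / d ^ 2 ≤ Cn' * (Cd ^ 2 * m) / d0 ^ 2 := by
      have hm0 : 0 ≤ m := by rw [hm]; positivity
      refine div_le_div₀ (by positivity) h2 (by positivity) ?_
      exact pow_le_pow_left₀ hd0.le hd 2
    refine h3.trans ?_
    have hm0 : 0 ≤ m := by rw [hm]; positivity
    calc Cn' * (Cd ^ 2 * m) / d0 ^ 2 = Cn' * Cd ^ 2 / d0 ^ 2 * m := by ring
      _ ≤ _ := mul_le_mul_of_nonneg_right hK1 hm0
  have hm0 : 0 ≤ m := by rw [hm]; positivity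
  have e3 : Kb * m * (d0 / 2) ≤ Kb * m * D := mul_le_mul_of_nonneg_left hD (by positivity)
  have e4 : - (r * (Hκ - 4 * Kb * z2)) ≤ r * (Bb * d0) := by
    have : - (Hκ - 4 * Kb * z2) ≤ Bb * d0 := by
      have := (abs_le.1 hH).1
      have h2 : (2 * CK + 4 * Kb) * z2 ≤ (2 * CK + 4 * Kb) * Z := mul_le_mul_of_nonneg_left hz (by positivity)
      linarith
    have := mul_le_mul_of_nonneg_left this hr
    linarith
  have e5 : 2 * Bb * r * (d0 / 2) ≤ 2 * Bb * r * D := mul_le_mul_of_nonneg_left hD (by positivity)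
  have : N + (κ1 + c0 - Kb * m) * D = (N + κ1 * D) + c0 * D - Kb * m * D := by ring
  rw [this, e1]
  linarith

theorem has_mul_zero {f g : Cn n → ℝ} {g' : Cn n →L[ℝ] ℝ} {s : Set (Cn n)} {p : Cn n} (hf : ContinuousWithinAt f s p)
    (hg : HasFDerivWithinAt g g' s p) (h0 : g p = 0) : HasFDerivWithinAt (fun z => f z * g z) (f p • g') s p := by
  have h1 : HasFDerivWithinAt (fun z => (f z - f p) * g z) (0 : Cn n →L[ℝ] ℝ) s p := by
    rw [hasFDerivWithinAt_iff_isLittleO]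
    have hb : g =O[𝓝[s] p] fun z => z - p := by
      have := hg.isBigO_sub
      simpa [h0] using this
    have hl : (fun z => f z - f p) =o[𝓝[s] p] fun _ => (1:ℝ) := by
      rw [Asymptotics.isLittleO_one_iff]
      simpa using (hf.tendsto.sub_const (f p))
    have := hl.mul_isBigO (hb.norm_right)
    simp only [h0, mul_zero, sub_zero, ContinuousLinearMap.zero_apply]
    have h2 := Asymptotics.isLittleO_norm_right.1 (this.congr_right (fun z => by rw [one_mul]))
    exact h2
  have h2 := h1.add (hg.const_mul (f p))
  rw [zero_add] at h2
  exact h2.congr (fun z _ => by simp only [Pi.add_apply]; ring) (by simp only [Pi.add_apply]; ring)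

end Tan1

/-! ### Lower bound for the tangential complex Hessian -/

section Tan2

variable {Ω O : Set (Cn n)} {ρ : Cn n → ℝ} {δ c C T K : ℝ} {u F φ : En n → ℝ}

set_option maxHeartbeats 2000000 in
theorem Pk.tan_touch (P : Pk Ω ρ O δ c C T K u F φ) {s A : ℝ} (hs : 0 < s) (hA : 1 ≤ A) (EE : E3 Ω ρ T s A u F φ)
    {p ν ξ z : Cn n} {t : ℝ} (hz : z ∈ Ω) (ht : t ∈ Ico s T) (hpc : p ∈ closure Ω) (hν : ‖ν‖ ≤ 1) (hξ : ‖ξ‖ ≤ 1)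
    {d d0 r0 Cd CK Cm c0 Kb Bb CB : ℝ} {κ : En n → ℝ} (hd0 : 0 < d0) (hd : d0 ≤ d) (hr0 : 0 < r0)
    (hκ : κ = fun q => -(1 / d ^ 2) * (Nf ρ (fun v w p => D2 φ p v w) ξ ν q *
      (2 * d + (-1) * Nf ρ (fun v w p => D2 (lft ρ) p v w) ξ ν q)))
    (hN : |Nf ρ (fun v w p => D2 φ p v w) ξ ν (z, t)| ≤ Cm)
    (hCK : C2b (Ω ×ˢ Ioo (0:ℝ) T) CK κ)
    (hKb : 0 ≤ Kb) (hKr : A + CK + 1 ≤ Kb * r0 ^ 2)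
    (hcl : ‖z - p‖ < r0 → |Nf ρ (fun v w p => D2 (lft ρ) p v w) ξ ν (z, t) - d| ≤ Cd * ‖z - p‖)
    (hCd : 0 ≤ Cd) (hCdr : Cd * r0 ≤ d0 / 2)
    (hK1 : Cm * Cd ^ 2 / d0 ^ 2 ≤ Kb * (d0 / 2)) (hB : (2 * CK + 4 * Kb) * (16 * C ^ 2) ≤ Bb * d0) (hB0 : 0 ≤ Bb)
    (hCB : CB = K + (CK + 1 + Kb * (4 * C ^ 2)) * C + 2 * (CK + Kb * (4 * C)) * C + C * (CK + 2 * Kb) + Bb * (4 * C ^ 2))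
    (hc0 : 0 ≤ c0) (hc1 : c0 ≤ 1) (hfin : n * (C * c0 / 2) * (n * CB / 2) ^ (n - 1) < Real.exp (-A))
    (hpos : 0 < (u (z, t) - φ (z, t)) - (κ (z, t) + (c0 - Kb * nsq p (z, t))) * lft ρ (z, t) - Bb * lft ρ (z, t) ^ 2) :
    ∃ a h : En n → ℝ, HasJet (fun q => (u q - φ q) - (κ q + (c0 - Kb * nsq p q)) * lft ρ q - Bb * lft ρ q ^ 2) (z, t) a h ∧
      ((∀ v, a (sx v) = 0) → (∀ v, h (sx v) ≤ 0) → False) := by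
  have D := P.D
  have hC := D.hC
  have hK := P.hK
  have htI : t ∈ Ioo (0:ℝ) T := ⟨by linarith [ht.1], ht.2⟩
  have hq : (z, t) ∈ Ω ×ˢ Ioo (0:ℝ) T := ⟨hz, htI⟩
  have hQ := P.S.op
  have hzO := D.sub hz
  have hCK0 : 0 ≤ CK := hCK.nonneg hq
  have Ju := HasJet.of_smooth hQ P.S.su hq
  have Jφ := HasJet.of_smooth hQ P.C4.o0.sm hq
  have Jκ := HasJet.of_smooth hQ hCK.sm hq
  have Jρ := HasJet.of_cd (P.smρ hq)
  refine ⟨_, _, ((Ju.sub Jφ).sub ((Jκ.add ((HasJet.const c0 _).sub ((nsq_jet p _).const_mul Kb))).mul Jρ)).sub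
    (Jρ.sq.const_mul Bb), fun _ hh => ?_⟩
  have hρ : ρ z < 0 := D.neg hz
  have hρC : |ρ z| ≤ C := P.ρ_lb hzO
  have el : lft ρ (z, t) = ρ z := rfl
  have em : nsq p (z, t) = ‖z - p‖ ^ 2 := rfl
  rw [el, em] at hpos
  have key : ∀ v, D2 u (z, t) v v ≤ D2 φ (z, t) v v + (κ (z, t) + (c0 - Kb * ‖z - p‖ ^ 2)) * D2 (lft ρ) (z, t) v v
      + 2 * (dd (sx v) κ (z, t) - Kb * (2 * (inner ℂ (z - p) v).re)) * dd (sx v) (lft ρ) (z, t)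
      + ρ z * (D2 κ (z, t) v v - Kb * (2 * ‖v‖ ^ 2))
      + Bb * (2 * ρ z * D2 (lft ρ) (z, t) v v + 2 * dd (sx v) (lft ρ) (z, t) ^ 2) := by
    intro v
    have h := hh v
    have h' : (D2 u (z, t) v v - D2 φ (z, t) v v) - ((κ (z, t) + (c0 - Kb * ‖z - p‖ ^ 2)) * D2 (lft ρ) (z, t) v v
      + ρ z * (D2 κ (z, t) v v + (0 - Kb * (2 * ‖v‖ ^ 2)))
      + 2 * (dd (sx v) κ (z, t) + (0 - Kb * (2 * (inner ℂ (z - p) v).re))) * dd (sx v) (lft ρ) (z, t))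
      - Bb * (2 * ρ z * D2 (lft ρ) (z, t) v v + 2 * dd (sx v) (lft ρ) (z, t) ^ 2) ≤ 0 := h
    linarith
  clear hh
  have hκ0 := hCK.b0 _ hq
  have hz2 : ‖z - p‖ ≤ 2 * C := by
    have h1 := D.bz z hzO
    have h2 := D.bz p (D.cl_sub hpc)
    have := norm_sub_le z p
    linarith
  have hm4 : ‖z - p‖ ^ 2 ≤ 4 * C ^ 2 := by
    have := pow_le_pow_left₀ (norm_nonneg _) hz2 2
    linarith
  have hb1 : ∀ v, |dd (sx v) (lft ρ) (z, t)| ≤ C * ‖v‖ := fun v => D.C4b.o0.b1 _ ⟨hzO, mem_univ _⟩ v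
  have hb2 : ∀ v, |D2 (lft ρ) (z, t) v v| ≤ C * ‖v‖ * ‖v‖ := fun v => D.C4b.o0.b2 _ ⟨hzO, mem_univ _⟩ v v
  -- general upper bound
  have ub : ∀ v, ‖v‖ = 1 → D2 u (z, t) v v ≤ CB := by
    intro v hv
    have k := key v
    have i1 := P.C4.o0.b2 _ hq v v
    have i2 := hb2 v
    have i3 := hCK.b1 _ hq v
    have i4 := hCK.b2 _ hq v v
    have i5 := hb1 v
    have i6 := re_inner_le (z - p) v
    rw [hv] at k i1 i2 i3 i4 i5 i6
    simp only [mul_one, one_pow] at k i1 i2 i3 i4 i5 i6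
    have j1 : (κ (z, t) + (c0 - Kb * ‖z - p‖ ^ 2)) * D2 (lft ρ) (z, t) v v ≤ (CK + 1 + Kb * (4 * C ^ 2)) * C := by
      refine (le_abs_self _).trans ?_
      rw [abs_mul]
      refine mul_le_mul ?_ i2 (abs_nonneg _) (by positivity)
      have a1 := abs_le.1 hκ0
      have a2 : Kb * ‖z - p‖ ^ 2 ≤ Kb * (4 * C ^ 2) := mul_le_mul_of_nonneg_left hm4 hKb
      have a3 : 0 ≤ Kb * ‖z - p‖ ^ 2 := by positivity
      rw [abs_le]; constructor <;> linarith
    have j2 : 2 * (dd (sx v) κ (z, t) - Kb * (2 * (inner ℂ (z - p) v).re)) * dd (sx v) (lft ρ) (z, t)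
        ≤ 2 * (CK + Kb * (4 * C)) * C := by
      refine (le_abs_self _).trans ?_
      rw [abs_mul]
      refine mul_le_mul ?_ i5 (abs_nonneg _) (by positivity)
      rw [abs_mul, abs_two]
      have a1 := abs_sub (dd (sx v) κ (z, t)) (Kb * (2 * (inner ℂ (z - p) v).re))
      rw [abs_mul Kb, abs_mul 2, abs_two, abs_of_nonneg hKb] at a1
      have a2 : Kb * (2 * |(inner ℂ (z - p) v).re|) ≤ Kb * (4 * C) := mul_le_mul_of_nonneg_left (by linarith) hKb
      linarith
    have j3 : ρ z * (D2 κ (z, t) v v - Kb * 2) ≤ C * (CK + 2 * Kb) := by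
      refine (le_abs_self _).trans ?_
      rw [abs_mul]
      refine mul_le_mul hρC ?_ (abs_nonneg _) (by positivity)
      have a1 := abs_le.1 i4
      rw [abs_le]; constructor <;> linarith
    have j4 : Bb * (2 * ρ z * D2 (lft ρ) (z, t) v v + 2 * dd (sx v) (lft ρ) (z, t) ^ 2) ≤ Bb * (4 * C ^ 2) := by
      refine mul_le_mul_of_nonneg_left ?_ hB0
      have a1 : ρ z * D2 (lft ρ) (z, t) v v ≤ C * C := by
        refine (le_abs_self _).trans ?_
        rw [abs_mul]
        exact mul_le_mul hρC i2 (abs_nonneg _) (by positivity)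
      have a2 : dd (sx v) (lft ρ) (z, t) ^ 2 ≤ C ^ 2 := by
        rw [← sq_abs]; exact pow_le_pow_left₀ (abs_nonneg _) i5 2
      linarith
    have := (abs_le.1 i1).2
    rw [hCB]; linarith
  -- the special direction
  set a1 := dd (sx ν) (lft ρ) (z, t) with ha1
  set a2 := dd (sx (I • ν)) (lft ρ) (z, t) with ha2
  set a3 := dd (sx ξ) (lft ρ) (z, t) with ha3
  set a4 := dd (sx (I • ξ)) (lft ρ) (z, t) with ha4
  have hle : ∀ v : Cn n, ‖v‖ ≤ 1 → |dd (sx v) (lft ρ) (z, t)| ≤ C := fun v hv =>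
    (hb1 v).trans (by have := mul_le_mul_of_nonneg_left hv (by linarith : (0:ℝ) ≤ C); linarith)
  have hzn : ‖zt a1 a2 a3 a4 ξ ν‖ ≤ 4 * C := zt_norm hξ hν (hle ν hν) (hle (I • ν) (by rwa [norm_I_smul'])) (hle ξ hξ) (hle (I • ξ) (by rwa [norm_I_smul']))
  obtain ⟨hzt1, hzt2⟩ := zt_tan (D1 (lft ρ) (z, t)) ξ ν
  have hzt1' : dd (sx (zt a1 a2 a3 a4 ξ ν)) (lft ρ) (z, t) = 0 := hzt1
  have hzt2' : dd (sx (I • zt a1 a2 a3 a4 ξ ν)) (lft ρ) (z, t) = 0 := hzt2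
  have eN : hf (D2 φ (z, t)) (zt a1 a2 a3 a4 ξ ν) (zt a1 a2 a3 a4 ξ ν) = Nf ρ (fun v w p => D2 φ p v w) ξ ν (z, t) :=
    Qn_eq (D2_bil (smooth_at2 hQ P.C4.o0.sm hq)) _ _ _ _ _ _
  have eD : hf (D2 (lft ρ) (z, t)) (zt a1 a2 a3 a4 ξ ν) (zt a1 a2 a3 a4 ξ ν)
      = Nf ρ (fun v w p => D2 (lft ρ) p v w) ξ ν (z, t) :=
    Qn_eq (D2_bil (P.smρ hq)) _ _ _ _ _ _
  have eκ : κ (z, t) = -(1 / d ^ 2) * (Nf ρ (fun v w p => D2 φ p v w) ξ ν (z, t) *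
      (2 * d + (-1) * Nf ρ (fun v w p => D2 (lft ρ) p v w) ξ ν (z, t))) := by rw [hκ]
  generalize zt a1 a2 a3 a4 ξ ν = ζ at hzn hzt1' hzt2' eN eD
  generalize Nf ρ (fun v w p => D2 φ p v w) ξ ν (z, t) = N at hN eN eκ
  generalize Nf ρ (fun v w p => D2 (lft ρ) p v w) ξ ν (z, t) = Dd at hcl eD eκ
  -- closeness
  have hx : ‖z - p‖ < r0 := by
    by_contra hcon
    push Not at hcon
    have h1 := (abs_le.1 (EE.bb z hz t ht)).2
    have h2 : Kb * r0 ^ 2 ≤ Kb * ‖z - p‖ ^ 2 :=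
      mul_le_mul_of_nonneg_left (pow_le_pow_left₀ hr0.le hcon 2) hKb
    have h3 := (abs_le.1 hκ0).2
    have h4 : (A + κ (z, t) + c0 - Kb * ‖z - p‖ ^ 2) * (- ρ z) ≤ 0 :=
      mul_nonpos_of_nonpos_of_nonneg (by linarith) (by linarith)
    have h5 : 0 ≤ Bb * ρ z ^ 2 := by positivity
    linarith
  have hDd := hcl hx
  have hDlow : d0 / 2 ≤ Dd := by
    have h1 : Cd * ‖z - p‖ ≤ Cd * r0 := mul_le_mul_of_nonneg_left hx.le hCd
    have := (abs_le.1 hDd).1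
    linarith
  have hz16 : ‖ζ‖ ^ 2 ≤ 16 * C ^ 2 := by
    have := pow_le_pow_left₀ (norm_nonneg _) hzn 2
    linarith
  have hHκ : |hf (D2 κ (z, t)) ζ ζ| ≤ 2 * CK * ‖ζ‖ ^ 2 := by
    unfold hf
    have i1 := hCK.b2 _ hq ζ ζ
    have i2 := hCK.b2 _ hq (I • ζ) (I • ζ)
    rw [norm_I_smul'] at i2
    refine (abs_add_le _ _).trans ?_
    linarith
  have tp := tan_pt (c0 := c0) (m := ‖z - p‖ ^ 2) (r := - ρ z) (z2 := ‖ζ‖ ^ 2) eκ hN rfl (norm_nonneg _) hDd hd0 hd hDlow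
    (by linarith) hHκ (by positivity) hz16 hCK0 hKb hK1 hB hB0
  have k1 := key ζ
  have k2 := key (I • ζ)
  rw [hzt1'] at k1
  rw [hzt2', norm_I_smul'] at k2
  have hfu : hf (D2 u (z, t)) ζ ζ ≤ c0 * Dd := by
    refine le_trans ?_ tp
    rw [← eN, ← eD]
    unfold hf
    linarith
  have hDz : Dd ≤ 2 * C * ‖ζ‖ ^ 2 := by
    rw [← eD]
    unfold hf
    have i1 := (abs_le.1 (hb2 ζ)).2
    have i2 := (abs_le.1 (hb2 (I • ζ))).2
    rw [norm_I_smul'] at i2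
    linarith
  have hζ : ζ ≠ 0 := by
    intro h0
    rw [h0, norm_zero] at hDz
    norm_num at hDz
    linarith
  have bu := D2_bil (smooth_at2 hQ P.S.su hq)
  have hqf : qf (hMat (D2 u (z, t))) ζ ≤ (C * c0 / 2) * ‖ζ‖ ^ 2 := by
    rw [qf_hMat bu]
    have := mul_le_mul_of_nonneg_left hDz hc0
    linarith
  have htr : (hMat (D2 u (z, t))).trace.re ≤ n * CB / 2 := by
    rw [trace_hMat]
    have hs1 : ∀ α ∈ (Finset.univ : Finset (Fin n)), (D2 u (z, t) (cvec n α 1) (cvec n α 1) + D2 u (z, t) (cvec n α I) (cvec n α I)) ≤ 2 * CB := by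
      intro α _
      have e1 : ‖cvec n α 1‖ = 1 := by simp [cvec]
      have e2 : ‖cvec n α I‖ = 1 := by simp [cvec]
      have := ub _ e1
      have := ub _ e2
      linarith
    have := Finset.sum_le_card_nsmul _ _ _ hs1
    simp only [Finset.card_univ, Fintype.card_fin, nsmul_eq_mul] at this
    linarith
  have hdet := det_le_of_dir (P.S.pos _ hq) hζ hqf htr
  have := (P.det_bd hs EE.e2 hz ht).1
  linarith

end Tan2

section Tan3

variable {Ω O : Set (Cn n)} {ρ : Cn n → ℝ} {δ c C T K : ℝ} {u F φ : En n → ℝ}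

theorem CN_nonneg {C K : ℝ} (hC : 0 ≤ C) (hK : 0 ≤ K) : 0 ≤ CN C K := by
  unfold CN; positivity

theorem Nf_lip (D : Dom Ω ρ O δ c C) {ξ ν p z : Cn n} (t : ℝ) (hξ : ‖ξ‖ ≤ 1) (hν : ‖ν‖ ≤ 1) (hp : p ∈ closure Ω)
    (hz : ‖z - p‖ < δ) :
    |Nf ρ (fun v w p => D2 (lft ρ) p v w) ξ ν (z, t) - Nf ρ (fun v w p => D2 (lft ρ) p v w) ξ ν (p, t)|
      ≤ CN C C * ‖z - p‖ := by
  have hC := D.hC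
  have h := Nf_C2b D (D.opO.prod isOpen_univ) le_rfl (by linarith) D.C4b hξ hν
  have hd : ∀ y ∈ Metric.ball p δ, DifferentiableAt ℝ (Nf ρ (fun v w p => D2 (lft ρ) p v w) ξ ν) (y, t) := fun y hy =>
    smooth_diff (D.opO.prod isOpen_univ) h.sm ⟨D.ball p hp hy, mem_univ _⟩
  have h1 : ‖(fun w => Nf ρ (fun v w p => D2 (lft ρ) p v w) ξ ν (w, t)) z
      - (fun w => Nf ρ (fun v w p => D2 (lft ρ) p v w) ξ ν (w, t)) p‖ ≤ CN C C * ‖z - p‖ := by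
    refine (convex_ball p δ).norm_image_sub_le_of_norm_fderiv_le (𝕜 := ℝ)
      (f := fun w => Nf ρ (fun v w p => D2 (lft ρ) p v w) ξ ν (w, t)) (fun y hy => ?_) (fun y hy => ?_)
      (mem_ball_self D.hδ) (by rwa [mem_ball_iff_norm])
    · have hl : DifferentiableAt ℝ (fun w : Cn n => ((w, t) : En n)) y :=
        differentiableAt_id.prodMk (differentiableAt_const t)
      exact DifferentiableAt.comp (g := Nf ρ (fun v w p => D2 (lft ρ) p v w) ξ ν) y (hd y hy) hl
    · refine ContinuousLinearMap.opNorm_le_bound _ (CN_nonneg (by linarith) (by linarith)) fun w => ?_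
      have e := dd_slice (hd y hy) w
      have := h.b1 (y, t) ⟨D.ball p hp hy, mem_univ _⟩ w
      rw [← e] at this
      exact this
  exact h1

theorem Nf_cont (D : Dom Ω ρ O δ c C) {B : Cn n → Cn n → En n → ℝ} {J : Set ℝ} (hB : ∀ v w, ContinuousOn (B v w) (closure Ω ×ˢ J))
    (ξ ν : Cn n) : ContinuousOn (Nf ρ B ξ ν) (closure Ω ×ˢ J) := by
  have a : ∀ v : Cn n, ContinuousOn (dd (sx v) (lft ρ)) (closure Ω ×ˢ J) := fun v =>
    (D.C4b.o1 v).sm.continuousOn.mono (prod_mono D.cl_sub (subset_univ _))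
  have hh : ∀ v w : Cn n, ContinuousOn (fun p => hf (fun v w => B v w p) v w) (closure Ω ×ˢ J) := fun v w =>
    (hB v w).add (hB (I • v) (I • w))
  have a1 := a ν
  have a2 := a (I • ν)
  have a3 := a ξ
  have a4 := a (I • ξ)
  exact ((((a1.mul a1).add (a2.mul a2)).mul (hh ξ ξ)).add (((a3.mul a3).add (a4.mul a4)).mul (hh ν ν))).add
    (continuousOn_const.mul ((((a1.mul a3).add (a2.mul a4)).mul (hh ξ ν)).add
      (((a2.mul a3).add (continuousOn_const.mul (a1.mul a4))).mul (hh ξ (I • ν)))))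

theorem Nf_at (D : Dom Ω ρ O δ c C) {B : Cn n → Cn n → En n → ℝ} {p ν ξ : Cn n} {γ : ℝ} (t : ℝ) (hp : p ∈ frontier Ω) (hν : ‖ν‖ = 1)
    (hg : ∀ x, dd x ρ p = γ * (inner ℂ ν x).re) (h0 : inner ℂ ν ξ = 0) :
    Nf ρ B ξ ν (p, t) = γ ^ 2 * hf (fun v w => B v w (p, t)) ξ ξ := by
  have hpO : p ∈ O := D.cl_sub (frontier_subset_closure hp)
  have e : ∀ v, dd (sx v) (lft ρ) (p, t) = dd v ρ p := fun v => D.dd_lft (p := (p, t)) hpO v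
  have e3 : dd ξ ρ p = 0 := by rw [hg, h0]; simp
  have e4 : dd (I • ξ) ρ p = 0 := by rw [hg, inner_smul_right, h0]; simp
  unfold Nf Qn
  rw [e, e, e, e, D.nn hν hg, D.tan_J hg, e3, e4]
  ring

end Tan3

/-! ### The tangential lower bound -/

section Tan4

variable {Ω O : Set (Cn n)} {ρ : Cn n → ℝ} {δ c C T K : ℝ} {u F φ : En n → ℝ}

theorem tan_consts (n : ℕ) {A CK Cd Cm d0 C K δ : ℝ} (hA : 1 ≤ A) (hCK : 0 ≤ CK) (hCd : 0 ≤ Cd) (hCm : 0 ≤ Cm)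
    (hd0 : 0 < d0) (hC : 1 ≤ C) (hK : 1 ≤ K) (hδ : 0 < δ) : ∃ r0 Kb Bb CB c0 : ℝ, 0 < r0 ∧ r0 ≤ δ ∧ 0 ≤ Kb ∧
    A + CK + 1 ≤ Kb * r0 ^ 2 ∧ Cd * r0 ≤ d0 / 2 ∧ Cm * Cd ^ 2 / d0 ^ 2 ≤ Kb * (d0 / 2) ∧
    (2 * CK + 4 * Kb) * (16 * C ^ 2) ≤ Bb * d0 ∧ 0 ≤ Bb ∧
    CB = K + (CK + 1 + Kb * (4 * C ^ 2)) * C + 2 * (CK + Kb * (4 * C)) * C + C * (CK + 2 * Kb) + Bb * (4 * C ^ 2) ∧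
    0 < c0 ∧ c0 ≤ 1 ∧ n * (C * c0 / 2) * (n * CB / 2) ^ (n - 1) < Real.exp (-A) := by
  have hr : 0 < min δ (d0 / (2 * (Cd + 1))) := lt_min hδ (by positivity)
  obtain ⟨r0, hr0, hrδ, hrd⟩ : ∃ r0 : ℝ, 0 < r0 ∧ r0 ≤ δ ∧ r0 ≤ d0 / (2 * (Cd + 1)) :=
    ⟨_, hr, min_le_left _ _, min_le_right _ _⟩
  obtain ⟨Kb, hKb⟩ : ∃ Kb, Kb = (A + CK + 1) / r0 ^ 2 + Cm * Cd ^ 2 / d0 ^ 2 * (2 / d0) := ⟨_, rfl⟩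
  have hKb0 : 0 ≤ Kb := by rw [hKb]; positivity
  obtain ⟨Bb, hBb⟩ : ∃ Bb, Bb = (2 * CK + 4 * Kb) * (16 * C ^ 2) / d0 := ⟨_, rfl⟩
  have hBb0 : 0 ≤ Bb := by rw [hBb]; positivity
  obtain ⟨CB, hCB⟩ : ∃ CB, CB = K + (CK + 1 + Kb * (4 * C ^ 2)) * C + 2 * (CK + Kb * (4 * C)) * C + C * (CK + 2 * Kb) + Bb * (4 * C ^ 2) := ⟨_, rfl⟩
  have hCB0 : 0 ≤ CB := by rw [hCB]; positivity
  obtain ⟨X, hX⟩ : ∃ X : ℝ, X = n * (C / 2) * (n * CB / 2) ^ (n - 1) := ⟨_, rfl⟩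
  have hX0 : 0 ≤ X := by rw [hX]; positivity
  have he := Real.exp_pos (-A)
  have hc : 0 < min 1 (Real.exp (-A) / (X + 1)) := lt_min one_pos (by positivity)
  obtain ⟨c0, hc0, hc1, hc2⟩ : ∃ c0 : ℝ, 0 < c0 ∧ c0 ≤ 1 ∧ c0 ≤ Real.exp (-A) / (X + 1) :=
    ⟨_, hc, min_le_left _ _, min_le_right _ _⟩
  refine ⟨r0, Kb, Bb, CB, c0, hr0, hrδ, hKb0, ?_, ?_, ?_, ?_, hBb0, hCB, hc0, hc1, ?_⟩
  · have : (A + CK + 1) / r0 ^ 2 ≤ Kb := by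
      rw [hKb]
      have : 0 ≤ Cm * Cd ^ 2 / d0 ^ 2 * (2 / d0) := by positivity
      linarith
    rwa [div_le_iff₀ (by positivity)] at this
  · rw [le_div_iff₀ (by positivity)] at hrd
    nlinarith
  · have h1 : Cm * Cd ^ 2 / d0 ^ 2 * (2 / d0) ≤ Kb := by
      rw [hKb]
      have : 0 ≤ (A + CK + 1) / r0 ^ 2 := by positivity
      linarith
    have h2 := mul_le_mul_of_nonneg_right h1 (by positivity : 0 ≤ d0 / 2)
    refine le_trans (le_of_eq ?_) h2
    field_simp
  · rw [hBb]
    apply le_of_eq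
    field_simp
  · rw [le_div_iff₀ (by positivity)] at hc2
    have : (n:ℝ) * (C * c0 / 2) * (n * CB / 2) ^ (n - 1) = c0 * X := by rw [hX]; ring
    rw [this]
    linarith

theorem kap_C2b (D : Dom Ω ρ O δ c C) (hK : 0 ≤ K) (C4 : C4b (Ω ×ˢ Ioo (0:ℝ) T) K φ) {ξ ν : Cn n} (hξ : ‖ξ‖ ≤ 1) (hν : ‖ν‖ ≤ 1)
    {d d0 : ℝ} (hd0 : 0 < d0) (hd : d0 ≤ d) (hdC : d ≤ CN C C) :
    C2b (Ω ×ˢ Ioo (0:ℝ) T) (4 * (1 / d0 ^ 2 * (4 * (CN C K * (2 * CN C C + 4 * (1 * CN C C))))))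
      (fun q => -(1 / d ^ 2) * (Nf ρ (fun v w p => D2 φ p v w) ξ ν q *
      (2 * d + (-1) * Nf ρ (fun v w p => D2 (lft ρ) p v w) ξ ν q))) := by
  have hC := D.hC
  have hQ : IsOpen (Ω ×ˢ Ioo (0:ℝ) T) := D.op.prod isOpen_Ioo
  have hQO : Ω ×ˢ Ioo (0:ℝ) T ⊆ O ×ˢ (univ : Set ℝ) := prod_mono D.sub (subset_univ _)
  have h1 := Nf_C2b D hQ hQO hK C4 hξ hν
  have h2 := Nf_C2b D hQ hQO (by linarith) (D.C4b.mono hQO le_rfl) hξ hν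
  have h3 := ((C2b.const (Ω ×ˢ Ioo (0:ℝ) T) (2 * d)).add hQ ((C2b.const (Ω ×ˢ Ioo (0:ℝ) T) (-1)).mul hQ h2))
  have h4 := (C2b.const (Ω ×ˢ Ioo (0:ℝ) T) (-(1 / d ^ 2))).mul hQ (h1.mul hQ h3)
  have n1 := CN_nonneg (C := C) (K := K) (by linarith) hK
  have n2 := CN_nonneg (C := C) (K := C) (by linarith) (by linarith)
  refine h4.mono le_rfl ?_
  have e1 : |-(1 / d ^ 2)| ≤ 1 / d0 ^ 2 := by
    rw [abs_neg, abs_of_nonneg (by positivity)]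
    gcongr
  have e2 : |2 * d| ≤ 2 * CN C C := by
    rw [abs_of_nonneg (by linarith)]
    linarith
  have e3 : |(-1:ℝ)| = 1 := by norm_num
  rw [e3]
  gcongr

theorem est_tan (D : Dom Ω ρ O δ c C) (hK : 1 ≤ K) {s A : ℝ} (hs : 0 < s) (hA : 1 ≤ A) : ∃ c0 : ℝ, 0 < c0 ∧
    ∀ u F φ, Pk Ω ρ O δ c C T K u F φ → E3 Ω ρ T s A u F φ → ∀ u1 u2 ut k1 k2 kt, Reg Ω T u u1 u2 ut →
    Reg Ω T φ k1 k2 kt → ∀ p ∈ frontier Ω, ∀ (ν ξ : Cn n) (γ : ℝ), ‖ν‖ = 1 → c ≤ γ →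
    (∀ x, dd x ρ p = γ * (inner ℂ ν x).re) → inner ℂ ν ξ = 0 → ‖ξ‖ = 1 → ∀ t ∈ Ico s T,
    c0 ≤ hf (fun v w => u2 v w (p, t)) ξ ξ := by
  have hC := D.hC
  have hc := D.hc
  have n1 := CN_nonneg (C := C) (K := K) (by linarith) (by linarith)
  have n2 := CN_nonneg (C := C) (K := C) (by linarith) (by linarith)
  obtain ⟨d0, hd0e⟩ : ∃ d0, d0 = 4 * c ^ 3 := ⟨_, rfl⟩
  have hd0 : 0 < d0 := by rw [hd0e]; positivity
  obtain ⟨CK, hCKe⟩ : ∃ CK, CK = 4 * (1 / d0 ^ 2 * (4 * (CN C K * (2 * CN C C + 4 * (1 * CN C C))))) := ⟨_, rfl⟩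
  have hCK : 0 ≤ CK := by rw [hCKe]; positivity
  obtain ⟨r0, Kb, Bb, CB, c0, hr0, hrδ, hKb, hKr, hCdr, hK1, hB, hB0, hCB, hc0, hc1, hfin⟩ :=
    tan_consts n hA hCK n2 n1 hd0 hC hK D.hδ
  refine ⟨4 * c * c0, by positivity, ?_⟩
  intro u F φ P EE u1 u2 ut k1 k2 kt Ru Rk p hp ν ξ γ hν hγ hg h0 hξ t ht
  have hpc : p ∈ closure Ω := frontier_subset_closure hp
  have hpO : p ∈ O := D.cl_sub hpc
  have ht0 : t ∈ Ioo (0:ℝ) T := ⟨lt_of_lt_of_le hs ht.1, ht.2⟩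
  have ht0' : t ∈ Ico (0:ℝ) T := ⟨ht0.1.le, ht.2⟩
  have R := Ru.sub D.op Rk
  obtain ⟨H, hH⟩ : ∃ H, H = hf (D2 (lft ρ) (p, t)) ξ ξ := ⟨_, rfl⟩
  have hH4 : 4 * c ≤ H := by
    have := D.psh' (p := (p, t)) hpO ξ
    rw [hξ] at this
    rw [hH]; linarith
  obtain ⟨M, hM⟩ : ∃ M, M = hf (fun v w => k2 v w (p, t)) ξ ξ := ⟨_, rfl⟩
  have hγ0 : 0 < γ := lt_of_lt_of_le hc hγ
  obtain ⟨d, hd⟩ : ∃ d, d = Nf ρ (fun v w p => D2 (lft ρ) p v w) ξ ν (p, t) := ⟨_, rfl⟩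
  have hd' : d = γ ^ 2 * H := by rw [hd, hH]; exact Nf_at D t hp hν hg h0
  have hNk : Nf ρ k2 ξ ν (p, t) = γ ^ 2 * M := by rw [hM]; exact Nf_at D t hp hν hg h0
  have hdd0 : d0 ≤ d := by
    rw [hd0e, hd']
    calc 4 * c ^ 3 = c ^ 2 * (4 * c) := by ring
      _ ≤ γ ^ 2 * H := by gcongr
  have hdC : d ≤ CN C C := by
    have h := Nf_C2b D (D.opO.prod isOpen_univ) le_rfl (by linarith) D.C4b hξ.le hν.le
    have := h.b0 (p, t) ⟨hpO, mem_univ _⟩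
    rw [← hd] at this
    exact (le_abs_self d).trans this
  obtain ⟨κ, hκ⟩ : ∃ κ : En n → ℝ, κ = fun q => -(1 / d ^ 2) * (Nf ρ (fun v w p => D2 φ p v w) ξ ν q *
      (2 * d + (-1) * Nf ρ (fun v w p => D2 (lft ρ) p v w) ξ ν q)) := ⟨_, rfl⟩
  have hκC : C2b (Ω ×ˢ Ioo (0:ℝ) T) CK κ := by
    rw [hκ, hCKe]
    exact kap_C2b D (by linarith) P.C4 hξ.le hν.le hd0 hdd0 hdC
  obtain ⟨κe, hκe⟩ : ∃ κe : En n → ℝ, κe = fun q => -(1 / d ^ 2) * (Nf ρ k2 ξ ν q *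
      (2 * d + (-1) * Nf ρ (fun v w p => D2 (lft ρ) p v w) ξ ν q)) := ⟨_, rfl⟩
  have hκκ : ∀ q ∈ Ω ×ˢ Ioo (0:ℝ) T, κe q = κ q := by
    intro q hq
    have : Nf ρ k2 ξ ν q = Nf ρ (fun v w p => D2 φ p v w) ξ ν q := by
      have e : (fun v w => k2 v w q) = fun v w => D2 φ q v w := by
        funext v w
        exact Rk.i2 v w q hq
      unfold Nf
      rw [e]
    simp only [hκe, hκ, this]
  have hκc : ContinuousOn κe (closure Ω ×ˢ Ioo (0:ℝ) T) := by
    have a1 := Nf_cont D Rk.c2 ξ ν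
    have a2 := Nf_cont D (B := fun v w p => D2 (lft ρ) p v w) (J := Ioo (0:ℝ) T)
      (fun v w => (D.C4b.o2 v w).sm.continuousOn.mono (prod_mono D.cl_sub (subset_univ _))) ξ ν
    rw [hκe]
    exact continuousOn_const.mul (a1.mul (continuousOn_const.add (continuousOn_const.mul a2)))
  have hsl : ∀ J : Set ℝ, t ∈ J → MapsTo (fun z : Cn n => ((z, t) : En n)) (closure Ω) (closure Ω ×ˢ J) :=
    fun J hJ z hz => ⟨hz, hJ⟩
  have hslc : ContinuousOn (fun z : Cn n => ((z, t) : En n)) (closure Ω) :=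
    (continuous_id.prodMk continuous_const).continuousOn
  have hκs : ContinuousOn (fun z => κe (z, t)) (closure Ω) := hκc.comp hslc (hsl _ ht0)
  have hws : ContinuousOn (fun z => u (z, t) - φ (z, t)) (closure Ω) := R.c0.comp hslc (hsl _ ht0')
  have hρs : ContinuousOn ρ (closure Ω) := D.sm.continuousOn.mono D.cl_sub
  have hns : ContinuousOn (fun z : Cn n => nsq p (z, t)) (closure Ω) := by
    unfold nsq
    fun_prop
  obtain ⟨f, hf'⟩ : ∃ f : Cn n → ℝ, f = fun z => κe (z, t) + (c0 - Kb * nsq p (z, t)) + Bb * ρ z := ⟨_, rfl⟩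
  have hfc : ContinuousOn f (closure Ω) := by
    rw [hf']
    exact (hκs.add (continuousOn_const.sub (continuousOn_const.mul hns))).add (continuousOn_const.mul hρs)
  have hgc : ContinuousOn (fun z => (u (z, t) - φ (z, t)) - f z * ρ z) (closure Ω) := hws.sub (hfc.mul hρs)
  have hbd0 : ∀ z ∈ frontier Ω, (u (z, t) - φ (z, t)) - f z * ρ z = 0 := by
    intro z hz
    rw [P.bd z hz t ht0', D.fr z hz]; ring
  have key : ∀ z ∈ Ω ∩ univ, (fun q : En n => (u q - φ q) - (κ q + (c0 - Kb * nsq p q)) * lft ρ q - Bb * lft ρ q ^ 2) (z, t) ≤ 0 := by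
    refine elliptic_max D.op D.bd isOpen_univ (t := t)
      (g := fun q : En n => (u q - φ q) - (κ q + (c0 - Kb * nsq p q)) * lft ρ q - Bb * lft ρ q ^ 2) (gh := fun z => (u (z, t) - φ (z, t)) - f z * ρ z) ?_ ?_ ?_ ?_ ?_
    · exact hgc.mono inter_subset_left
    · intro z hz
      have := hκκ (z, t) ⟨hz.1, ht0⟩
      simp only [hf', this, lft]
      ring
    · intro z hz _
      exact (hbd0 z hz).le
    · intro z _ hz2
      simp at hz2
    · intro z hz hpos
      have hz' := hz.1
      have hN : |Nf ρ (fun v w p => D2 φ p v w) ξ ν (z, t)| ≤ CN C K := by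
        have hQ : IsOpen (Ω ×ˢ Ioo (0:ℝ) T) := D.op.prod isOpen_Ioo
        have hQO : Ω ×ˢ Ioo (0:ℝ) T ⊆ O ×ˢ (univ : Set ℝ) := prod_mono D.sub (subset_univ _)
        exact (Nf_C2b D hQ hQO (by linarith) P.C4 hξ.le hν.le).b0 (z, t) ⟨hz', ht0⟩
      have hcl : ‖z - p‖ < r0 → |Nf ρ (fun v w p => D2 (lft ρ) p v w) ξ ν (z, t) - d| ≤ CN C C * ‖z - p‖ := by
        intro h
        rw [hd]
        exact Nf_lip D t hξ.le hν.le hpc (lt_of_lt_of_le h hrδ)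
      exact P.tan_touch hs hA EE hz' ht hpc hν.le hξ.le hd0 hdd0 hr0 hκ hN hκC hKb hKr hcl n2 hCdr hK1 hB hB0 hCB hc0.le
        hc1 hfin hpos
  obtain ⟨b, hbA, hb1, hb2⟩ := P.tan2 hs EE.bb R hp ht
  obtain ⟨L, hL, hLd⟩ := R.f1 (p, t) ⟨hpc, ht0⟩
  have hLd' : HasFDerivWithinAt (fun z => u (z, t) - φ (z, t)) L (closure Ω) p := hLd
  have hG := hLd'.sub (has_mul_zero (hfc p hpc) (D.hasF hpc) (D.fr p hp))
  have hx : dd (-ν) ρ p < 0 := by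
    have : dd (-ν) ρ p = - dd ν ρ p := by simp [dd]
    rw [this, D.nn hν hg]; linarith
  have hin := D.inward_deriv hp hx hG (fun z hz => by
    have h1 := key z ⟨hz, mem_univ _⟩
    have h2 := hbd0 p hp
    have h3 := hκκ (z, t) ⟨hz, ht0⟩
    have h1' : (u (z, t) - φ (z, t)) - (κ (z, t) + (c0 - Kb * nsq p (z, t))) * ρ z - Bb * ρ z ^ 2 ≤ 0 := h1
    change (u (z, t) - φ (z, t)) - f z * ρ z ≤ (u (p, t) - φ (p, t)) - f p * ρ p
    rw [h2, hf']
    simp only [h3]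
    refine le_trans (le_of_eq ?_) h1'
    ring)
  have hfp : f p = -(M / H) + c0 := by
    have hH0 : H ≠ 0 := by intro h; rw [h] at hH4; linarith
    have hn0 : nsq p (p, t) = 0 := by simp [nsq]
    simp only [hf', hκe, hNk, ← hd, hn0, D.fr p hp]
    rw [hd']
    field_simp
    ring
  have hin' : - (b * γ) + f p * γ ≤ 0 := by
    have e1 : L (-ν) = - (b * γ) := by
      rw [map_neg, hL]
      have := hb1 ν
      rw [D.nn hν hg] at this
      rw [← this]
    have e2 : (fderiv ℝ ρ p) (-ν) = -γ := by
      rw [map_neg]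
      have : fderiv ℝ ρ p ν = γ := D.nn hν hg
      rw [this]
    have : L (-ν) - f p * (fderiv ℝ ρ p) (-ν) ≤ 0 := hin
    rw [e1, e2] at this
    linarith
  have hb : f p ≤ b := by
    by_contra h
    push Not at h
    nlinarith
  have t1 : dd ξ ρ p = 0 := by rw [hg, h0]; simp
  have t2 : dd (I • ξ) ρ p = 0 := by rw [hg, inner_smul_right, h0]; simp
  have w1e := hb2 ξ ξ t1 t1
  have w2e := hb2 (I • ξ) (I • ξ) t2 t2
  have hfe : hf (fun v w => u2 v w (p, t)) ξ ξ = b * H + M := by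
    rw [hH, hM]
    unfold hf
    rw [D.D2_lft (p := (p, t)) hpO, D.D2_lft (p := (p, t)) hpO]
    have w1' : u2 ξ ξ (p, t) - k2 ξ ξ (p, t) = b * dd ξ (dd ξ ρ) p := w1e
    have w2' : u2 (I • ξ) (I • ξ) (p, t) - k2 (I • ξ) (I • ξ) (p, t) = b * dd (I • ξ) (dd (I • ξ) ρ) p := w2e
    simp only
    linarith
  rw [hfe]
  have hHpos : 0 < H := by linarith
  have h5 : f p * H ≤ b * H := mul_le_mul_of_nonneg_right hb hHpos.le
  have h6 : f p * H = - M + c0 * H := by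
    rw [hfp]; field_simp
  have h7 : c0 * (4 * c) ≤ c0 * H := mul_le_mul_of_nonneg_left hH4 hc0.le
  linarith

end Tan4

/-! ### Boundary bound for the trace -/

section Btrace

variable {Ω O : Set (Cn n)} {ρ : Cn n → ℝ} {δ c C T K : ℝ} {u F φ : En n → ℝ}

theorem IsBil.hf_J {B : Cn n → Cn n → ℝ} (h : IsBil B) (v w : Cn n) : hf B (I • v) w = - hf B v (I • w) := by
  unfold hf
  rw [I_smul_I, I_smul_I, h.smul, h.smulr]
  ring

theorem IsBil.hf_JJ {B : Cn n → Cn n → ℝ} (h : IsBil B) (v w : Cn n) : hf B (I • v) (I • w) = hf B v w := by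
  unfold hf
  rw [I_smul_I, I_smul_I, h.smul, h.smulr]
  ring

theorem IsBil.hf_self_J {B : Cn n → Cn n → ℝ} (h : IsBil B) (v : Cn n) : hf B v (I • v) = 0 := by
  unfold hf
  rw [I_smul_I, h.smulr, h.symm (I • v) v]
  ring

theorem IsBil.hfBil {B : Cn n → Cn n → ℝ} (h : IsBil B) : IsBil (hf B) where
  add v v' w := by unfold hf; rw [smul_add, h.add, h.add]; ring
  smul c v w := by unfold hf; rw [smul_comm, h.smul, h.smul]; ring
  symm v w := by unfold hf; rw [h.symm v w, h.symm (I • v)]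

theorem hf_decomp {B : Cn n → Cn n → ℝ} (h : IsBil B) (a b : ℝ) (ν ξ : Cn n) :
    hf B (a • ν + b • (I • ν) + ξ) (a • ν + b • (I • ν) + ξ)
      = (a ^ 2 + b ^ 2) * hf B ν ν + hf B ξ ξ + 2 * a * hf B ν ξ - 2 * b * hf B ν (I • ξ) := by
  have H := h.hfBil
  have e1 := h.hf_J ν ξ
  have e2 := h.hf_JJ ν ν
  have e3 := h.hf_self_J ν
  have e4 : hf B (I • ν) ν = 0 := by rw [H.symm, e3]
  have e5 : hf B ξ (I • ν) = hf B (I • ν) ξ := H.symm _ _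
  have e6 : hf B ξ ν = hf B ν ξ := H.symm _ _
  simp only [H.add, H.addr, H.smul, H.smulr]
  rw [e5, e6, e1, e2, e3, e4]
  ring

theorem decomp_ex {ν : Cn n} (hν : ‖ν‖ = 1) (x : Cn n) : ∃ (a b : ℝ) (ξ : Cn n), x = a • ν + b • (I • ν) + ξ ∧
    inner ℂ ν ξ = 0 ∧ ‖x‖ ^ 2 = a ^ 2 + b ^ 2 + ‖ξ‖ ^ 2 := by
  obtain ⟨α, hα⟩ : ∃ α : ℂ, α = inner ℂ ν x := ⟨_, rfl⟩
  have hin : inner ℂ ν (x - α • ν) = 0 := by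
    rw [inner_sub_right, inner_smul_right, inner_self_eq_norm_sq_to_K, hν, ← hα]
    simp
  have hs : α • ν = α.re • ν + α.im • (I • ν) := by
    conv_lhs => rw [← Complex.re_add_im α]
    rw [add_smul, mul_smul]
    rfl
  refine ⟨α.re, α.im, x - α • ν, ?_, hin, ?_⟩
  · rw [← hs]; abel
  · have h1 := norm_add_sq_eq_norm_sq_add_norm_sq_of_inner_eq_zero (𝕜 := ℂ) (α • ν) (x - α • ν) (by
      rw [inner_smul_left, hin, mul_zero])
    have h2 : α • ν + (x - α • ν) = x := by abel
    rw [h2, norm_smul, hν, mul_one] at h1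
    have h3 : ‖α‖ * ‖α‖ = α.re ^ 2 + α.im ^ 2 := by
      rw [Complex.norm_mul_self_eq_normSq, Complex.normSq_apply]; ring
    rw [h3] at h1
    rw [pow_two, h1]; ring

theorem norm_cvec_one (α : Fin n) : ‖cvec n α 1‖ = 1 := by
  simp [cvec]

theorem trace_alg (hn : 0 < n) {B : Cn n → Cn n → ℝ} (hB : IsBil B) {ν : Cn n} (hν : ‖ν‖ = 1) {c0 A1 A2 X : ℝ} (hc0 : 0 < c0)
    (hA1 : 0 ≤ A1) (hA2 : 0 ≤ A2) (hX : 0 ≤ X)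
    (hlow : ∀ ξ, inner ℂ ν ξ = 0 → c0 * ‖ξ‖ ^ 2 ≤ hf B ξ ξ) (hup : ∀ ξ, inner ℂ ν ξ = 0 → hf B ξ ξ ≤ A2 * ‖ξ‖ ^ 2)
    (hmix : ∀ ξ, inner ℂ ν ξ = 0 → |hf B ν ξ| ≤ A1 * ‖ξ‖) (hdet : (hMat B).det.re ≤ X) :
    ∑ α, (B (cvec n α 1) (cvec n α 1) + B (cvec n α I) (cvec n α I)) ≤
      4 * (n * (X * (n / (c0 / 8)) ^ (n - 1))) + n * (4 * A1 ^ 2 / c0 + c0 / 2 + A2 + 2 * A1) := by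
  obtain ⟨m0, hm0⟩ : ∃ m0, m0 = 4 * A1 ^ 2 / c0 + c0 / 2 := ⟨_, rfl⟩
  have hm0' : 0 ≤ m0 := by rw [hm0]; positivity
  rw [← hm0]
  have p1 : 0 ≤ 4 * (n * (X * (n / (c0 / 8)) ^ (n - 1))) := by positivity
  have p2 : 0 ≤ n * (m0 + A2 + 2 * A1) := by positivity
  have hJ : ∀ ξ : Cn n, inner ℂ ν ξ = 0 → inner ℂ ν (I • ξ) = 0 := fun ξ h => by rw [inner_smul_right, h, mul_zero]
  have hnJ : ∀ ξ : Cn n, ‖I • ξ‖ = ‖ξ‖ := fun ξ => by rw [norm_smul, Complex.norm_I, one_mul]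
  rcases le_total m0 (hf B ν ν) with hm | hm
  · have h1 : ∀ v : Cn n, c0 / 8 * ‖v‖ ^ 2 ≤ qf (hMat B) v := by
      intro v
      obtain ⟨a, b, ξ, rfl, hi, hnv⟩ := decomp_ex hν v
      rw [qf_hMat hB, hf_decomp hB, hnv]
      have l1 := hlow ξ hi
      have l2 := abs_le.1 (hmix ξ hi)
      have l3 := hmix (I • ξ) (hJ ξ hi)
      rw [hnJ] at l3
      have l2' := hmix ξ hi
      have q1 : -(2 * a * hf B ν ξ) ≤ 4 * A1 ^ 2 / c0 * a ^ 2 + c0 / 4 * ‖ξ‖ ^ 2 := by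
        have : |a * hf B ν ξ| ≤ |a| * (A1 * ‖ξ‖) := by rw [abs_mul]; gcongr
        have k := neg_abs_le (a * hf B ν ξ)
        have k2 : 2 * (|a| * (A1 * ‖ξ‖)) ≤ 4 * A1 ^ 2 / c0 * a ^ 2 + c0 / 4 * ‖ξ‖ ^ 2 := by
          have e : 4 * A1 ^ 2 / c0 * a ^ 2 + c0 / 4 * ‖ξ‖ ^ 2 - 2 * (|a| * (A1 * ‖ξ‖))
              = (2 * A1 * |a| - c0 / 2 * ‖ξ‖) ^ 2 / c0 := by
            rw [← sq_abs a]; field_simp; ring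
          have : 0 ≤ (2 * A1 * |a| - c0 / 2 * ‖ξ‖) ^ 2 / c0 := by positivity
          linarith
        linarith
      have q2 : 2 * b * hf B ν (I • ξ) ≤ 4 * A1 ^ 2 / c0 * b ^ 2 + c0 / 4 * ‖ξ‖ ^ 2 := by
        have : |b * hf B ν (I • ξ)| ≤ |b| * (A1 * ‖ξ‖) := by rw [abs_mul]; gcongr
        have k := le_abs_self (b * hf B ν (I • ξ))
        have k2 : 2 * (|b| * (A1 * ‖ξ‖)) ≤ 4 * A1 ^ 2 / c0 * b ^ 2 + c0 / 4 * ‖ξ‖ ^ 2 := by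
          have e : 4 * A1 ^ 2 / c0 * b ^ 2 + c0 / 4 * ‖ξ‖ ^ 2 - 2 * (|b| * (A1 * ‖ξ‖))
              = (2 * A1 * |b| - c0 / 2 * ‖ξ‖) ^ 2 / c0 := by
            rw [← sq_abs b]; field_simp; ring
          have : 0 ≤ (2 * A1 * |b| - c0 / 2 * ‖ξ‖) ^ 2 / c0 := by positivity
          linarith
        linarith
      have q3 : (a ^ 2 + b ^ 2) * m0 ≤ (a ^ 2 + b ^ 2) * hf B ν ν := mul_le_mul_of_nonneg_left hm (by positivity)
      have q4 : (a ^ 2 + b ^ 2) * m0 = 4 * A1 ^ 2 / c0 * a ^ 2 + 4 * A1 ^ 2 / c0 * b ^ 2 + c0 / 2 * (a ^ 2 + b ^ 2) := by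
        rw [hm0]; ring
      linarith
    have h2 := trace_le_of_lower (hMat B) (hMat_herm hB) (by positivity : 0 < c0 / 8) h1 hdet
    rw [trace_hMat] at h2
    linarith
  · have h1 : ∀ v : Cn n, hf B v v ≤ (m0 + A2 + 2 * A1) * ‖v‖ ^ 2 := by
      intro v
      obtain ⟨a, b, ξ, rfl, hi, hnv⟩ := decomp_ex hν v
      rw [hf_decomp hB, hnv]
      have l1 := hup ξ hi
      have l3 := hmix (I • ξ) (hJ ξ hi)
      rw [hnJ] at l3
      have l2 := hmix ξ hi
      have q1 : 2 * a * hf B ν ξ ≤ A1 * (a ^ 2 + ‖ξ‖ ^ 2) := by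
        have : |a * hf B ν ξ| ≤ |a| * (A1 * ‖ξ‖) := by rw [abs_mul]; gcongr
        have k := le_abs_self (a * hf B ν ξ)
        have k2 : A1 * (2 * |a| * ‖ξ‖) ≤ A1 * (a ^ 2 + ‖ξ‖ ^ 2) := by
          refine mul_le_mul_of_nonneg_left ?_ hA1
          rw [← sq_abs a]
          linarith [sq_nonneg (|a| - ‖ξ‖), two_mul_le_add_sq |a| ‖ξ‖]
        linarith
      have q2 : -(2 * b * hf B ν (I • ξ)) ≤ A1 * (b ^ 2 + ‖ξ‖ ^ 2) := by
        have : |b * hf B ν (I • ξ)| ≤ |b| * (A1 * ‖ξ‖) := by rw [abs_mul]; gcongr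
        have k := neg_abs_le (b * hf B ν (I • ξ))
        have k2 : A1 * (2 * |b| * ‖ξ‖) ≤ A1 * (b ^ 2 + ‖ξ‖ ^ 2) := by
          refine mul_le_mul_of_nonneg_left ?_ hA1
          rw [← sq_abs b]
          linarith [sq_nonneg (|b| - ‖ξ‖), two_mul_le_add_sq |b| ‖ξ‖]
        linarith
      have q3 : (a ^ 2 + b ^ 2) * hf B ν ν ≤ (a ^ 2 + b ^ 2) * m0 := mul_le_mul_of_nonneg_left hm (by positivity)
      have q5 : 0 ≤ A2 * (a ^ 2 + b ^ 2) + m0 * ‖ξ‖ ^ 2 + A1 * (a ^ 2 + b ^ 2) := by positivity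
      linarith
    have h2 : ∑ α, (B (cvec n α 1) (cvec n α 1) + B (cvec n α I) (cvec n α I)) ≤ ∑ _α : Fin n, (m0 + A2 + 2 * A1) := by
      refine Finset.sum_le_sum fun α _ => ?_
      have := h1 (cvec n α 1)
      rw [norm_cvec_one] at this
      unfold hf at this
      rw [smul_cvec, mul_one] at this
      linarith
    rw [Finset.sum_const, Finset.card_univ, Fintype.card_fin, nsmul_eq_mul] at h2
    linarith

theorem Reg.bil (hO : IsOpen Ω) {g : En n → ℝ} {g1 : Cn n → En n → ℝ} {g2 : Cn n → Cn n → En n → ℝ} {gt : En n → ℝ}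
    (R : Reg Ω T g g1 g2 gt) : ∀ q ∈ closure Ω ×ˢ Ioo (0:ℝ) T, IsBil (fun v w => g2 v w q) := by
  have hQ : IsOpen (Ω ×ˢ Ioo (0:ℝ) T) := hO.prod isOpen_Ioo
  have hb : ∀ q ∈ Ω ×ˢ Ioo (0:ℝ) T, IsBil (D2 g q) := fun q hq => D2_bil (smooth_at2 hQ R.sm hq)
  have ext : ∀ {f k : En n → ℝ}, ContinuousOn f (closure Ω ×ˢ Ioo (0:ℝ) T) → ContinuousOn k (closure Ω ×ˢ Ioo (0:ℝ) T) →
      (∀ q ∈ Ω ×ˢ Ioo (0:ℝ) T, f q = k q) → ∀ q ∈ closure Ω ×ˢ Ioo (0:ℝ) T, f q = k q := by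
    intro f k hf hk h q hq
    exact le_antisymm (cl_le_Ioo hf hk (fun q hq => (h q hq).le) q hq) (cl_le_Ioo hk hf (fun q hq => (h q hq).ge) q hq)
  intro q hq
  constructor
  · intro v v' w
    refine ext (R.c2 _ _) ((R.c2 v w).add (R.c2 v' w)) (fun q hq => ?_) q hq
    simp only [R.i2 _ _ q hq, (hb q hq).add, Pi.add_apply]
  · intro a v w
    refine ext (R.c2 _ _) (continuousOn_const.mul (R.c2 v w)) (fun q hq => ?_) q hq
    simp only [R.i2 _ _ q hq, (hb q hq).smul, Pi.mul_apply]
  · intro v w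
    refine ext (R.c2 _ _) (R.c2 w v) (fun q hq => ?_) q hq
    simp only [R.i2 _ _ q hq]
    exact (hb q hq).symm v w

theorem Pk.det_cl (P : Pk Ω ρ O δ c C T K u F φ) {s A : ℝ} (hs : 0 < s) (EE : E2 Ω T s A u F) {u1 : Cn n → En n → ℝ}
    {u2 : Cn n → Cn n → En n → ℝ} {ut : En n → ℝ} (R : Reg Ω T u u1 u2 ut) {p : Cn n} (hp : p ∈ closure Ω) {t : ℝ}
    (ht : t ∈ Ico s T) : (hMat (fun v w => u2 v w (p, t))).det.re ≤ Real.exp A := by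
  have ht0 : t ∈ Ioo (0:ℝ) T := ⟨lt_of_lt_of_le hs ht.1, ht.2⟩
  have hc : ContinuousOn (fun q => (hMat (fun v w => u2 v w q)).det.re) (closure Ω ×ˢ ({t} : Set ℝ)) := by
    have hm : ContinuousOn (fun q => hMat (fun v w => u2 v w q)) (closure Ω ×ˢ ({t} : Set ℝ)) := by
      have c2 : ∀ v w, ContinuousOn (u2 v w) (closure Ω ×ˢ ({t} : Set ℝ)) := fun v w =>
        (R.c2 v w).mono (prod_mono le_rfl (singleton_subset_iff.2 ht0))
      refine continuousOn_pi.2 fun i => continuousOn_pi.2 fun j => ?_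
      simp only [hMat, Matrix.of_apply]
      refine continuousOn_const.mul (ContinuousOn.add ?_ (continuousOn_const.mul ?_))
      · exact Complex.continuous_ofReal.comp_continuousOn ((c2 _ _).add (c2 _ _))
      · exact Complex.continuous_ofReal.comp_continuousOn ((c2 _ _).sub (c2 _ _))
    exact Complex.continuous_re.comp_continuousOn ((continuous_id.matrix_det).comp_continuousOn hm)
  refine cl_le (S := closure Ω ×ˢ ({t} : Set ℝ)) (R := Ω ×ˢ ({t} : Set ℝ)) hc continuousOn_const
    (prod_mono subset_closure le_rfl) (cl_prod subset_closure) ?_ (p, t) ⟨hp, rfl⟩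
  rintro ⟨z, t'⟩ ⟨hz, ht'⟩
  have e : t' = t := ht'
  subst e
  have : (fun v w => u2 v w (z, t')) = D2 u (z, t') := by
    funext v w
    exact R.i2 v w _ ⟨hz, ht0⟩
  simp only [this]
  exact (P.det_bd hs EE hz ht).2

theorem est_bdry (D : Dom Ω ρ O δ c C) (hn : 0 < n) (hT : 0 < T) (hK : 1 ≤ K) {s A : ℝ} (hs : 0 < s) (hA : 1 ≤ A) : ∃ B0 : ℝ, 0 ≤ B0 ∧
    ∀ u F φ, Pk Ω ρ O δ c C T K u F φ → E3 Ω ρ T s A u F φ → ∀ u1 u2 ut, Reg Ω T u u1 u2 ut →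
    ∀ p ∈ frontier Ω, ∀ t ∈ Ico s T,
    ∑ α, (u2 (cvec n α 1) (cvec n α 1) (p, t) + u2 (cvec n α I) (cvec n α I) (p, t)) ≤ B0 := by
  have hC := D.hC
  obtain ⟨c0, hc0, htan⟩ := est_tan (T := T) D hK hs hA
  obtain ⟨Am, hAm, hmixed⟩ := est_mixed D hT hK hs
  refine ⟨4 * (n * (Real.exp A * (n / (c0 / 8)) ^ (n - 1))) + n * (4 * (Am + A * C + 2 * K) ^ 2 / c0 + c0 / 2
    + 2 * (A * C + K) + 2 * (Am + A * C + 2 * K)), by positivity, ?_⟩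
  intro u F φ P EE u1 u2 ut Ru p hp t ht
  obtain ⟨k1, k2, kt, Rk⟩ := P.rp
  have R := Ru.sub D.op Rk
  have hpc : p ∈ closure Ω := frontier_subset_closure hp
  have hpO : p ∈ O := D.cl_sub hpc
  have ht0 : t ∈ Ioo (0:ℝ) T := ⟨lt_of_lt_of_le hs ht.1, ht.2⟩
  obtain ⟨ν, γ, hν, hγ, hγC, hg⟩ := D.grad p hp
  have Bu := Ru.bil D.op (p, t) ⟨hpc, ht0⟩
  have Bw := R.bil D.op (p, t) ⟨hpc, ht0⟩
  have hkb : ∀ v w, |k2 v w (p, t)| ≤ K * ‖v‖ * ‖w‖ := fun v w => P.φ2_bd Rk v w (p, t) ⟨hpc, ht0⟩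
  obtain ⟨b, hbA, -, hb2⟩ := P.tan2 hs EE.bb R hp ht
  have hb2' : ∀ τ τ', dd τ ρ p = 0 → dd τ' ρ p = 0 → |u2 τ τ' (p, t) - k2 τ τ' (p, t)| ≤ A * (C * ‖τ‖ * ‖τ'‖) := by
    intro τ τ' h1 h2
    have e : u2 τ τ' (p, t) - k2 τ τ' (p, t) = b * dd τ (dd τ' ρ) p := hb2 τ τ' h1 h2
    rw [e, abs_mul]
    exact mul_le_mul hbA (D.dd2_le hpO τ τ') (abs_nonneg _) (by linarith)
  have hnJ : ∀ ξ : Cn n, ‖I • ξ‖ = ‖ξ‖ := fun ξ => by rw [norm_smul, Complex.norm_I, one_mul]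
  have t1 : ∀ ξ, inner ℂ ν ξ = 0 → dd ξ ρ p = 0 := fun ξ h0 => by rw [hg, h0]; simp
  have t2 : ∀ ξ, inner ℂ ν ξ = 0 → dd (I • ξ) ρ p = 0 := fun ξ h0 => by rw [hg, inner_smul_right, h0]; simp
  refine trace_alg hn Bu hν hc0 (by positivity) (by positivity) (Real.exp_pos A).le ?_ ?_ ?_ (P.det_cl hs EE.e2 Ru hpc ht)
  · intro ξ h0
    rcases eq_or_ne ξ 0 with rfl | hξ
    · have : hf (fun v w => u2 v w (p, t)) 0 0 = 0 := Bu.hfBil.zero 0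
      rw [this]; simp
    · have hξ0 : 0 < ‖ξ‖ := norm_pos_iff.2 hξ
      have h1 := htan u F φ P EE u1 u2 ut k1 k2 kt Ru Rk p hp ν (‖ξ‖⁻¹ • ξ) γ hν hγ hg (by
        have : (‖ξ‖⁻¹ • ξ : Cn n) = ((‖ξ‖⁻¹ : ℝ) : ℂ) • ξ := rfl
        rw [this, inner_smul_right, h0, mul_zero]) (by
        rw [norm_smul, norm_inv, norm_norm, inv_mul_cancel₀ hξ0.ne']) t ht
      rw [Bu.hfBil.smul, Bu.hfBil.smulr] at h1
      have h2 := mul_le_mul_of_nonneg_right h1 (by positivity : 0 ≤ ‖ξ‖ ^ 2)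
      refine h2.trans (le_of_eq ?_)
      field_simp
  · intro ξ h0
    have l1 := abs_le.1 (hb2' ξ ξ (t1 ξ h0) (t1 ξ h0))
    have l2 := abs_le.1 (hb2' (I • ξ) (I • ξ) (t2 ξ h0) (t2 ξ h0))
    have l3 := abs_le.1 (hkb ξ ξ)
    have l4 := abs_le.1 (hkb (I • ξ) (I • ξ))
    rw [hnJ] at l2 l4
    unfold hf
    simp only
    linarith [l1.2, l2.2, l3.2, l4.2]
  · intro ξ h0
    have l1 : |u2 ν ξ (p, t) - k2 ν ξ (p, t)| ≤ Am * ‖ξ‖ := by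
      rcases eq_or_ne ξ 0 with rfl | hξ
      · have e := Bw.symm ν 0
        rw [Bw.zero] at e
        have e' : u2 ν 0 (p, t) - k2 ν 0 (p, t) = 0 := e
        rw [e']; simp
      · have hξ0 : 0 < ‖ξ‖ := norm_pos_iff.2 hξ
        have h1 := hmixed u F φ P _ _ _ R p hp ν (‖ξ‖⁻¹ • ξ) γ hν hγ hg (by
          rw [norm_smul, norm_inv, norm_norm, inv_mul_cancel₀ hξ0.ne']) (by
          have : dd (‖ξ‖⁻¹ • ξ) ρ p = ‖ξ‖⁻¹ * dd ξ ρ p := by simp [dd]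
          rw [this, t1 ξ h0, mul_zero]) t ht
        have e := Bw.smulr ‖ξ‖⁻¹ ν ξ
        have e' : u2 ν (‖ξ‖⁻¹ • ξ) (p, t) - k2 ν (‖ξ‖⁻¹ • ξ) (p, t) = ‖ξ‖⁻¹ * (u2 ν ξ (p, t) - k2 ν ξ (p, t)) := e
        have h1' : |u2 ν (‖ξ‖⁻¹ • ξ) (p, t) - k2 ν (‖ξ‖⁻¹ • ξ) (p, t)| ≤ Am := h1
        rw [e', abs_mul, abs_of_pos (inv_pos.2 hξ0), inv_mul_le_iff₀ hξ0] at h1'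
        linarith
    have l1 := abs_le.1 l1
    have l2 := abs_le.1 (hb2' (I • ν) (I • ξ) (D.tan_J hg) (t2 ξ h0))
    have l3 := abs_le.1 (hkb ν ξ)
    have l4 := abs_le.1 (hkb (I • ν) (I • ξ))
    rw [hnJ, hnJ, hν] at l2 l4
    rw [hν] at l3
    unfold hf
    simp only
    rw [abs_le]
    constructor <;> linarith [l1.2, l2.2, l3.2, l4.2, l1.1, l2.1, l3.1, l4.1]

end Btrace

/-! ### The interior estimate -/

section Final

variable {Ω O : Set (Cn n)} {ρ : Cn n → ℝ} {δ c C T K : ℝ} {u F φ : En n → ℝ}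

theorem HasL.fsum {ι : Type*} (s : Finset ι) {e : Fin n → Cn n} {g : ι → En n → ℝ} {p : En n} {a : ι → Cn n → ℝ} {τ σ : ι → ℝ}
    (h : ∀ i, HasL e (g i) p (a i) (τ i) (σ i)) :
    HasL e (fun q => ∑ i ∈ s, g i q) p (fun v => ∑ i ∈ s, a i v) (∑ i ∈ s, τ i) (∑ i ∈ s, σ i) := by
  classical
  induction s using Finset.induction_on with
  | empty => simpa using HasL.const e p 0
  | insert i s hi ih =>
    simp only [Finset.sum_insert hi]
    exact (h i).add ih

theorem norm_cvec_I (α : Fin n) : ‖cvec n α I‖ = 1 := by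
  simp [cvec]

theorem Pk.lap_pt (P : Pk Ω ρ O δ c C T K u F φ) {s A : ℝ} (hs : 0 < s) (hA : 1 ≤ A) (EE : E3 Ω ρ T s A u F φ) {z : Cn n} {t : ℝ}
    (hz : z ∈ Ω) (ht : t ∈ Ico s T) {v : En n → ℝ}
    (hv : v = fun q => ∑ α, (D2 u q (cvec n α 1) (cvec n α 1) + D2 u q (cvec n α I) (cvec n α I)))
    (h1 : 1 < v (z, t)) {e : Fin n → Cn n} (E : FrameAt (hMat (D2 u (z, t))) e) {C0 : ℝ}
    (hC0 : C0 = 2 * n * K * (1 + A) ^ 2 + 4 * n * Real.exp A * A) :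
    Lop e v (z, t) ≤ C0 * v (z, t) ∧
      v (z, t) ≤ C0 * (Gam e (fun x => dd (sx x) u (z, t)) (fun x => dd (sx x) u (z, t)) + SS e) ^ n := by
  have hK := P.hK
  have hn := P.hn
  have hQ := P.S.op
  have hp : (z, t) ∈ Ω ×ˢ Ioo (0:ℝ) T := ⟨hz, lt_of_lt_of_le hs ht.1, ht.2⟩
  have hcd : ∀ w : Cn n, ContDiffAt ℝ 2 (fun q => D2 u q w w) (z, t) := fun w =>
    smooth_at2 hQ (dd_smooth hQ (dd_smooth hQ P.S.su (sx w)) (sx w)) hp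
  obtain ⟨k, -, hk0, -, -, hk⟩ := P.S.dF (z, t) hp
  have hL : ∀ w : Cn n, ‖w‖ = 1 → Lop e (fun q => D2 u q w w) (z, t) ≤ k * D2 u (z, t) w w + K * (1 + A) ^ 2 := by
    intro w hw
    have a1 := (P.S.lin hp E (sx w)).2
    have a2 := hk w
    have a3 := EE.b1 z hz t ht w
    rw [hw] at a2 a3
    have a4 : K * (1 + |dd (sx w) u (z, t)|) ^ 2 ≤ K * (1 + A) ^ 2 := by
      gcongr
      linarith
    have a1' : Lop e (fun q => D2 u q w w) (z, t) ≤ dd (sx w) (dd (sx w) F) (z, t) := a1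
    have a2' : dd (sx w) (dd (sx w) F) (z, t) ≤ k * D2 u (z, t) w w + K * (1 + |dd (sx w) u (z, t)|) ^ 2 := a2
    linarith
  have hLv : Lop e v (z, t) ≤ k * v (z, t) + n * (2 * (K * (1 + A) ^ 2)) := by
    have H := HasL.fsum Finset.univ (fun α : Fin n => (HasL.of_cd e (hcd (cvec n α 1))).add (HasL.of_cd e (hcd (cvec n α I))))
    have HL := H.lop
    rw [hv]
    rw [HL, ← Finset.sum_sub_distrib, Finset.mul_sum]
    have hcard : (n:ℝ) * (2 * (K * (1 + A) ^ 2)) = ∑ _α : Fin n, (2 * (K * (1 + A) ^ 2)) := by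
      rw [Finset.sum_const, Finset.card_univ, Fintype.card_fin, nsmul_eq_mul]
    rw [hcard, ← Finset.sum_add_distrib]
    refine Finset.sum_le_sum fun α _ => ?_
    have b1 := hL _ (norm_cvec_one α)
    have b2 := hL _ (norm_cvec_I α)
    unfold Lop at b1 b2
    linarith
  have hx : 0 ≤ 2 * n * K * (1 + A) ^ 2 := by positivity
  have hy : 0 ≤ 4 * n * Real.exp A * A := by positivity
  have hG := Gam_nonneg e (fun x => dd (sx x) u (z, t))
  have hSS := SS_nonneg e
  constructor
  · have b1 : k * v (z, t) ≤ 0 := mul_nonpos_of_nonpos_of_nonneg hk0 (by linarith)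
    have b2 : 2 * n * K * (1 + A) ^ 2 * 1 ≤ 2 * n * K * (1 + A) ^ 2 * v (z, t) := mul_le_mul_of_nonneg_left h1.le hx
    have b3 : 0 ≤ 4 * n * Real.exp A * A * v (z, t) := mul_nonneg hy (by linarith)
    rw [hC0, add_mul]
    linarith
  · have b1 := E.trace_le
    rw [trace_hMat] at b1
    have b2 : v (z, t) ≤ 4 * (n * ((hMat (D2 u (z, t))).det.re * SS e ^ (n - 1))) := by
      rw [hv]
      have b1' : 1 / 4 * ∑ α, (D2 u (z, t) (cvec n α 1) (cvec n α 1) + D2 u (z, t) (cvec n α I) (cvec n α I))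
        ≤ n * ((hMat (D2 u (z, t))).det.re * SS e ^ (n - 1)) := b1
      simp only
      linarith
    have b3 := (P.det_bd hs EE.e2 hz ht).2
    have b4 := EE.e2.lS z hz t ht e E
    have b5 : SS e ^ (n - 1) ≤ A * SS e ^ n := by
      calc SS e ^ (n - 1) = 1 * SS e ^ (n - 1) := by ring
        _ ≤ (A * SS e) * SS e ^ (n - 1) := by gcongr
        _ = A * SS e ^ (n - 1 + 1) := by ring
        _ = A * SS e ^ n := by rw [Nat.sub_add_cancel hn]
    have b6 : SS e ^ n ≤ (Gam e (fun x => dd (sx x) u (z, t)) (fun x => dd (sx x) u (z, t)) + SS e) ^ n := by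
      gcongr
      linarith
    have b7 : 0 ≤ (Gam e (fun x => dd (sx x) u (z, t)) (fun x => dd (sx x) u (z, t)) + SS e) ^ n := by positivity
    calc v (z, t) ≤ 4 * (n * ((hMat (D2 u (z, t))).det.re * SS e ^ (n - 1))) := b2
      _ ≤ 4 * (n * (Real.exp A * SS e ^ (n - 1))) := by gcongr
      _ ≤ 4 * (n * (Real.exp A * (A * SS e ^ n))) := by gcongr
      _ ≤ 4 * (n * (Real.exp A * (A * (Gam e (fun x => dd (sx x) u (z, t)) (fun x => dd (sx x) u (z, t)) + SS e) ^ n))) := by gcongr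
      _ = (4 * n * Real.exp A * A) * (Gam e (fun x => dd (sx x) u (z, t)) (fun x => dd (sx x) u (z, t)) + SS e) ^ n := by ring
      _ ≤ _ := by
        rw [hC0]
        refine mul_le_mul_of_nonneg_right ?_ b7
        linarith

theorem est_lap (D : Dom Ω ρ O δ c C) (hn : 0 < n) (hT : 0 < T) (hK : 1 ≤ K) {s : ℝ} (hs : 0 < s) : ∃ M : ℝ, 1 ≤ M ∧
    ∀ u F φ, Pk Ω ρ O δ c C T K u F φ → ∀ z ∈ Ω, ∀ t ∈ Ico s T,
    (t - s) ^ n * ∑ α, (D2 u (z, t) (cvec n α 1) (cvec n α 1) + D2 u (z, t) (cvec n α I) (cvec n α I)) ≤ M := by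
  obtain ⟨A, hA, hgrad⟩ := est_grad D T K hs
  obtain ⟨B0, hB0, hb⟩ := est_bdry D hn hT hK hs hA
  obtain ⟨C0, hC0⟩ : ∃ C0, C0 = 2 * n * K * (1 + A) ^ 2 + 4 * n * Real.exp A * A := ⟨_, rfl⟩
  have hC00 : 0 ≤ C0 := by rw [hC0]; positivity
  obtain ⟨M, hM, h⟩ := smoothing D T K hs hA hB0 hC00
  refine ⟨M, hM, ?_⟩
  intro u F φ P
  have EE := hgrad u F φ P
  obtain ⟨u1, u2, ut, R⟩ := P.ru
  have hQ := P.S.op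
  refine h u F φ P EE.e2 (fun q => ∑ α, (D2 u q (cvec n α 1) (cvec n α 1) + D2 u q (cvec n α I) (cvec n α I)))
    (fun q => ∑ α, (u2 (cvec n α 1) (cvec n α 1) q + u2 (cvec n α I) (cvec n α I) q)) ?_ ?_ ?_ ?_ ?_
  · refine ContDiffOn.sum fun α _ => ?_
    exact (dd_smooth hQ (dd_smooth hQ P.S.su (sx (cvec n α 1))) (sx (cvec n α 1))).add
      (dd_smooth hQ (dd_smooth hQ P.S.su (sx (cvec n α I))) (sx (cvec n α I)))
  · exact continuousOn_finset_sum _ fun α _ => (R.c2 _ _).add (R.c2 _ _)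
  · intro p hp
    exact Finset.sum_congr rfl fun α _ => by rw [R.i2 _ _ p hp, R.i2 _ _ p hp]
  · intro z hz t ht
    exact hb u F φ P EE u1 u2 ut R z hz t ht
  · intro z hz t ht h1 e E
    exact P.lap_pt hs hA EE hz ht rfl h1 E hC0

theorem Sol.mono {Cf Cf' : ℝ} (h : Cf ≤ Cf') (S : Sol Ω T Cf u F) : Sol Ω T Cf' u F where
  op := S.op
  su := S.su
  sF := S.sF
  pos := S.pos
  eq := S.eq
  bF p hp := (S.bF p hp).trans h
  dF p hp := by
    obtain ⟨c, h1, h2, h3, h4, h5⟩ := S.dF p hp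
    refine ⟨c, by linarith, h2, fun ξ => (h3 ξ).trans ?_, h4.trans h, fun ξ => (h5 ξ).trans ?_⟩
    · gcongr
    · gcongr

end Final

/-! ### Assembly -/

section Assembly

theorem phi_C4b {Ω : Set (Cn n)} (hΩ : IsOpen Ω) {T K : ℝ} {φ : En n → ℝ} (sm : ContDiffOn ℝ ∞ φ (Ω ×ˢ Ioo (0:ℝ) T))
    (h : ∀ j l : ℕ, j + 2 * l ≤ 4 → ∀ z ∈ Ω, ∀ t ∈ Ioo (0 : ℝ) T,
      ‖iteratedFDeriv ℝ j (fun w => iteratedDeriv l (fun s => φ (w, s)) t) z‖ ≤ K) :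
    C4b (Ω ×ˢ Ioo (0:ℝ) T) K φ := by
  have hQ : IsOpen (Ω ×ˢ Ioo (0:ℝ) T) := hΩ.prod isOpen_Ioo
  refine C4b.of_Bk hQ sm ?_ ?_
  · rintro ⟨z, t⟩ ⟨hz, ht⟩ j hj
    have := h j 0 (by omega) z hz t ht
    simpa using this
  · rintro ⟨z, t⟩ ⟨hz, ht⟩ j hj
    have h1 := h j 1 (by omega) z hz t ht
    have e : (fun w => iteratedDeriv 1 (fun s => φ (w, s)) t) =ᶠ[𝓝 z] fun w => dd st φ (w, t) := by
      filter_upwards [hΩ.mem_nhds hz] with w hw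
      rw [iteratedDeriv_one]
      exact (deriv_slice (smooth_diff hQ sm (p := (w, t)) ⟨hw, ht⟩)).deriv
    have e2 := (e.iteratedFDeriv ℝ j).eq_of_nhds
    rw [e2] at h1
    exact h1

theorem mkPk {Ω O : Set (Cn n)} {ρ : Cn n → ℝ} {δ c C T K Cu Cφv Cf : ℝ} (D : Dom Ω ρ O δ c C) (hn : 0 < n) (hT : 0 < T)
    (hK : 1 ≤ K) (h1 : Cu ≤ K) (h2 : Cφv ≤ K) (h3 : Cf ≤ K) {u φ : En n → ℝ} {f : ℝ × Cn n × ℝ → ℝ}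
    (H : AprioriHyps n Ω T Cu Cφv Cf u φ f) : Pk Ω ρ O δ c C T K u (fun p => f (p.2, p.1, u p)) φ := by
  have S := toSol D.op H
  obtain ⟨hφ, -, hu, hc, -, -, hbd, h0, -, -, hb⟩ := H
  have hφ' : ContDiffOn ℝ ∞ φ (Ω ×ˢ Ioo (0:ℝ) T) := hφ.mono (prod_mono subset_closure Ioo_subset_Ico_self)
  exact ⟨D, S.mono h3, hn, hT, hK, (phi_C4b D.op hφ' hb).mono le_rfl h2, hbd, fun z hz => (h0 z hz).trans h1,
    reg_u D hu hc, reg_phi D hφ⟩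

end Assembly

/-- **Interior estimate of the Laplacian** (Proposition 4.4): under the a priori hypotheses,
for every `ε ∈ (0,T)` there is `D₂ = D₂(Ω, ε, T, Cφv, Cf, Cu)` such that `Δu ≤ D₂` on
`Ω×(ε,T)`. -/
theorem stmt_13 (n : ℕ) (Ω : Set (Cn n)) (T Cu Cφv Cf ε : ℝ)
    (hΩ : IsSPCDomain Ω) (hT : 0 < T) (hε : 0 < ε) (hεT : ε < T) :
    ∃ D₂ : ℝ, 0 < D₂ ∧
      ∀ (u φ : Cn n × ℝ → ℝ) (f : ℝ × Cn n × ℝ → ℝ),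
        AprioriHyps n Ω T Cu Cφv Cf u φ f →
        ∀ z ∈ Ω, ∀ t ∈ Ioo ε T, lap (fun w => u (w, t)) z ≤ D₂ := by
  rcases Nat.eq_zero_or_pos n with hn | hn
  · subst hn
    refine ⟨1, one_pos, ?_⟩
    intro u φ f H z hz t ht
    have : lap (fun w => u (w, t)) z = 0 := by simp [lap, lapW]
    rw [this]
    exact zero_le_one
  · obtain ⟨ρ, O, δ, c, C, D⟩ := Dom.exists hΩ
    obtain ⟨K, hK, h1, h2, h3⟩ : ∃ K : ℝ, 1 ≤ K ∧ Cu ≤ K ∧ Cφv ≤ K ∧ Cf ≤ K :=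
      ⟨1 + |Cu| + |Cφv| + |Cf|, by linarith [abs_nonneg Cu, abs_nonneg Cφv, abs_nonneg Cf],
        by linarith [le_abs_self Cu, abs_nonneg Cφv, abs_nonneg Cf],
        by linarith [abs_nonneg Cu, le_abs_self Cφv, abs_nonneg Cf],
        by linarith [abs_nonneg Cu, abs_nonneg Cφv, le_abs_self Cf]⟩
    have hs : 0 < ε / 2 := by positivity
    obtain ⟨M, hM, hest⟩ := est_lap D hn hT hK hs
    have hpw : 0 < (ε / 2) ^ n := by positivity
    refine ⟨M / (ε / 2) ^ n, by positivity, ?_⟩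
    intro u φ f H z hz t ht
    have P := mkPk D hn hT hK h1 h2 h3 H
    have ht' : t ∈ Ico (ε / 2) T := ⟨by linarith [ht.1], ht.2⟩
    have hp : (z, t) ∈ Ω ×ˢ Ioo (0:ℝ) T := ⟨hz, by linarith [ht.1], ht.2⟩
    have key := hest u _ φ P z hz t ht'
    rw [lap_slice (smooth_at2 P.S.op P.S.su hp)]
    rcases le_total (∑ α, (D2 u (z, t) (cvec n α 1) (cvec n α 1) + D2 u (z, t) (cvec n α I) (cvec n α I))) 0 with hneg | hpos
    · exact hneg.trans (by positivity)
    · rw [le_div_iff₀ hpw, mul_comm]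
      refine le_trans (mul_le_mul_of_nonneg_right ?_ hpos) key
      have : ε / 2 ≤ t - ε / 2 := by linarith [ht.1]
      gcongr
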